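/- Let h be a nontrivial attractor–repellor map of S², viewed as an orientation- and end-preserving homeomorphism of the open annulus 𝔸 = S¹ × ℝ, with lift h̃. Let q > 0 and let p₁, p₂ be integers with p₁ + 1 < p₂, and let C₀ be a chain transitive class of h. Assume there are points x₁, x₂ ∈ C₀ with lifts x̃₁, x̃₂ such that h̃^q(x̃₁) = T^{p₁}(x̃₁) and h̃^q(x̃₂) = T^{p₂}(x̃₂). Let H be a C^∞ complete Lyapunov function of h with H(C₀) = {0}, and let −a′ < 0 and a > 0 be values of H that are both dynamically regular and regular values of the smooth function H. Then there is a point x in the subsurface H^{−1}([−a′, a]) with a lift x̃ such that h̃^q(x̃) = T^{p₁+1}(x̃). -/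

import Mathlib

noncomputable section

open Metric Set Function Filter MeasureTheory Topology Manifold

/-- The circle `ℝ/ℤ`. -/
abbrev Circle1 : Type := AddCircle (1 : ℝ)

/-- The open annulus `𝔸 = S¹ × ℝ`. -/
abbrev Ann : Type := Circle1 × ℝ

/-- The universal covering map `π : ℝ² → 𝔸`, `π(x,t) = (x mod 1, t)`. -/
def annP : ℝ × ℝ → Ann := fun p => ((p.1 : Circle1), p.2)

/-- The `k`-th power of the generating deck transformation `T(x,t) = (x+1,t)`. -/
def deckPow (k : ℤ) : ℝ × ℝ → ℝ × ℝ := fun p => (p.1 + (k : ℝ), p.2)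

/-- `ht` is a (continuous) lift of the annulus map `hA` through `annP`. -/
def IsAnnulusLift (hA : Ann → Ann) (ht : ℝ × ℝ → ℝ × ℝ) : Prop :=
  Continuous ht ∧ ∀ p : ℝ × ℝ, annP (ht p) = hA (annP p)

/-- `φ : 𝔸 → ℝ` is the (continuous) descent of `Π₁ ∘ h̃ − Π₁` to the annulus. -/
def DescendsTo (ht : ℝ × ℝ → ℝ × ℝ) (φ : Ann → ℝ) : Prop :=
  Continuous φ ∧ ∀ p : ℝ × ℝ, φ (annP p) = (ht p).1 - p.1

/-- Rotation number of a periodic point `x` of period `q`: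
`rot(h̃, x) = (1/q) Σ_{i<q} φ(h^i(x))`. -/
def rotPer (hA : Ann → Ann) (φ : Ann → ℝ) (q : ℕ) (x : Ann) : ℝ :=
  (∑ i ∈ Finset.range q, φ (hA^[i] x)) / (q : ℝ)

/-- Rotation number of an invariant measure: `rot(h̃, μ) = ∫ φ dμ`. -/
def rotMeas (φ : Ann → ℝ) (μ : Measure Ann) : ℝ := ∫ z, φ z ∂μ

/-- The rotation set over the invariant Borel probability measures supported on `K`. -/
def rotSet (hA : Ann → Ann) (φ : Ann → ℝ) (K : Set Ann) : Set ℝ :=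
  {r | ∃ μ : Measure Ann, IsProbabilityMeasure μ ∧ μ.map hA = μ ∧ μ Kᶜ = 0 ∧ r = rotMeas φ μ}

/-- `h` is isotopic to the identity (through homeomorphisms). -/
def IsotopicToId {X : Type*} [TopologicalSpace X] (h : X ≃ₜ X) : Prop :=
  ∃ F : ℝ → X ≃ₜ X, Continuous (fun p : ℝ × X => F p.1 p.2) ∧
    F 0 = Homeomorph.refl X ∧ F 1 = h

/-- `hA` preserves each of the two ends of the annulus. -/
def EndPreserving (hA : Ann → Ann) : Prop :=
  Tendsto (fun p : Ann => (hA p).2) (comap Prod.snd atTop) atTop ∧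
  Tendsto (fun p : Ann => (hA p).2) (comap Prod.snd atBot) atBot

/-- Orientation- and end-preserving homeomorphism of the annulus. -/
def OrientEndPreserving (hA : Ann ≃ₜ Ann) : Prop :=
  IsotopicToId hA ∧ EndPreserving ⇑hA

/-- `z 0, z 1, …, z r` is an `ε`-chain of `h` (of length `r ≥ 1`). -/
def IsEpsChain {X : Type*} [MetricSpace X] (h : X → X) (ε : ℝ) (r : ℕ) (z : ℕ → X) : Prop :=
  1 ≤ r ∧ ∀ i < r, dist (h (z i)) (z (i + 1)) < ε

/-- There is an `ε`-chain of `h` from `x` to `y`. -/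
def EpsChainFromTo {X : Type*} [MetricSpace X] (h : X → X) (ε : ℝ) (x y : X) : Prop :=
  ∃ r z, IsEpsChain h ε r z ∧ z 0 = x ∧ z r = y

/-- `x` is chain recurrent for `h`. -/
def ChainRecurrent {X : Type*} [MetricSpace X] (h : X → X) (x : X) : Prop :=
  ∀ ε > 0, EpsChainFromTo h ε x x

/-- `x` and `y` are chain transitive (`x ∼ y`). -/
def ChainEquiv {X : Type*} [MetricSpace X] (h : X → X) (x y : X) : Prop :=
  ChainRecurrent h x ∧ ChainRecurrent h y ∧
    ∀ ε > 0, EpsChainFromTo h ε x y ∧ EpsChainFromTo h ε y x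

/-- `C₀` is a chain transitive class of `h`. -/
def IsChainClass {X : Type*} [MetricSpace X] (h : X → X) (C₀ : Set X) : Prop :=
  ∃ x, ChainRecurrent h x ∧ C₀ = {y | ChainEquiv h x y}
/-- The standard 2-sphere. -/
abbrev S2 : Type := ↥(Metric.sphere (0 : EuclideanSpace ℝ (Fin 3)) 1)

instance : Fact (Module.finrank ℝ (EuclideanSpace ℝ (Fin 3)) = 2 + 1) := ⟨by simp⟩

/-- An open disk in `S²`: an open set homeomorphic to the open unit 2-disc. -/
def IsOpenDisk (V : Set S2) : Prop :=
  IsOpen V ∧ Nonempty (↥V ≃ₜ ↥(Metric.ball (0 : EuclideanSpace ℝ (Fin 2)) 1))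

/-- `a` is an attractor of `h` with basin `W`. -/
def AttractorWithBasin (h : S2 ≃ₜ S2) (a : S2) (W : Set S2) : Prop :=
  h a = a ∧ ∃ V : Set S2, IsOpenDisk V ∧ a ∈ V ∧ h '' closure V ⊆ V ∧
    (⋂ i : ℕ, (⇑h)^[i] '' V) = {a} ∧ W = ⋃ i : ℕ, (⇑h.symm)^[i] '' V

/-- `h` is a nontrivial attractor-repellor map of `S²`, with repellor `pinf` of basin
`Winf` and attractor `minf` of basin `Wminf`. -/
structure IsNontrivAR (h : S2 ≃ₜ S2) (pinf minf : S2) (Winf Wminf : Set S2) : Prop where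
  distinct : pinf ≠ minf
  orient : IsotopicToId h
  attractor : AttractorWithBasin h minf Wminf
  repellor : AttractorWithBasin h.symm pinf Winf
  nontrivial : (Set.univ \ (Wminf ∪ Winf)).Nonempty
  basins_meet : (Wminf ∩ Winf).Nonempty
/-- The chain recurrent set of `h`. -/
def chainRecSet (h : S2 → S2) : Set S2 := {x | ChainRecurrent h x}

/-- `H` is a complete Lyapunov function of `h`. -/
def IsCompleteLyapunov (h : S2 → S2) (H : S2 → ℝ) : Prop :=
  Continuous H ∧
  (∀ x, ¬ ChainRecurrent h x → H (h x) < H x) ∧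
  (∀ x y, ChainRecurrent h x → ChainRecurrent h y → (H x = H y ↔ ChainEquiv h x y)) ∧
  IsClosed (H '' chainRecSet h) ∧ volume (H '' chainRecSet h) = 0

/-- `c` is a regular value of the smooth function `H : S² → ℝ`. -/
def IsRegularValue (H : S2 → ℝ) (c : ℝ) : Prop :=
  ∀ x : S2, H x = c → Function.Surjective ⇑(mfderiv (𝓡 2) 𝓘(ℝ, ℝ) H x)

/-- Continuous logarithms lift along homotopies. -/
theorem exists_log_homotopy {Y : Type*} [TopologicalSpace Y] (F : unitInterval → Y → ℂ)
    (hF : Continuous (uncurry F)) (hne : ∀ t y, F t y ≠ 0) (l0 : Y → ℂ) (hl0 : Continuous l0)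
    (h0 : ∀ y, Complex.exp (l0 y) = F 0 y) :
    ∃ l : unitInterval → Y → ℂ, Continuous (uncurry l) ∧
      (∀ t y, Complex.exp (l t y) = F t y) ∧ ∀ y, l 0 y = l0 y := by
  let H : C(unitInterval × Y, {z : ℂ // z ≠ 0}) :=
    ⟨fun p => ⟨F p.1 p.2, hne p.1 p.2⟩, by
      exact Continuous.subtype_mk hF _⟩
  let f : C(Y, ℂ) := ⟨l0, hl0⟩
  have H0 : ∀ a, H (0, a) = (fun z : ℂ ↦ (⟨_, z.exp_ne_zero⟩ : {z : ℂ // z ≠ 0})) (f a) := by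
    intro a
    exact Subtype.ext (h0 a).symm
  refine ⟨fun t y => Complex.isCoveringMap_exp.liftHomotopy H f H0 (t, y), ?_, ?_, ?_⟩
  · exact (Complex.isCoveringMap_exp.liftHomotopy H f H0).continuous
  · intro t y
    have := congrFun (Complex.isCoveringMap_exp.liftHomotopy_lifts H f H0) (t, y)
    exact congrArg Subtype.val this
  · intro y
    exact Complex.isCoveringMap_exp.liftHomotopy_zero H f H0 y

/-- A nonvanishing continuous function on a real topological vector space has a logarithm. -/
theorem exists_log_of_ne_zero {E : Type*} [AddCommGroup E] [Module ℝ E] [TopologicalSpace E]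
    [ContinuousSMul ℝ E] (g : E → ℂ) (hg : Continuous g) (hne : ∀ x, g x ≠ 0) :
    ∃ l : E → ℂ, Continuous l ∧ ∀ x, Complex.exp (l x) = g x := by
  obtain ⟨l, hl, hexp, -⟩ := exists_log_homotopy (fun (t : unitInterval) (x : E) => g ((t : ℝ) • x))
    (hg.comp (by fun_prop)) (fun t y => hne _) (fun _ => Complex.log (g 0)) continuous_const
    (fun y => by simp [Complex.exp_log (hne 0)])
  refine ⟨fun x => l 1 x, hl.comp (by fun_prop : Continuous fun x : E => ((1 : unitInterval), x)), ?_⟩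
  intro x
  simpa using hexp 1 x

theorem eqOn_of_exp_eq_one {Y : Type*} [TopologicalSpace Y] {S : Set Y} (hS : IsPreconnected S)
    {d : Y → ℂ} (hd : ContinuousOn d S) (h1 : ∀ x ∈ S, Complex.exp (d x) = 1) {x y : Y}
    (hx : x ∈ S) (hy : y ∈ S) : d x = d y := by
  have hpi : (2 * Real.pi * Complex.I : ℂ) ≠ 0 := Complex.two_pi_I_ne_zero
  have hdisc : DiscreteTopology (AddSubgroup.zmultiples (2 * Real.pi * Complex.I : ℂ)) :=
    NormedSpace.discreteTopology_zmultiples _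
  refine hS.constant_of_mapsTo (T := (AddSubgroup.zmultiples (2 * Real.pi * Complex.I : ℂ) : Set ℂ))
    ⟨hdisc⟩ hd ?_ hx hy
  intro z hz
  obtain ⟨n, hn⟩ := Complex.exp_eq_one_iff.1 (h1 z hz)
  exact ⟨n, by simp [hn]⟩

/-- Two continuous logarithms of the same function that agree at a point agree. -/
theorem log_unique {Y : Type*} [TopologicalSpace Y] {S : Set Y} (hS : IsPreconnected S)
    {a b : Y → ℂ} (ha : ContinuousOn a S) (hb : ContinuousOn b S)
    (hab : ∀ x ∈ S, Complex.exp (a x) = Complex.exp (b x)) {x : Y} (hx : x ∈ S) (hxe : a x = b x)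
    {y : Y} (hy : y ∈ S) : a y = b y := by
  have := eqOn_of_exp_eq_one hS (ha.sub hb) (fun z hz => by
    simp [Complex.exp_sub, hab z hz]) hx hy
  simp only [hxe, sub_self, Pi.sub_apply] at this
  exact (sub_eq_zero.1 this.symm)

/-- The difference of two continuous logarithms of the same function is constant. -/
theorem log_sub_const {Y : Type*} [TopologicalSpace Y] {S : Set Y} (hS : IsPreconnected S)
    {a b : Y → ℂ} (ha : ContinuousOn a S) (hb : ContinuousOn b S)
    (hab : ∀ x ∈ S, Complex.exp (a x) = Complex.exp (b x)) {x y : Y} (hx : x ∈ S)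
    (hy : y ∈ S) : a x - b x = a y - b y :=
  eqOn_of_exp_eq_one hS (ha.sub hb) (fun z hz => by simp [Complex.exp_sub, hab z hz]) hx hy

/-- Continuous logarithms lift along homotopies of functions defined on a set. -/
theorem exists_log_homotopyOn {Y : Type*} [TopologicalSpace Y] {S : Set Y}
    (F : unitInterval → Y → ℂ) (hF : ContinuousOn (uncurry F) (univ ×ˢ S))
    (hne : ∀ t, ∀ y ∈ S, F t y ≠ 0) (l0 : Y → ℂ) (hl0 : ContinuousOn l0 S)
    (h0 : ∀ y ∈ S, Complex.exp (l0 y) = F 0 y) :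
    ∃ l : unitInterval → Y → ℂ, ContinuousOn (uncurry l) (univ ×ˢ S) ∧
      (∀ t, ∀ y ∈ S, Complex.exp (l t y) = F t y) ∧ ∀ y ∈ S, l 0 y = l0 y := by
  classical
  obtain ⟨l, hl, hexp, hz⟩ := exists_log_homotopy (Y := S) (fun t y => F t y)
    (by
      have : Continuous fun p : unitInterval × S => ((p.1, (p.2 : Y)) : unitInterval × Y) := by
        fun_prop
      exact hF.comp_continuous this (fun p => ⟨mem_univ _, p.2.2⟩))
    (fun t y => hne t y y.2) (fun y => l0 y) (continuousOn_iff_continuous_domRestrict.1 hl0)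
    (fun y => h0 y y.2)
  refine ⟨fun t y => if hy : y ∈ S then l t ⟨y, hy⟩ else 0, ?_, ?_, ?_⟩
  · rw [continuousOn_iff_continuous_domRestrict]
    have : Continuous fun p : (univ ×ˢ S : Set (unitInterval × Y)) =>
        ((p.1.1, ⟨p.1.2, p.2.2⟩) : unitInterval × S) := by fun_prop
    refine (hl.comp this).congr ?_
    rintro ⟨⟨t, y⟩, hp⟩
    simp [uncurry, hp.2]
  · intro t y hy
    simp [hy, hexp]
  · intro y hy
    simp [hy, hz]

theorem continuousOn_slice {X Y Z : Type*} [TopologicalSpace X] [TopologicalSpace Y]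
    [TopologicalSpace Z] {S : Set Y} {l : X → Y → Z} (hl : ContinuousOn (uncurry l) (univ ×ˢ S))
    (t : X) : ContinuousOn (l t) S :=
  hl.comp (f := fun y => (t, y)) (by fun_prop) (fun y hy => ⟨mem_univ _, hy⟩)

theorem continuous_slice_left {X Y Z : Type*} [TopologicalSpace X] [TopologicalSpace Y]
    [TopologicalSpace Z] {S : Set Y} {l : X → Y → Z} (hl : ContinuousOn (uncurry l) (univ ×ˢ S))
    {y : Y} (hy : y ∈ S) : Continuous (fun t => l t y) :=
  hl.comp_continuous (f := fun t => (t, y)) (by fun_prop) (fun t => ⟨mem_univ _, hy⟩)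

/-- `φ` is the time-one map of an isotopy starting at the identity and supported in `U`. -/
def SupportedIsotopy (U : Set ℂ) (φ : ℂ ≃ₜ ℂ) : Prop :=
  ∃ Φ : unitInterval → ℂ → ℂ, Continuous (uncurry Φ) ∧ (∀ t, Injective (Φ t)) ∧
    (∀ t, ∀ z ∉ U, Φ t z = z) ∧ (∀ z, Φ 0 z = z) ∧ ∀ z, Φ 1 z = φ z

/-- Fixed point free homeomorphisms of an invariant plane domain with vanishing
displacement winding data. -/
structure IsBrouwerOn (f : ℂ ≃ₜ ℂ) (Ω : Set ℂ) : Prop where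
  inv : ∀ z, f z ∈ Ω ↔ z ∈ Ω
  log_disp : ∃ l : ℂ → ℂ, ContinuousOn l Ω ∧ ∀ z ∈ Ω, Complex.exp (l z) = f z - z
  log_ratio : ∃ Θ : ℂ → ℂ → ℂ, ContinuousOn (uncurry Θ) {p | p.1 ≠ p.2} ∧
    (∀ z w, z ≠ w → Complex.exp (Θ z w) = (f z - f w) / (z - w)) ∧
    ∀ z w, z ≠ w → Θ z w = Θ w z

theorem IsBrouwerOn.ne {f : ℂ ≃ₜ ℂ} {Ω : Set ℂ} (hf : IsBrouwerOn f Ω) {z : ℂ} (hz : z ∈ Ω) :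
    f z ≠ z := by
  obtain ⟨l, -, hl⟩ := hf.log_disp
  intro h
  have := hl z hz
  rw [h, sub_self] at this
  exact Complex.exp_ne_zero _ this

theorem mem_of_isotopy_mem {U : Set ℂ} {F : ℂ → ℂ} (hi : Injective F) (ho : ∀ z ∉ U, F z = z)
    {z : ℂ} : F z ∈ U ↔ z ∈ U := by
  constructor
  · intro h
    by_contra hz
    rw [ho z hz] at h
    exact hz h
  · intro h
    by_contra hz
    have := hi (ho _ hz)
    rw [this] at hz
    exact hz h

theorem SupportedIsotopy.mem_iff {U : Set ℂ} {φ : ℂ ≃ₜ ℂ} (h : SupportedIsotopy U φ) {z : ℂ} :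
    φ z ∈ U ↔ z ∈ U := by
  obtain ⟨Φ, -, hi, ho, -, h1⟩ := h
  rw [← h1]
  exact mem_of_isotopy_mem (hi 1) (ho 1)

theorem SupportedIsotopy.eq_self {U : Set ℂ} {φ : ℂ ≃ₜ ℂ} (h : SupportedIsotopy U φ) {z : ℂ}
    (hz : z ∉ U) : φ z = z := by
  obtain ⟨Φ, -, hi, ho, -, h1⟩ := h
  rw [← h1, ho 1 z hz]

theorem SupportedIsotopy.refl (U : Set ℂ) : SupportedIsotopy U (Homeomorph.refl ℂ) :=
  ⟨fun _ z => z, by fun_prop, fun _ => injective_id, fun _ _ _ => rfl, fun _ => rfl, fun _ => rfl⟩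

theorem SupportedIsotopy.trans {U : Set ℂ} {φ ψ : ℂ ≃ₜ ℂ} (hφ : SupportedIsotopy U φ)
    (hψ : SupportedIsotopy U ψ) : SupportedIsotopy U (φ.trans ψ) := by
  obtain ⟨Φ, hc, hi, ho, h0, h1⟩ := hφ
  obtain ⟨Ψ, hc', hi', ho', h0', h1'⟩ := hψ
  refine ⟨fun t z => Ψ t (Φ t z), ?_, fun t => (hi' t).comp (hi t), ?_, ?_, ?_⟩
  · exact hc'.comp (continuous_fst.prodMk hc)
  · intro t z hz
    change Ψ t (Φ t z) = z
    rw [ho t z hz, ho' t z hz]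
  · intro z
    change Ψ 0 (Φ 0 z) = z
    rw [h0, h0']
  · intro z
    change Ψ 1 (Φ 1 z) = ψ (φ z)
    rw [h1, h1']

theorem IsBrouwerOn.trans_isotopy {f φ : ℂ ≃ₜ ℂ} {Ω U : Set ℂ} (hf : IsBrouwerOn f Ω)
    (hU : U ⊆ Ω) (hfree : ∀ z ∈ U, f z ∉ U) (hφ : SupportedIsotopy U φ) :
    IsBrouwerOn (f.trans φ) Ω := by
  have hφ' := hφ
  obtain ⟨Φ, hc, hi, ho, h0, h1⟩ := hφ
  obtain ⟨l, hl, hle⟩ := hf.log_disp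
  obtain ⟨Θ, hΘ, hΘe, hΘs⟩ := hf.log_ratio
  refine ⟨?_, ?_, ?_⟩
  · intro z
    change φ (f z) ∈ Ω ↔ _
    rw [← hf.inv z]
    by_cases hz : f z ∈ U
    · exact iff_of_true (hU (hφ'.mem_iff.2 hz)) (hU hz)
    · rw [hφ'.eq_self hz]
  · obtain ⟨m, hm, hme, -⟩ := exists_log_homotopyOn (S := Ω) (fun t z => Φ t (f z) - z)
      (by
        have : Continuous fun p : unitInterval × ℂ => Φ p.1 (f p.2) :=
          hc.comp (continuous_fst.prodMk (f.continuous.comp continuous_snd))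
        exact (this.sub continuous_snd).continuousOn)
      (by
        intro t z hz h
        have h := sub_eq_zero.1 h
        by_cases hfz : f z ∈ U
        · have := (mem_of_isotopy_mem (hi t) (ho t)).2 hfz
          rw [h] at this
          exact hfree z this hfz
        · rw [ho t _ hfz] at h
          exact hf.ne hz h) l hl (fun z hz => by rw [hle z hz, h0])
    exact ⟨m 1, continuousOn_slice hm 1, fun z hz => by rw [hme 1 z hz, h1]; rfl⟩
  · set S : Set (ℂ × ℂ) := {p | p.1 ≠ p.2} with hS
    have hsub : ∀ p ∈ S, p.1 - p.2 ≠ 0 := fun p hp => sub_ne_zero.2 hp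
    obtain ⟨m, hm, hme, hm0⟩ := exists_log_homotopyOn (S := S)
      (fun t p => (Φ t p.1 - Φ t p.2) / (p.1 - p.2))
      (by
        have c1 : Continuous fun p : unitInterval × (ℂ × ℂ) => Φ p.1 p.2.1 :=
          hc.comp (by fun_prop : Continuous fun p : unitInterval × (ℂ × ℂ) => (p.1, p.2.1))
        have c2 : Continuous fun p : unitInterval × (ℂ × ℂ) => Φ p.1 p.2.2 :=
          hc.comp (by fun_prop : Continuous fun p : unitInterval × (ℂ × ℂ) => (p.1, p.2.2))
        refine ContinuousOn.div (c1.sub c2).continuousOn (by fun_prop) ?_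
        rintro ⟨t, p⟩ hp
        exact hsub p hp.2)
      (fun t p hp => div_ne_zero (sub_ne_zero.2 ((hi t).ne hp)) (hsub p hp))
      (fun _ => 0) continuousOn_const (fun p hp => by
        simp only [h0, Complex.exp_zero]
        rw [div_self (hsub p hp)])
    have hsymm : ∀ p ∈ S, m 1 p = m 1 p.swap := by
      intro p hp
      have hp' : p.swap ∈ S := fun h => hp h.symm
      refine log_unique (S := univ) (a := fun t => m t p) (b := fun t => m t p.swap) isPreconnected_univ
        (continuous_slice_left hm hp).continuousOn (continuous_slice_left hm hp').continuousOn
        ?_ (mem_univ 0) ?_ (mem_univ 1)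
      · intro t _
        simp only [hme t p hp, hme t _ hp', Prod.fst_swap, Prod.snd_swap]
        rw [← neg_sub (Φ t p.2), ← neg_sub p.2, neg_div_neg_eq]
      · simp only [hm0 p hp, hm0 _ hp']
    refine ⟨fun z w => m 1 (f z, f w) + Θ z w, ?_, ?_, ?_⟩
    · refine ContinuousOn.add ?_ hΘ
      refine (continuousOn_slice hm 1).comp (f := fun p : ℂ × ℂ => (f p.1, f p.2)) ?_ ?_
      · exact (by fun_prop : Continuous fun p : ℂ × ℂ => (f p.1, f p.2)).continuousOn
      · intro p hp
        exact f.injective.ne hp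
    · intro z w hzw
      have hfz : f z ≠ f w := f.injective.ne hzw
      rw [Complex.exp_add, hme 1 (f z, f w) hfz, hΘe z w hzw, h1, h1]
      have := sub_ne_zero.2 hfz
      have := sub_ne_zero.2 hzw
      simp only [Homeomorph.trans_apply]
      field_simp
    · intro z w hzw
      have hfz : f z ≠ f w := f.injective.ne hzw
      change m 1 (f z, f w) + Θ z w = m 1 (f w, f z) + Θ w z
      rw [hsymm (f z, f w) hfz, hΘs z w hzw]
      rfl

/-- A small translation cut off to a ball. -/
theorem exists_supportedIsotopy_ball {U : Set ℂ} {c v : ℂ} {r : ℝ} (hU : ball c r ⊆ U)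
    (hv : ‖v‖ < r) : ∃ φ, SupportedIsotopy U φ ∧ φ c = c + v := by
  have hr : 0 < r := (norm_nonneg v).trans_lt hv
  let β : ℂ → ℝ := fun z => max (1 - ‖z - c‖ / r) 0
  have hβc : Continuous β := by fun_prop
  have hβ : ∀ z w, |β z - β w| ≤ ‖z - w‖ / r := by
    intro z w
    refine (abs_max_sub_max_le_abs _ _ _).trans ?_
    rw [show (1 - ‖z - c‖ / r) - (1 - ‖w - c‖ / r) = (‖w - c‖ - ‖z - c‖) / r by ring, abs_div,
      abs_of_pos hr]
    gcongr
    refine (abs_norm_sub_norm_le _ _).trans_eq ?_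
    rw [norm_sub_rev]
    congr 1
    ring
  have hlip : ∀ t : ℝ, |t| ≤ 1 → ∀ z w, ‖(t * β z : ℝ) * v - (t * β w : ℝ) * v‖ ≤
      ‖v‖ / r * ‖z - w‖ := by
    intro t ht z w
    rw [← sub_mul, norm_mul, ← Complex.ofReal_sub, Complex.norm_real, ← mul_sub, norm_mul,
      Real.norm_eq_abs, Real.norm_eq_abs]
    calc |t| * |β z - β w| * ‖v‖ ≤ 1 * (‖z - w‖ / r) * ‖v‖ := by
          gcongr
          exact hβ z w
      _ = _ := by ring
  have hk : ‖v‖ / r < 1 := (div_lt_one hr).2 hv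
  let Φ : unitInterval → ℂ → ℂ := fun t z => z + ((t : ℝ) * β z : ℝ) * v
  have hinj : ∀ t, Injective (Φ t) := by
    intro t z w h
    have habs : |(t : ℝ)| ≤ 1 := by
      rw [abs_of_nonneg t.2.1]; exact t.2.2
    have h1 := hlip t habs w z
    have h2 : z - w = ((t : ℝ) * β w : ℝ) * v - ((t : ℝ) * β z : ℝ) * v := by
      simp only [Φ] at h
      linear_combination h
    rw [← h2, norm_sub_rev w z] at h1
    by_contra hne
    have : 0 < ‖z - w‖ := norm_pos_iff.2 (sub_ne_zero.2 hne)
    nlinarith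
  have happ : ApproximatesLinearOn (Φ 1) ((ContinuousLinearEquiv.refl ℝ ℂ : ℂ ≃L[ℝ] ℂ) : ℂ →L[ℝ] ℂ)
      univ (‖v‖ / r).toNNReal := by
    intro z _ w _
    have := hlip 1 (by simp) z w
    rw [Real.coe_toNNReal _ (by positivity)]
    refine le_of_eq_of_le ?_ this
    congr 1
    simp [Φ]
    ring
  have hsmall : Subsingleton ℂ ∨ (‖v‖ / r).toNNReal <
      ‖((ContinuousLinearEquiv.refl ℝ ℂ).symm : ℂ →L[ℝ] ℂ)‖₊⁻¹ := by
    right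
    have : ‖((ContinuousLinearEquiv.refl ℝ ℂ).symm : ℂ →L[ℝ] ℂ)‖₊ = 1 := by
      ext
      simp only [coe_nnnorm, NNReal.coe_one]
      exact ContinuousLinearMap.norm_id
    rw [this, inv_one]
    exact Real.toNNReal_lt_one.2 hk
  refine ⟨happ.toHomeomorph (Φ 1) hsmall, ⟨Φ, ?_, hinj, ?_, ?_, ?_⟩, ?_⟩
  · simp only [Φ]
    fun_prop
  · intro t z hz
    have hz' : r ≤ ‖z - c‖ := by
      by_contra h
      exact hz (hU (by simpa [dist_eq_norm] using h))
    have : β z = 0 := max_eq_right (by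
      have := (one_le_div hr).2 hz'
      linarith)
    simp [Φ, this]
  · intro z
    simp [Φ]
  · intro z
    rfl
  · change Φ 1 c = _
    simp [Φ, β]

theorem exists_supportedIsotopy {U : Set ℂ} (hU : IsOpen U) (hc : IsPreconnected U) {a b : ℂ}
    (ha : a ∈ U) (hb : b ∈ U) : ∃ φ, SupportedIsotopy U φ ∧ φ a = b := by
  let R : Set ℂ := {b | b ∈ U ∧ ∃ φ, SupportedIsotopy U φ ∧ φ a = b}
  have step : ∀ b ∈ R, ∀ r, ball b r ⊆ U → ball b r ⊆ R := by
    rintro b ⟨hb, φ, hφ, rfl⟩ r hr w hw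
    have hw' : ‖w - φ a‖ < r := by simpa [dist_eq_norm] using hw
    obtain ⟨ψ, hψ, hψe⟩ := exists_supportedIsotopy_ball hr hw'
    refine ⟨hr hw, φ.trans ψ, hφ.trans hψ, ?_⟩
    simp [hψe]
  have hRo : IsOpen R := by
    rw [Metric.isOpen_iff]
    intro b hb
    obtain ⟨r, hr, hball⟩ := Metric.isOpen_iff.1 hU b hb.1
    exact ⟨r, hr, step b hb r hball⟩
  have : U ⊆ R := by
    refine hc.subset_of_closure_inter_subset hRo ⟨a, ha, ha, _, .refl U, rfl⟩ ?_
    rintro b ⟨hbR, hbU⟩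
    obtain ⟨r, hr, hball⟩ := Metric.isOpen_iff.1 hU b hbU
    obtain ⟨b', hb', hd⟩ := Metric.mem_closure_iff.1 hbR (r / 2) (by positivity)
    refine step b' hb' (r / 2) (fun w hw => hball ?_) (by simpa using hd)
    have hw : dist w b' < r / 2 := hw
    have := dist_triangle w b' b
    rw [dist_comm b' b] at this
    rw [mem_ball]
    linarith
  exact (this hb).2

theorem preconnected_thickening {S : Set ℂ} (hS : IsPreconnected S) (δ : ℝ) :
    IsPreconnected (thickening δ S) := by
  rw [← add_ball_zero, ← image2_add, ← image_prod]
  exact (hS.prod (convex_ball _ _).isPreconnected).image _ continuous_add.continuousOn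

theorem exists_thickening_avoid {K L : Set ℂ} (hK : IsCompact K) (hL : IsCompact L) {g : ℂ → ℂ}
    (hg : Continuous g) (h : ∀ z ∈ K, g z ∉ L) :
    ∃ δ > 0, ∀ z ∈ thickening δ K, g z ∉ thickening δ L := by
  have hdis : Disjoint (g '' K) L := by
    rw [Set.disjoint_left]
    rintro _ ⟨z, hz, rfl⟩ hzL
    exact h z hz hzL
  obtain ⟨A, B, hA, hB, hKA, hLB, hAB⟩ := SeparatedNhds.of_isCompact_isCompact (hK.image hg) hL hdis
  obtain ⟨δ₁, h₁, hs₁⟩ := hK.exists_thickening_subset_open (hA.preimage hg) (image_subset_iff.1 hKA)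
  obtain ⟨δ₂, h₂, hs₂⟩ := hL.exists_thickening_subset_open hB hLB
  refine ⟨min δ₁ δ₂, lt_min h₁ h₂, fun z hz hgz => ?_⟩
  exact Set.disjoint_left.1 hAB (hs₁ (thickening_mono (min_le_left _ _) _ hz))
    (hs₂ (thickening_mono (min_le_right _ _) _ hgz))

/-- Some map of the class has a point of (not necessarily minimal) period `n`. -/
def HasBrouwerCycle (Ω : Set ℂ) (n : ℕ) : Prop :=
  ∃ (f : ℂ ≃ₜ ℂ) (z : ℂ), IsBrouwerOn f Ω ∧ z ∈ Ω ∧ f^[n] z = z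

theorem IsBrouwerOn.iterate_mem {f : ℂ ≃ₜ ℂ} {Ω : Set ℂ} (hf : IsBrouwerOn f Ω) {z : ℂ} (n : ℕ) :
    f^[n] z ∈ Ω ↔ z ∈ Ω := by
  induction n with
  | zero => simp
  | succ n ih => rw [iterate_succ_apply', hf.inv, ih]

theorem not_hasBrouwerCycle_two {Ω : Set ℂ} (hc : IsPreconnected Ω) : ¬ HasBrouwerCycle Ω 2 := by
  rintro ⟨f, z, hf, hz, hper⟩
  obtain ⟨l, hl, hle⟩ := hf.log_disp
  obtain ⟨Θ, hΘ, hΘe, hΘs⟩ := hf.log_ratio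
  have hf1 : ContinuousOn (fun z => l (f z) - l z - Θ (f z) z) Ω := by
    refine ((hl.comp f.continuous.continuousOn (fun z hz => (hf.inv z).2 hz)).sub hl).sub ?_
    exact hΘ.comp (f := fun z => (f z, z)) (by fun_prop) (fun z hz => hf.ne hz)
  have h1 : ∀ z ∈ Ω, Complex.exp (l (f z) - l z - Θ (f z) z) = 1 := by
    intro z hz
    have hfz := (hf.inv z).2 hz
    rw [Complex.exp_sub, Complex.exp_sub, hle _ hfz, hle _ hz, hΘe _ _ (hf.ne hz)]
    have a1 := sub_ne_zero.2 (hf.ne hz)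
    have a2 := sub_ne_zero.2 (hf.ne hfz)
    field_simp
  have hper : f (f z) = z := hper
  have e1 := eqOn_of_exp_eq_one hc hf1 h1 hz ((hf.inv z).2 hz)
  obtain ⟨n, hn⟩ := Complex.exp_eq_one_iff.1 (h1 z hz)
  simp only [hper] at e1
  rw [hΘs z (f z) (hf.ne hz).symm] at e1
  have e2 : Θ (f z) z = ((-n : ℤ) : ℂ) * (2 * Real.pi * Complex.I) := by
    push_cast
    linear_combination e1 / 2 - hn
  have e3 := hΘe _ _ (hf.ne hz)
  rw [e2, hper, Complex.exp_int_mul_two_pi_mul_I, ← neg_sub, neg_div,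
    div_self (sub_ne_zero.2 (hf.ne hz))] at e3
  norm_num at e3

theorem brouwer_no_return {Ω : Set ℂ} {n : ℕ} (ih : ∀ m, 1 ≤ m → m < n → ¬ HasBrouwerCycle Ω m)
    {f : ℂ ≃ₜ ℂ} (hf : IsBrouwerOn f Ω) {U : Set ℂ} (hU : IsOpen U) (hUc : IsPreconnected U)
    (hUΩ : U ⊆ Ω) (hfree : ∀ z ∈ U, f z ∉ U) {y : ℂ} (hy : y ∈ U) {j : ℕ} (hj : 1 ≤ j) (hjn : j < n) :
    f^[j] y ∉ U := by
  classical
  intro hjU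
  have hex : ∃ j, 1 ≤ j ∧ f^[j] y ∈ U := ⟨j, hj, hjU⟩
  set k := Nat.find hex with hk
  obtain ⟨hk1, hkU⟩ := Nat.find_spec hex
  rw [← hk] at hk1 hkU
  have hkj : k ≤ j := Nat.find_min' hex ⟨hj, hjU⟩
  have hmin : ∀ i, 1 ≤ i → i < k → f^[i] y ∉ U := fun i hi hik h => Nat.find_min hex hik ⟨hi, h⟩
  obtain ⟨φ, hφ, hφe⟩ := exists_supportedIsotopy hU hUc hkU hy
  refine ih k hk1 (by omega) ⟨f.trans φ, y, hf.trans_isotopy hUΩ hfree hφ, hUΩ hy, ?_⟩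
  have : ∀ i, i < k → (f.trans φ)^[i] y = f^[i] y := by
    intro i
    induction i with
    | zero => simp
    | succ i ihi =>
      intro hi
      rw [iterate_succ_apply', ihi (by omega), Homeomorph.trans_apply, ← iterate_succ_apply' f,
        hφ.eq_self (hmin _ (by omega) hi)]
  obtain ⟨i, hi⟩ : ∃ i, k = i + 1 := ⟨k - 1, by omega⟩
  rw [hi] at hφe ⊢
  rw [iterate_succ_apply', this i (by omega), Homeomorph.trans_apply, ← iterate_succ_apply' f, hφe]

/-- The leg of a disc chain: a compact connected set joining the start of a path to a point
near the path. -/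
theorem leg_properties (γ : unitInterval → ℂ) (hγ : Continuous γ) {ρ : ℝ} (hρ : 0 < ρ)
    {s τ : unitInterval} (hs : s ≤ τ) {p : ℂ} (hp : dist p (γ s) ≤ ρ) :
    ∃ S : Set ℂ, IsCompact S ∧ IsPreconnected S ∧ γ 0 ∈ S ∧ p ∈ S ∧
      ∀ z ∈ S, z = p ∨ ∃ t ≤ τ, dist z (γ t) < ρ := by
  refine ⟨γ '' Icc 0 s ∪ segment ℝ (γ s) p, ?_, ?_, ?_, ?_, ?_⟩
  · refine (isCompact_Icc.image hγ).union ?_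
    rw [segment_eq_image_lineMap]
    exact isCompact_Icc.image (by fun_prop)
  · refine IsPreconnected.union (γ s) ⟨s, ⟨s.2.1, le_rfl⟩, rfl⟩ (left_mem_segment _ _ _) ?_ ?_
    · exact isPreconnected_Icc.image _ hγ.continuousOn
    · exact (convex_segment _ _).isPreconnected
  · exact Or.inl ⟨0, ⟨le_rfl, s.2.1⟩, rfl⟩
  · exact Or.inr (right_mem_segment _ _ _)
  · rintro z (⟨t, ht, rfl⟩ | hz)
    · exact Or.inr ⟨t, ht.2.trans hs, by simpa using hρ⟩
    · rw [segment_eq_image_lineMap] at hz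
      obtain ⟨θ, hθ, rfl⟩ := hz
      rcases eq_or_lt_of_le hθ.2 with h1 | h1
      · left; rw [h1]; simp
      · right
        refine ⟨s, hs, ?_⟩
        rw [dist_comm, dist_left_lineMap, Real.norm_eq_abs, abs_of_nonneg hθ.1]
        rw [dist_comm] at hp
        have h0 := hθ.1
        nlinarith [@dist_nonneg _ _ (γ s) p]

/-- The first self-contact of a growing chain of discs along an arc from `x` to `f x`. -/
theorem exists_first_contact {f : ℂ ≃ₜ ℂ} {Ω : Set ℂ} (hf : IsBrouwerOn f Ω) (hΩ : IsOpen Ω)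
    (hc : IsConnected Ω) {x : ℂ} (hx : x ∈ Ω) :
    ∃ (D S S' : Set ℂ) (p y : ℂ), IsOpen D ∧ IsPreconnected D ∧ D ⊆ Ω ∧ (∀ z ∈ D, f z ∉ D) ∧
      p ∈ Ω ∧ y ∈ Ω ∧ f y = p ∧ p ∈ closure D ∧ y ∈ closure D ∧
      IsCompact S ∧ IsPreconnected S ∧ x ∈ S ∧ p ∈ S ∧ (∀ z ∈ S, z = p ∨ z ∈ D) ∧
      IsCompact S' ∧ IsPreconnected S' ∧ x ∈ S' ∧ y ∈ S' ∧ (∀ z ∈ S', z = y ∨ z ∈ D) := by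
  have hfx : f x ∈ Ω := (hf.inv x).2 hx
  obtain ⟨γ, hγΩ⟩ := ((hΩ.isConnected_iff_isPathConnected.1 hc).joinedIn x hx (f x) hfx)
  have hγc : Continuous γ := γ.continuous
  have hKc : IsCompact (range γ) := isCompact_range hγc
  obtain ⟨ρ₁, hρ₁, hth⟩ := hKc.exists_cthickening_subset_open hΩ (range_subset_iff.2 hγΩ)
  obtain ⟨ρ₂, hρ₂, hfr⟩ : ∃ ρ > 0, ∀ z, dist z x ≤ ρ → ρ < dist (f z) x := by
    have hne : 0 < dist (f x) x := dist_pos.2 (hf.ne hx)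
    obtain ⟨δ, hδ, hcont⟩ := Metric.continuous_iff.1 f.continuous x (dist (f x) x / 2) (by positivity)
    refine ⟨min (δ / 2) (dist (f x) x / 4), by positivity, fun z hz => ?_⟩
    have h1 := hcont z (lt_of_le_of_lt (hz.trans (min_le_left _ _)) (by linarith))
    have h2 := dist_triangle_left (f x) x (f z)
    have h3 := min_le_right (δ / 2) (dist (f x) x / 4)
    linarith
  set ρ := min ρ₁ ρ₂ with hρdef
  have hρ : 0 < ρ := lt_min hρ₁ hρ₂
  have hin : ∀ z t, dist z (γ t) ≤ ρ → z ∈ Ω := fun z t hzt =>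
    hth (mem_cthickening_of_dist_le z (γ t) _ _ ⟨t, rfl⟩ (hzt.trans (min_le_left _ _)))
  let T : Set (unitInterval × unitInterval × ℂ) :=
    {q | dist q.2.2 (γ q.1) ≤ ρ ∧ dist (f.symm q.2.2) (γ q.2.1) ≤ ρ}
  have hTc : IsCompact T := by
    refine ((isCompact_univ (X := unitInterval)).prod
      ((isCompact_univ (X := unitInterval)).prod (hKc.cthickening (r := ρ)))).of_isClosed_subset
      ?_ ?_
    · have c1 : IsClosed {q : unitInterval × unitInterval × ℂ | dist q.2.2 (γ q.1) ≤ ρ} :=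
        isClosed_le (by fun_prop) continuous_const
      have c2 : IsClosed {q : unitInterval × unitInterval × ℂ |
          dist (f.symm q.2.2) (γ q.2.1) ≤ ρ} :=
        isClosed_le ((f.symm.continuous.comp (by fun_prop)).dist (by fun_prop)) continuous_const
      exact c1.inter c2
    · rintro ⟨s, s', p⟩ hq
      exact ⟨mem_univ _, mem_univ _, mem_cthickening_of_dist_le p (γ s) _ _ ⟨s, rfl⟩ hq.1⟩
  have hTne : T.Nonempty := ⟨(1, 0, f x), by simp [T, hρ.le]⟩
  obtain ⟨⟨s, s', p⟩, ⟨hps, hps'⟩, hmin⟩ := hTc.exists_isMinOn hTne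
    (f := fun q => max q.1 q.2.1) (by fun_prop)
  simp only at hps hps'
  set τ := max s s' with hτ
  have hmin' : ∀ t t' : unitInterval, ∀ z, dist (f z) (γ t) ≤ ρ → dist z (γ t') ≤ ρ → τ ≤ max t t' := by
    intro t t' z h1 h2
    exact hmin (show (t, t', f z) ∈ T by simp [T, h1, h2])
  have hτ0 : 0 < τ := by
    by_contra h
    have h0 : τ = 0 := le_antisymm (not_lt.1 h) τ.2.1
    have hs0 : s = 0 := le_antisymm ((le_max_left s s').trans h0.le) s.2.1
    have hs0' : s' = 0 := le_antisymm ((le_max_right s s').trans h0.le) s'.2.1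
    rw [hs0, γ.source] at hps
    rw [hs0', γ.source] at hps'
    have := hfr _ (hps'.trans (min_le_right _ _))
    rw [f.apply_symm_apply] at this
    exact absurd (hps.trans (min_le_right _ _)) (not_le.2 this)
  let D : Set ℂ := ⋃ t ∈ Iic τ, ball (γ t) ρ
  have hDm : ∀ z, z ∈ D ↔ ∃ t ≤ τ, dist z (γ t) < ρ := by
    intro z; simp [D]
  have hDo : IsOpen D := isOpen_biUnion fun _ _ => isOpen_ball
  have hearly : ∀ z ∈ D, ∃ t < τ, dist z (γ t) < ρ := by
    intro z hz
    obtain ⟨t, ht, hd⟩ := (hDm z).1 hz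
    rcases lt_or_eq_of_le ht with ht | rfl
    · exact ⟨t, ht, hd⟩
    · have hev : ∀ᶠ t in 𝓝[<] τ, dist z (γ t) < ρ :=
        ((continuous_const.dist hγc).tendsto τ |>.eventually_lt_const hd).filter_mono
          nhdsWithin_le_nhds
      have : (𝓝[<] τ).NeBot := nhdsLT_neBot_of_exists_lt ⟨0, hτ0⟩
      obtain ⟨t, h1, h2⟩ := (hev.and self_mem_nhdsWithin).exists
      exact ⟨t, h2, h1⟩
  have hfree : ∀ z ∈ D, f z ∉ D := by
    intro z hz hfz
    obtain ⟨t, ht, hd⟩ := hearly z hz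
    obtain ⟨t', ht', hd'⟩ := hearly _ hfz
    exact absurd (hmin' t' t z hd'.le hd.le) (not_le.2 (max_lt ht' ht))
  have hcl : ∀ z t, t ≤ τ → dist z (γ t) ≤ ρ → z ∈ closure D := by
    intro z t ht hz
    have : z ∈ closure (ball (γ t) ρ) := by
      rw [closure_ball _ hρ.ne']; exact hz
    exact closure_mono (fun w hw => (hDm w).2 ⟨t, ht, hw⟩) this
  have hDp : IsPreconnected D := by
    have : D = thickening ρ (γ '' Iic τ) := by
      ext z
      rw [hDm, mem_thickening_iff]
      simp
    rw [this]
    have h2 : Iic τ = Icc 0 τ := by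
      ext t; exact ⟨fun h => ⟨t.2.1, h⟩, fun h => h.2⟩
    rw [h2]
    exact preconnected_thickening (isPreconnected_Icc.image _ hγc.continuousOn) ρ
  obtain ⟨S, h1, h2, h3, h4, h5⟩ := leg_properties γ hγc hρ (le_max_left s s') hps
  obtain ⟨S', h1', h2', h3', h4', h5'⟩ := leg_properties γ hγc hρ (le_max_right s s') hps'
  rw [γ.source] at h3 h3'
  refine ⟨D, S, S', p, f.symm p, hDo, hDp, ?_, hfree, hin _ _ hps, hin _ _ hps', by simp,
    hcl _ _ (le_max_left _ _) hps, hcl _ _ (le_max_right _ _) hps', h1, h2, h3, h4, ?_, h1', h2',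
    h3', h4', ?_⟩
  · intro z hz
    obtain ⟨t, -, hd⟩ := (hDm z).1 hz
    exact hin _ _ hd.le
  · intro z hz
    exact (h5 z hz).imp_right (hDm z).2
  · intro z hz
    exact (h5' z hz).imp_right (hDm z).2

/-- Brouwer's lemma: maps of the class have no periodic points in the domain. -/
theorem not_hasBrouwerCycle {Ω : Set ℂ} (hΩ : IsOpen Ω) (hc : IsConnected Ω) (n : ℕ) (hn : 1 ≤ n) :
    ¬ HasBrouwerCycle Ω n := by
  induction n using Nat.strong_induction_on with
  | _ n ihn =>
  have ih : ∀ m, 1 ≤ m → m < n → ¬ HasBrouwerCycle Ω m := fun m h1 h2 => ihn m h2 h1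
  obtain h1 | h2 | h3 : n = 1 ∨ n = 2 ∨ 3 ≤ n := by omega
  · rintro ⟨f, z, hf, hz, hper⟩
    rw [h1] at hper
    exact hf.ne hz hper
  · rw [h2]
    exact not_hasBrouwerCycle_two hc.isPreconnected
  rintro ⟨f, x, hf, hx, hper⟩
  obtain ⟨D, S, S', p, y, hDo, hDp, hDΩ, hfree, hpΩ, hyΩ, hfy, hpD, hyD, hSc, hSp, hxS, hpS, hS,
    hSc', hSp', hxS', hyS', hS'⟩ := exists_first_contact hf hΩ hc hx
  have hret := fun (f : ℂ ≃ₜ ℂ) (hf : IsBrouwerOn f Ω) => @brouwer_no_return Ω n ih f hf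
  have hpy : p ≠ y := by rw [← hfy]; exact hf.ne hyΩ
  have hfp : f p ≠ p := hf.ne hpΩ
  -- a point of the closure whose image or preimage lies in `D`
  have hcl1 : ∀ z ∈ closure D, f z ∉ D := by
    intro z hz hfz
    obtain ⟨w, hw, hwD⟩ := mem_closure_iff.1 hz _ (hDo.preimage f.continuous) hfz
    exact hfree w hwD hw
  have hcl2 : ∀ z ∈ closure D, ∀ w ∈ D, f w ≠ z := by
    rintro _ hz w hw rfl
    obtain ⟨v, hv, hvD⟩ := mem_closure_iff.1 hz _ (f.isOpenMap D hDo) ⟨w, hw, rfl⟩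
    obtain ⟨u, hu, rfl⟩ := hv
    exact hfree u hu hvD
  have hpD' : p ∉ D := by rw [← hfy]; exact hcl1 y hyD
  have hyD' : y ∉ D := fun h => hcl2 p hpD y h hfy
  have hSfree : ∀ z ∈ S, f z ∉ S := by
    intro z hz hfz
    rcases hS z hz with rfl | hzD
    · rcases hS _ hfz with h | h
      · exact hfp h
      · exact hcl1 _ hpD h
    · rcases hS _ hfz with h | h
      · exact hcl2 p hpD z hzD h
      · exact hfree z hzD h
  have hSfree' : ∀ z ∈ S', f z ∉ S' := by
    intro z hz hfz
    rcases hS' z hz with rfl | hzD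
    · rw [hfy] at hfz
      rcases hS' _ hfz with h | h
      · exact hpy h
      · exact hpD' h
    · rcases hS' _ hfz with h | h
      · exact hcl2 y hyD z hzD h
      · exact hfree z hzD h
  have hSS' : ∀ z ∈ S', f (f z) ∉ S := by
    intro z hz hfz
    rcases hS' z hz with rfl | hzD
    · rw [hfy] at hfz
      rcases hS _ hfz with h | h
      · exact hfp h
      · exact hcl1 p hpD h
    · rcases hS _ hfz with h | h
      · have : f z = y := f.injective (h.trans hfy.symm)
        exact hcl2 y hyD z hzD this
      · exact hret f hf hDo hDp hDΩ hfree hzD (j := 2) (by norm_num) (by omega) h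
  have hSΩ : S ⊆ Ω := fun z hz => (hS z hz).elim (fun h => h ▸ hpΩ) (fun h => hDΩ h)
  have hSΩ' : S' ⊆ Ω := fun z hz => (hS' z hz).elim (fun h => h ▸ hyΩ) (fun h => hDΩ h)
  obtain ⟨δ₁, h₁, ht₁⟩ := exists_thickening_avoid hSc hSc f.continuous hSfree
  obtain ⟨δ₂, h₂, ht₂⟩ := exists_thickening_avoid hSc' hSc' f.continuous hSfree'
  obtain ⟨δ₃, h₃, ht₃⟩ := exists_thickening_avoid hSc' hSc (f.continuous.comp f.continuous) hSS'
  obtain ⟨δ₄, h₄, ht₄⟩ := hSc.exists_thickening_subset_open hΩ hSΩ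
  obtain ⟨δ₅, h₅, ht₅⟩ := hSc'.exists_thickening_subset_open hΩ hSΩ'
  set δ := min (min (min δ₁ δ₂) (min δ₃ δ₄)) δ₅ with hδ
  have hδ0 : 0 < δ := by positivity
  have e1 : δ ≤ δ₁ := (min_le_left _ _).trans ((min_le_left _ _).trans (min_le_left _ _))
  have e2 : δ ≤ δ₂ := (min_le_left _ _).trans ((min_le_left _ _).trans (min_le_right _ _))
  have e3 : δ ≤ δ₃ := (min_le_left _ _).trans ((min_le_right _ _).trans (min_le_left _ _))
  have e4 : δ ≤ δ₄ := (min_le_left _ _).trans ((min_le_right _ _).trans (min_le_right _ _))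
  have e5 : δ ≤ δ₅ := min_le_right _ _
  set U := thickening δ S
  set U' := thickening δ S'
  have hUfree : ∀ z ∈ U, f z ∉ U := fun z hz h =>
    ht₁ z (thickening_mono e1 _ hz) (thickening_mono e1 _ h)
  have hUfree' : ∀ z ∈ U', f z ∉ U' := fun z hz h =>
    ht₂ z (thickening_mono e2 _ hz) (thickening_mono e2 _ h)
  have hUU' : ∀ z ∈ U', f (f z) ∉ U := fun z hz h =>
    ht₃ z (thickening_mono e3 _ hz) (thickening_mono e3 _ h)
  have hUΩ : U ⊆ Ω := (thickening_mono e4 _).trans ht₄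
  have hUΩ' : U' ⊆ Ω := (thickening_mono e5 _).trans ht₅
  have hUo : IsOpen U := isOpen_thickening
  have hUo' : IsOpen U' := isOpen_thickening
  have hUp : IsPreconnected U := preconnected_thickening hSp δ
  have hUp' : IsPreconnected U' := preconnected_thickening hSp' δ
  have hxU : x ∈ U := self_subset_thickening hδ0 _ hxS
  have hpU : p ∈ U := self_subset_thickening hδ0 _ hpS
  have hxU' : x ∈ U' := self_subset_thickening hδ0 _ hxS'
  have hyU' : y ∈ U' := self_subset_thickening hδ0 _ hyS'
  let f2 : ℂ ≃ₜ ℂ := f.trans f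
  let V := f2 '' U'
  have hVmem : ∀ z, f (f z) ∈ V ↔ z ∈ U' := fun z => f2.injective.mem_set_image (s := U') (a := z)
  have hVU : ∀ z ∈ V, z ∉ U := by
    rintro _ ⟨z, hz, rfl⟩
    exact hUU' z hz
  have hVΩ : V ⊆ Ω := by
    rintro _ ⟨z, hz, rfl⟩
    exact (hf.inv _).2 ((hf.inv _).2 (hUΩ' hz))
  have hVo : IsOpen V := f2.isOpenMap _ hUo'
  have hVp : IsPreconnected V := hUp'.image _ f2.continuous.continuousOn
  have hVfree : ∀ z ∈ V, f z ∉ V := by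
    rintro _ ⟨z, hz, rfl⟩ h
    exact hUfree' z hz ((hVmem (f z)).1 h)
  obtain ⟨φ, hφ, hφe⟩ := exists_supportedIsotopy hUo hUp hxU hpU
  have hfpV : f p ∈ V := by rw [← hfy, hVmem]; exact hyU'
  have hx2V : f (f x) ∈ V := (hVmem x).2 hxU'
  obtain ⟨ψ, hψ, hψe⟩ := exists_supportedIsotopy hVo hVp hfpV hx2V
  have hg1 := hf.trans_isotopy hVΩ hVfree hψ
  have hg2 : IsBrouwerOn ((f.trans ψ).trans φ) Ω := by
    refine hg1.trans_isotopy hUΩ ?_ hφ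
    intro z hz h
    have h : ψ (f z) ∈ U := h
    have h4 : ψ (f z) ∉ V := fun h' => hVU _ h' h
    rw [hψ.mem_iff] at h4
    rw [hψ.eq_self h4] at h
    exact hUfree z hz h
  have hxV : ∀ m, 3 ≤ m → m ≤ n → f^[m] x ∉ V := by
    intro m hm hmn h
    obtain ⟨k, rfl⟩ : ∃ k, m = k + 2 := ⟨m - 2, by omega⟩
    rw [iterate_succ_apply', iterate_succ_apply', hVmem] at h
    exact hret f hf hUo' hUp' hUΩ' hUfree' hxU' (j := k) (by omega) (by omega) h
  have hxUn : ∀ m, 1 ≤ m → m < n → f^[m] x ∉ U := fun m h1 h2 =>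
    hret f hf hUo hUp hUΩ hUfree hxU h1 h2
  refine ih (n - 1) (by omega) (by omega) ⟨(f.trans ψ).trans φ, p, hg2, hpΩ, ?_⟩
  have horb : ∀ i, i + 3 ≤ n → ((f.trans ψ).trans φ)^[i + 1] p = f^[i + 2] x := by
    intro i
    induction i with
    | zero =>
      intro _
      change φ (ψ (f p)) = f (f x)
      rw [hψe, hφ.eq_self (hVU _ hx2V)]
    | succ i ihi =>
      intro hi
      rw [iterate_succ_apply', ihi (by omega)]
      change φ (ψ (f (f^[i + 2] x))) = _
      rw [← iterate_succ_apply' f, hψ.eq_self (hxV _ (by omega) (by omega)),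
        hφ.eq_self (hxUn _ (by omega) (by omega))]
  obtain ⟨i, hi⟩ : ∃ i, n = i + 3 := ⟨n - 3, by omega⟩
  have hi' : n - 1 = (i + 1) + 1 := by omega
  rw [hi', iterate_succ_apply', horb i (by omega)]
  change φ (ψ (f (f^[i + 2] x))) = p
  rw [← iterate_succ_apply' f, hψ.eq_self (hxV _ (by omega) (by omega)), show (i + 2).succ = n by omega,
    hper, hφe]

/-- Composing with isotopies supported in disjoint free domains turns a pseudo-orbit into an
orbit. -/
theorem IsBrouwerOn.exists_shadowing {Ω : Set ℂ} {f : ℂ ≃ₜ ℂ} (hf : IsBrouwerOn f Ω) {n : ℕ}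
    (z : ℕ → ℂ) (U : ℕ → Set ℂ) (hUo : ∀ i < n, IsOpen (U i)) (hUp : ∀ i < n, IsPreconnected (U i))
    (hUΩ : ∀ i < n, U i ⊆ Ω) (hfree : ∀ i < n, ∀ w ∈ U i, f w ∉ U i)
    (hdis : ∀ i < n, ∀ j < n, i ≠ j → ∀ w ∈ U i, w ∉ U j)
    (ha : ∀ i < n, f (z i) ∈ U i) (hb : ∀ i < n, z (i + 1) ∈ U i) :
    ∃ g : ℂ ≃ₜ ℂ, IsBrouwerOn g Ω ∧ ∀ i < n, g (z i) = z (i + 1) := by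
  have key : ∀ k ≤ n, ∃ g : ℂ ≃ₜ ℂ, IsBrouwerOn g Ω ∧ (∀ i < k, g (z i) = z (i + 1)) ∧
      (∀ i < n, k ≤ i → g (z i) = f (z i)) ∧ ∀ i < n, k ≤ i → ∀ w ∈ U i, g w ∉ U i := by
    intro k
    induction k with
    | zero =>
      intro _
      exact ⟨f, hf, by simp, fun _ _ _ => rfl, fun i hi _ => hfree i hi⟩
    | succ k ih =>
      intro hk
      obtain ⟨g, hg, h1, h2, h3⟩ := ih (by omega)
      have hkn : k < n := by omega
      obtain ⟨φ, hφ, hφe⟩ := exists_supportedIsotopy (hUo k hkn) (hUp k hkn) (ha k hkn) (hb k hkn)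
      refine ⟨g.trans φ, hg.trans_isotopy (hUΩ k hkn) (h3 k hkn le_rfl) hφ, ?_, ?_, ?_⟩
      · intro i hi
        rw [Homeomorph.trans_apply]
        rcases Nat.lt_succ_iff_lt_or_eq.1 hi with hik | rfl
        · rw [h1 i hik]
          exact hφ.eq_self (hdis i (by omega) k hkn (by omega) _ (hb i (by omega)))
        · rw [h2 i hkn le_rfl, hφe]
      · intro i hi hki
        rw [Homeomorph.trans_apply, h2 i hi (by omega)]
        exact hφ.eq_self (hdis i hi k hkn (by omega) _ (ha i hi))
      · intro i hi hki w hw h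
        rw [Homeomorph.trans_apply] at h
        have h4 := hdis i hi k hkn (by omega) _ h
        rw [hφ.mem_iff] at h4
        rw [hφ.eq_self h4] at h
        exact h3 i hi (by omega) w hw h
  obtain ⟨g, hg, h1, -, -⟩ := key n le_rfl
  exact ⟨g, hg, h1⟩

/-- Franks' lemma: maps of the class have no closed pseudo-orbits with small jumps. -/
theorem IsBrouwerOn.no_closed_chain {Ω : Set ℂ} (hΩ : IsOpen Ω) (hc : IsConnected Ω) {f : ℂ ≃ₜ ℂ}
    (hf : IsBrouwerOn f Ω) {ε : ℝ} {n : ℕ} (hn : 1 ≤ n) (z : ℕ → ℂ) (hz : z n = z 0)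
    (hchain : ∀ i < n, dist (f (z i)) (z (i + 1)) < ε)
    (hball : ∀ i < n, ball (f (z i)) (2 * ε) ⊆ Ω)
    (hfree : ∀ i < n, ∀ w ∈ ball (f (z i)) (2 * ε), f w ∉ ball (f (z i)) (2 * ε)) : False := by
  induction n using Nat.strong_induction_on generalizing z with
  | _ n ih =>
  have hε : 0 < ε := dist_nonneg.trans_lt (hchain 0 (by omega))
  have hsep : ∀ i < n, ∀ j < n, i ≠ j → ε ≤ dist (f (z i)) (z (j + 1)) := by
    intro i hi j hj hij
    by_contra hlt
    rw [not_le] at hlt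
    rcases lt_or_gt_of_ne hij with h | h
    · refine ih (n - (j - i)) (by omega) (by omega)
        (fun k => if k ≤ i then z k else z (k + (j - i))) ?_ ?_ ?_ ?_
      · rw [if_neg (by omega), if_pos (Nat.zero_le _), ← hz]
        congr 1
        omega
      · intro k hk
        rcases lt_trichotomy k i with h' | rfl | h'
        · rw [if_pos h'.le, if_pos (by omega)]
          exact hchain k (by omega)
        · rw [if_pos le_rfl, if_neg (by omega), show k + 1 + (j - k) = j + 1 by omega]
          exact hlt
        · rw [if_neg (by omega), if_neg (by omega), show k + 1 + (j - i) = k + (j - i) + 1 by omega]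
          exact hchain _ (by omega)
      · intro k hk
        split_ifs
        · exact hball _ (by omega)
        · exact hball _ (by omega)
      · intro k hk
        split_ifs
        · exact hfree _ (by omega)
        · exact hfree _ (by omega)
    · refine ih (i - j) (by omega) (by omega)
        (fun k => if k = i - j then z (j + 1) else z (j + 1 + k)) ?_ ?_ ?_ ?_
      · rw [if_pos rfl, if_neg (by omega)]
      · intro k hk
        rw [if_neg (by omega)]
        split_ifs with h'
        · rw [show j + 1 + k = i by omega]
          exact hlt
        · exact hchain _ (by omega)
      · intro k hk
        rw [if_neg (by omega)]
        exact hball _ (by omega)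
      · intro k hk
        rw [if_neg (by omega)]
        exact hfree _ (by omega)
  let S : ℕ → Set ℂ := fun i => segment ℝ (f (z i)) (z (i + 1))
  have hScomp : ∀ i, IsCompact (S i) := by
    intro i
    simp only [S, segment_eq_image_lineMap]
    exact isCompact_Icc.image (by fun_prop)
  have hdist : ∀ i, ∀ w ∈ S i, dist (f (z i)) w + dist w (z (i + 1)) =
      dist (f (z i)) (z (i + 1)) := fun i w hw => dist_add_dist_of_mem_segment hw
  have hSdis : ∀ i < n, ∀ j < n, i ≠ j → ∀ w ∈ S i, w ∉ S j := by
    intro i hi j hj hij w hw hw'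
    have h1 := hdist i w hw
    have h2 := hdist j w hw'
    have h3 := hchain i hi
    have h4 := hchain j hj
    have h5 := hsep i hi j hj hij
    have h6 := hsep j hj i hi hij.symm
    have h7 := dist_triangle (f (z i)) w (z (j + 1))
    have h8 := dist_triangle (f (z j)) w (z (i + 1))
    linarith
  have hev : ∀ᶠ δ in 𝓝[>] (0 : ℝ), ∀ i ∈ Iio n, ∀ j ∈ Iio n, i ≠ j →
      ∀ w ∈ thickening δ (S i), w ∉ thickening δ (S j) := by
    rw [eventually_all_finite (finite_Iio n)]
    intro i hi
    rw [eventually_all_finite (finite_Iio n)]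
    intro j hj
    by_cases hij : i = j
    · exact Eventually.of_forall fun _ h => absurd hij h
    obtain ⟨δ, hδ, h⟩ := exists_thickening_avoid (hScomp i) (hScomp j) continuous_id
      (hSdis i hi j hj hij)
    filter_upwards [Ioo_mem_nhdsGT hδ] with δ' hδ' _ w hw hw'
    exact h w (thickening_mono hδ'.2.le _ hw) (thickening_mono hδ'.2.le _ hw')
  obtain ⟨δ, hδdis, hδ0, hδε⟩ := (hev.and (Ioo_mem_nhdsGT hε)).exists
  have hsub : ∀ i < n, thickening δ (S i) ⊆ ball (f (z i)) (2 * ε) := by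
    intro i hi w hw
    obtain ⟨v, hv, hwv⟩ := mem_thickening_iff.1 hw
    have h1 := hdist i v hv
    have h2 := hchain i hi
    have h3 := dist_triangle w v (f (z i))
    have h4 : 0 ≤ dist v (z (i + 1)) := dist_nonneg
    rw [dist_comm v] at h3
    rw [mem_ball]
    linarith
  obtain ⟨g, hg, hgz⟩ := hf.exists_shadowing (n := n) z (fun i => thickening δ (S i))
    (fun i _ => isOpen_thickening)
    (fun i _ => preconnected_thickening (convex_segment _ _).isPreconnected δ)
    (fun i hi => (hsub i hi).trans (hball i hi))
    (fun i hi w hw h => hfree i hi w (hsub i hi hw) (hsub i hi h))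
    (fun i hi j hj hij => hδdis i hi j hj hij)
    (fun i _ => self_subset_thickening hδ0 _ (left_mem_segment _ _ _))
    (fun i _ => self_subset_thickening hδ0 _ (right_mem_segment _ _ _))
  have hiter : ∀ i ≤ n, g^[i] (z 0) = z i := by
    intro i
    induction i with
    | zero => simp
    | succ i ihi =>
      intro hi
      rw [iterate_succ_apply', ihi (by omega), hgz i (by omega)]
  refine not_hasBrouwerCycle hΩ hc n hn ⟨g, z 0, hg, ?_, (hiter n le_rfl).trans hz⟩
  have h1 : f (z 0) ∈ Ω := hball 0 (by omega) (mem_ball_self (by positivity))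
  exact (hf.inv _).1 h1

/-- The plane is unicoherent, in its open version. -/
theorem isPreconnected_inter_of_union_eq_univ {U V : Set ℂ} (hU : IsOpen U) (hV : IsOpen V)
    (hUc : IsPreconnected U) (hVc : IsPreconnected V) (hUV : U ∪ V = univ) :
    IsPreconnected (U ∩ V) := by
  classical
  rintro P' Q' hP' hQ' hsub ⟨p, hp, hpP⟩ ⟨q, hq, hqQ⟩
  by_contra hemp
  set P := U ∩ V ∩ P' with hP
  have hPo : IsOpen P := (hU.inter hV).inter hP'
  have hPQ : ∀ z ∈ U ∩ V, z ∉ P → z ∉ closure P := by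
    intro z hz hzP hcl
    have hzQ : z ∈ U ∩ V ∩ Q' := ⟨hz, (hsub hz).resolve_left fun h => hzP ⟨hz, h⟩⟩
    obtain ⟨w, hw, hwP⟩ := mem_closure_iff.1 hcl _ ((hU.inter hV).inter hQ') hzQ
    exact hemp ⟨w, hwP.1, hwP.2, hw.2⟩
  have hfr : ∀ z ∈ frontier P, z ∈ U → z ∉ V := by
    intro z hz hzU hzV
    rw [hPo.frontier_eq] at hz
    exact hPQ z ⟨hzU, hzV⟩ hz.2 hz.1
  have hqP : q ∉ P := fun h => hemp ⟨q, hq, h.2, hqQ⟩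
  obtain ⟨ψ, hψV, hψU, -⟩ := exists_continuous_zero_one_of_isClosed hV.isClosed_compl
    hU.isClosed_compl (by
      rw [Set.disjoint_left]
      intro z hz hz'
      have : z ∈ U ∪ V := hUV ▸ mem_univ z
      exact this.elim hz' hz)
  have hψc : Continuous fun z => (ψ z : ℂ) := Complex.continuous_ofReal.comp ψ.continuous
  let F : ℂ → ℂ := fun z => if z ∈ P then Complex.exp (2 * Real.pi * Complex.I * ψ z) else 1
  have hF : Continuous F := by
    refine Continuous.if ?_ (by fun_prop) continuous_const
    intro z hz
    by_cases hzU : z ∈ U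
    · have : ψ z = 0 := hψV (hfr z hz hzU)
      simp [this]
    · have : ψ z = 1 := hψU hzU
      simp [this]
  obtain ⟨l, hl, hle⟩ := exists_log_of_ne_zero F hF (fun z => by
    simp only [F]; split_ifs <;> simp)
  have h1 : ContinuousOn (fun z => if z ∈ P then 2 * Real.pi * Complex.I * ψ z else 0) U := by
    refine ContinuousOn.if ?_ (by fun_prop) continuousOn_const
    rintro z ⟨hzU, hz⟩
    have : ψ z = 0 := hψV (hfr z hz hzU)
    simp [this]
  have h2 : ContinuousOn (fun z => if z ∈ P then 2 * Real.pi * Complex.I * (ψ z - 1) else 0) V := by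
    refine ContinuousOn.if ?_ (by fun_prop) continuousOn_const
    rintro z ⟨hzV, hz⟩
    have : ψ z = 1 := hψU fun hzU => hfr z hz hzU hzV
    simp [this]
  have e1 := log_sub_const hUc hl.continuousOn h1 (fun z _ => by
    rw [hle]; simp only [F]; split_ifs <;> simp) hp.1 hq.1
  have e2 := log_sub_const hVc hl.continuousOn h2 (fun z _ => by
    rw [hle]; simp only [F]; split_ifs
    · rw [mul_sub, mul_one, Complex.exp_sub, Complex.exp_two_pi_mul_I, div_one]
    · simp) hp.2 hq.2
  rw [if_pos ⟨hp, hpP⟩, if_neg hqP] at e1 e2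
  exact Complex.two_pi_I_ne_zero (by linear_combination e2 - e1)

/-- Lifts to the plane of end preserving annulus homeomorphisms, in complex notation. -/
structure IsAnnular (f : ℂ ≃ₜ ℂ) : Prop where
  comm : ∀ z, f (z + 1) = f z + 1
  top : ∀ C : ℝ, ∃ M : ℝ, ∀ z, M ≤ z.im → C ≤ (f z).im
  bot : ∀ C : ℝ, ∃ M : ℝ, ∀ z, z.im ≤ M → (f z).im ≤ C

/-- Equivariance under integer translations follows from that under the generator. -/
theorem map_add_int {f : ℂ → ℂ} (hf : ∀ z, f (z + 1) = f z + 1) (z : ℂ) (n : ℤ) :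
    f (z + n) = f z + n := by
  induction n using Int.induction_on with
  | zero => simp
  | succ n ih =>
    push_cast at ih ⊢
    rw [← add_assoc, hf, ih, add_assoc]
  | pred n ih =>
    push_cast at ih ⊢
    have := hf (z + (-(n : ℂ) - 1))
    rw [show z + (-(n : ℂ) - 1) + 1 = z + -n by ring, ih] at this
    linear_combination -this

theorem periodic_add_int {α : Type*} {g : ℂ → α} (hg : ∀ z, g (z + 1) = g z) (z : ℂ) (n : ℤ) :
    g (z + n) = g z := by
  have : Function.Periodic g 1 := hg
  simpa using this.int_mul n z

/-- The unit-width rectangle of height `2M`, a fundamental domain of a horizontal strip. -/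
theorem isCompact_strip_fundamental (a b : ℝ) : IsCompact {z : ℂ | z.re ∈ Icc (0 : ℝ) 1 ∧ z.im ∈ Icc a b} :=
  (isCompact_Icc.reProdIm isCompact_Icc)

theorem exists_int_translate_mem (z : ℂ) : ∃ n : ℤ, (z + n).re ∈ Icc (0 : ℝ) 1 := by
  refine ⟨-⌊z.re⌋, ?_⟩
  have h1 := Int.floor_le z.re
  have h2 := Int.lt_floor_add_one z.re
  constructor <;> simp <;> linarith

theorem exists_bound_on_strip {g : ℂ → ℂ} (hg : Continuous g) (hp : ∀ z, g (z + 1) = g z) (a b : ℝ) :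
    ∃ B : ℝ, ∀ z : ℂ, z.im ∈ Icc a b → ‖g z‖ ≤ B := by
  obtain ⟨B, hB⟩ := (isCompact_strip_fundamental a b).exists_bound_of_continuousOn hg.continuousOn
  refine ⟨B, fun z hz => ?_⟩
  obtain ⟨n, hn⟩ := exists_int_translate_mem z
  rw [← periodic_add_int hp z n]
  exact hB _ ⟨hn, by simpa using hz⟩

theorem div_mem_slitPlane_of_im {x d : ℂ} (h : 0 < x.im * d.im) : x / d ∈ Complex.slitPlane := by
  rw [Complex.mem_slitPlane_iff_not_le_zero]
  intro hle
  have hd : d ≠ 0 := by rintro rfl; simp at h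
  obtain ⟨hre, him⟩ := Complex.le_def.1 hle
  have hx : x = ((x / d).re : ℂ) * d := by
    have : x / d = ((x / d).re : ℂ) := by
      apply Complex.ext <;> simp at him ⊢; exact him
    rw [← this, div_mul_cancel₀ _ hd]
  have h2 : x.im = (x / d).re * d.im := by
    conv_lhs => rw [hx]
    simp only [Complex.im_ofReal_mul]
  simp only [Complex.zero_re] at hre
  rw [h2, mul_assoc] at h
  nlinarith [mul_self_nonneg d.im]

theorem div_mem_slitPlane_of_re {x d : ℂ} (h : 0 < x.re * d.re) : x / d ∈ Complex.slitPlane := by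
  have := div_mem_slitPlane_of_im (x := Complex.I * x) (d := Complex.I * d) (by simpa using h)
  rwa [mul_div_mul_left _ _ Complex.I_ne_zero] at this

theorem IsAnnular.exists_ratio_mem_slitPlane {f : ℂ ≃ₜ ℂ} (hf : IsAnnular f) :
    ∃ ρ : ℝ, 0 < ρ ∧ ∀ d : ℂ, ρ ≤ ‖d‖ → (f d - f 0) / d ∈ Complex.slitPlane := by
  obtain ⟨M₁, h₁⟩ := hf.top ((f 0).im + 1)
  obtain ⟨M₂, h₂⟩ := hf.bot ((f 0).im - 1)
  set M := max (max M₁ (-M₂)) 1 with hM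
  have hM1 : 1 ≤ M := le_max_right _ _
  have hM₁ : M₁ ≤ M := (le_max_left _ _).trans (le_max_left _ _)
  have hM₂ : -M₂ ≤ M := (le_max_right _ _).trans (le_max_left _ _)
  obtain ⟨B, hB⟩ := exists_bound_on_strip (g := fun z => f z - z - f 0) (by fun_prop)
    (fun z => by rw [hf.comm]; ring) (-M) M
  have hB0 : 0 ≤ B := (norm_nonneg _).trans (hB 0 ⟨by simp; linarith, by simp; linarith⟩)
  refine ⟨B + M + 1, by linarith, fun d hd => ?_⟩
  by_cases h : M ≤ d.im
  · apply div_mem_slitPlane_of_im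
    have := h₁ d (by linarith)
    rw [Complex.sub_im]
    nlinarith
  by_cases h' : d.im ≤ -M
  · apply div_mem_slitPlane_of_im
    have := h₂ d (by linarith)
    rw [Complex.sub_im]
    nlinarith
  push Not at h h'
  have hb := hB d ⟨h'.le, h.le⟩
  have h3 := (Complex.abs_re_le_norm _).trans hb
  have h4 := Complex.norm_le_abs_re_add_abs_im d
  have h5 : |d.im| ≤ M := abs_le.2 ⟨h'.le, h.le⟩
  apply div_mem_slitPlane_of_re
  simp only [Complex.sub_re] at h3 ⊢
  rw [abs_le] at h3
  rcases abs_cases d.re with ⟨h6, h7⟩ | ⟨h6, h7⟩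
  · have : 1 ≤ d.re := by linarith
    have : 0 < (f d).re - (f 0).re := by linarith
    positivity
  · have : d.re ≤ -1 := by linarith
    have : (f d).re - (f 0).re < 0 := by linarith
    nlinarith

theorem isPreconnected_offDiag : IsPreconnected {p : ℂ × ℂ | p.1 ≠ p.2} := by
  have : {p : ℂ × ℂ | p.1 ≠ p.2} = (fun q : ℂ × ℂ => (q.1, q.1 + Complex.exp q.2)) '' univ := by
    ext ⟨z, w⟩
    constructor
    · intro h
      refine ⟨(z, Complex.log (w - z)), mem_univ _, ?_⟩
      simp [Complex.exp_log (sub_ne_zero.2 (Ne.symm h))]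
    · rintro ⟨⟨a, b⟩, -, h⟩
      simp only [Prod.mk.injEq] at h
      obtain ⟨rfl, rfl⟩ := h
      simp
  rw [this]
  exact isPreconnected_univ.image _ (by fun_prop)

/-- An annular homeomorphism of the plane has a symmetric, translation invariant continuous
logarithm of its difference quotients. -/
theorem IsAnnular.exists_log_ratio {f : ℂ ≃ₜ ℂ} (hf : IsAnnular f) :
    ∃ Θ : ℂ → ℂ → ℂ, ContinuousOn (uncurry Θ) {p | p.1 ≠ p.2} ∧
      (∀ z w, z ≠ w → Complex.exp (Θ z w) = (f z - f w) / (z - w)) ∧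
      (∀ z w, z ≠ w → Θ z w = Θ w z) ∧ ∀ z w, z ≠ w → Θ (z + 1) (w + 1) = Θ z w := by
  obtain ⟨R, hR, hRe⟩ := exists_log_of_ne_zero
    (fun q : ℂ × ℂ => (f (q.1 + Complex.exp q.2) - f q.1) / Complex.exp q.2)
    (by
      refine Continuous.div ?_ (by fun_prop) (fun q => Complex.exp_ne_zero _)
      fun_prop)
    (fun q => div_ne_zero (sub_ne_zero.2 (f.injective.ne (by simp))) (Complex.exp_ne_zero _))
  set c : ℂ := 2 * Real.pi * Complex.I with hc
  have hper : ∀ z ζ, R (z, ζ + c) = R (z, ζ) := by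
    obtain ⟨ρ, hρ, hslit⟩ := hf.exists_ratio_mem_slitPlane
    have hbig : R (0, (Real.log ρ : ℂ) + c) = R (0, (Real.log ρ : ℂ)) := by
      have key := log_sub_const (S := univ) isPreconnected_univ
        (a := fun s : ℝ => R (0, (Real.log ρ : ℂ) + s * Complex.I))
        (b := fun s : ℝ => Complex.log ((f (0 + Complex.exp ((Real.log ρ : ℂ) + s * Complex.I)) - f 0) /
          Complex.exp ((Real.log ρ : ℂ) + s * Complex.I)))
        (by fun_prop) ?_ ?_ (mem_univ (2 * Real.pi)) (mem_univ 0)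
      · simp only [Complex.ofReal_mul, Complex.ofReal_ofNat, Complex.ofReal_zero, zero_mul,
          add_zero, Complex.exp_add, Complex.exp_two_pi_mul_I, mul_one] at key
        rw [hc]
        linear_combination key
      · refine ContinuousOn.clog ?_ ?_
        · refine ContinuousOn.div (by fun_prop) (by fun_prop) (fun s _ => Complex.exp_ne_zero _)
        · intro s _
          rw [zero_add]
          refine hslit _ ?_
          rw [Complex.norm_exp]
          simp [Real.exp_log hρ]
      · intro s _
        rw [hRe, Complex.exp_log]
        refine div_ne_zero (sub_ne_zero.2 (f.injective.ne (by simp))) (Complex.exp_ne_zero _)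
    intro z ζ
    have := log_sub_const (S := univ) isPreconnected_univ (a := fun q : ℂ × ℂ => R (q.1, q.2 + c))
      (b := R) (by fun_prop) hR.continuousOn (fun q _ => by
        rw [hRe, hRe]
        simp only [Complex.exp_add, hc, Complex.exp_two_pi_mul_I, mul_one])
      (mem_univ (z, ζ)) (mem_univ ((0 : ℂ), (Real.log ρ : ℂ)))
    simp only [hbig, sub_self] at this
    exact sub_eq_zero.1 this
  have hperint : ∀ z ζ, ∀ n : ℤ, R (z, ζ + n * c) = R (z, ζ) := by
    intro z ζ n
    have : Function.Periodic (fun ζ => R (z, ζ)) c := fun ζ => hper z ζ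
    exact this.int_mul n ζ
  let Θ : ℂ → ℂ → ℂ := fun z w => R (z, Complex.log (w - z))
  have hΘe : ∀ z w, z ≠ w → Complex.exp (Θ z w) = (f z - f w) / (z - w) := by
    intro z w h
    simp only [Θ]
    rw [hRe]
    simp only [Complex.exp_log (sub_ne_zero.2 h.symm)]
    rw [← neg_sub (f z), ← neg_sub z w, neg_div_neg_eq]
    simp
  have hΘ' : ∀ z w, z ≠ w → Θ z w = R (z, Complex.log (z - w) + Real.pi * Complex.I) := by
    intro z w h
    have : Complex.exp (Complex.log (w - z)) =
        Complex.exp (Complex.log (z - w) + Real.pi * Complex.I) := by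
      rw [Complex.exp_add, Complex.exp_pi_mul_I, Complex.exp_log (sub_ne_zero.2 h),
        Complex.exp_log (sub_ne_zero.2 h.symm)]
      ring
    obtain ⟨n, hn⟩ := Complex.exp_eq_exp_iff_exists_int.1 this
    simp only [Θ]
    rw [hn, hperint]
  have hΘc : ContinuousOn (uncurry Θ) {p | p.1 ≠ p.2} := by
    rintro ⟨z, w⟩ hp
    have hp : z ≠ w := hp
    apply ContinuousAt.continuousWithinAt
    by_cases hs : w - z ∈ Complex.slitPlane
    · have : ContinuousAt (fun p : ℂ × ℂ => Complex.log (p.2 - p.1)) (z, w) :=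
        ContinuousAt.clog (by fun_prop) hs
      exact hR.continuousAt.comp (continuousAt_fst.prodMk this)
    · have hs' : z - w ∈ Complex.slitPlane := by
        have h0 := sub_ne_zero.2 hp
        simp only [Complex.mem_slitPlane_iff, Complex.sub_re, Complex.sub_im, not_or, not_not,
          not_lt] at hs ⊢
        by_contra hcon
        push Not at hcon
        apply h0
        apply Complex.ext <;> simp <;> linarith [hs.1, hs.2, hcon.1, hcon.2]
      have h0 : ContinuousAt (fun p : ℂ × ℂ => Complex.log (p.1 - p.2)) (z, w) :=
        ContinuousAt.clog (by fun_prop) hs'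
      have h1 : ContinuousAt (fun p : ℂ × ℂ => Complex.log (p.1 - p.2) + Real.pi * Complex.I) (z, w) :=
        h0.add continuousAt_const
      have h2 : ContinuousAt (fun p : ℂ × ℂ => R (p.1, Complex.log (p.1 - p.2) + Real.pi * Complex.I))
          (z, w) := hR.continuousAt.comp (continuousAt_fst.prodMk h1)
      refine h2.congr ?_
      have : {p : ℂ × ℂ | p.1 ≠ p.2} ∈ 𝓝 (z, w) :=
        (isOpen_ne_fun continuous_fst continuous_snd).mem_nhds hp
      filter_upwards [this] with p hp'
      exact (hΘ' p.1 p.2 hp').symm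
  refine ⟨Θ, hΘc, hΘe, ?_, ?_⟩
  · intro z w h
    have hsw : ContinuousOn (fun p : ℂ × ℂ => uncurry Θ p.swap) {p | p.1 ≠ p.2} :=
      hΘc.comp (f := Prod.swap) (by fun_prop) (fun p hp => Ne.symm hp)
    have := log_sub_const isPreconnected_offDiag hΘc hsw (fun p hp => by
      change Complex.exp (Θ p.1 p.2) = Complex.exp (Θ p.2 p.1)
      rw [hΘe _ _ hp, hΘe _ _ (Ne.symm hp), ← neg_sub (f p.2), ← neg_sub p.2, neg_div_neg_eq])
      (x := (z, w)) (y := (w, z)) h h.symm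
    simp only [uncurry, Prod.swap] at this
    linear_combination this / 2
  · intro z w h
    have hsh : ContinuousOn (fun p : ℂ × ℂ => uncurry Θ (p.1 + 1, p.2 + 1)) {p | p.1 ≠ p.2} :=
      hΘc.comp (f := fun p : ℂ × ℂ => (p.1 + 1, p.2 + 1)) (by fun_prop)
        (fun p hp => by simpa using hp)
    have h1 := log_sub_const isPreconnected_offDiag hsh hΘc (fun p hp => by
      have hp : p.1 ≠ p.2 := hp
      change Complex.exp (Θ (p.1 + 1) (p.2 + 1)) = Complex.exp (Θ p.1 p.2)
      rw [hΘe _ _ hp, hΘe _ _ (by simpa using hp), hf.comm, hf.comm]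
      simp only [add_sub_add_right_eq_sub]) (x := (z, w)) (y := (0, 1)) h (by simp)
    have h2 := eqOn_of_exp_eq_one (S := univ) isPreconnected_univ
      (d := fun t : ℝ => Θ t (t + 1)) ?_ ?_ (mem_univ 0) (mem_univ 1)
    · simp only [uncurry] at h1
      simp only [Complex.ofReal_zero, Complex.ofReal_one, zero_add] at h2
      rw [zero_add, ← h2, sub_self] at h1
      exact sub_eq_zero.1 h1
    · exact hΘc.comp (f := fun t : ℝ => ((t : ℂ), (t : ℂ) + 1)) (by fun_prop) (fun t _ => by simp)
    · intro t _
      rw [hΘe _ _ (by simp), hf.comm]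
      simp

/-- The entire function `1 - e^{2πi(z-ζ)}`, whose zeros are `ζ + ℤ`. -/
def periodicFactor (ζ z : ℂ) : ℂ := 1 - Complex.exp (2 * Real.pi * Complex.I * (z - ζ))

theorem periodicFactor_eq_zero {ζ z : ℂ} : periodicFactor ζ z = 0 ↔ ∃ n : ℤ, z = ζ + n := by
  rw [periodicFactor, sub_eq_zero, eq_comm, Complex.exp_eq_one_iff]
  refine exists_congr fun n => ?_
  have := Complex.two_pi_I_ne_zero
  rw [mul_comm, mul_left_inj' this]
  constructor
  · intro h; rw [← h]; ring
  · intro h; rw [h]; ring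

theorem periodicFactor_add_one (ζ z : ℂ) : periodicFactor ζ (z + 1) = periodicFactor ζ z := by
  simp only [periodicFactor]
  rw [show 2 * Real.pi * Complex.I * (z + 1 - ζ) =
    2 * Real.pi * Complex.I * (z - ζ) + 2 * Real.pi * Complex.I by ring, Complex.exp_add,
    Complex.exp_two_pi_mul_I, mul_one]

theorem hasDerivAt_periodicFactor (ζ z : ℂ) : HasDerivAt (periodicFactor ζ)
    (-(Complex.exp (2 * Real.pi * Complex.I * (z - ζ)) * (2 * Real.pi * Complex.I))) z := by
  have h1 : HasDerivAt (fun z : ℂ => 2 * Real.pi * Complex.I * (z - ζ)) (2 * Real.pi * Complex.I) z := by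
    simpa using ((hasDerivAt_id z).sub_const ζ).const_mul (2 * Real.pi * Complex.I)
  have := h1.cexp.const_sub 1
  exact this

theorem norm_exp_two_pi_I_mul (w : ℂ) :
    ‖Complex.exp (2 * Real.pi * Complex.I * w)‖ = Real.exp (-(2 * Real.pi * w.im)) := by
  rw [Complex.norm_exp]
  simp

theorem one_sub_mem_slitPlane {w : ℂ} (h : ‖w‖ < 1) : 1 - w ∈ Complex.slitPlane := by
  left
  have := (Complex.abs_re_le_norm w).trans_lt h
  rw [abs_lt] at this
  simp
  linarith

theorem norm_exp_lt_one_of_im_pos {w : ℂ} (h : 0 < w.im) :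
    ‖Complex.exp (2 * Real.pi * Complex.I * w)‖ < 1 := by
  rw [norm_exp_two_pi_I_mul, Real.exp_lt_one_iff]
  have := Real.pi_pos
  have : 0 < 2 * Real.pi * w.im := by positivity
  linarith

/-- The argument principle for periodic functions with simple zeros of positive type which are
constant near both ends of the strip: there are no zeros. -/
theorem ne_zero_of_periodic_of_const_ends {v : ℂ → ℂ} (hv : Continuous v)
    (hper : ∀ z, v (z + 1) = v z) {C : ℝ} {c₁ c₂ : ℂ} (hc₁ : c₁ ≠ 0) (hc₂ : c₂ ≠ 0)
    (htop : ∀ z, C < z.im → v z = c₁) (hbot : ∀ z, z.im < -C → v z = c₂)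
    (hzero : ∀ z, v z = 0 → ∃ κ : ℂ, κ ≠ 0 ∧ ∀ᶠ w in 𝓝 z, v w = κ * (w - z)) (z : ℂ) : v z ≠ 0 := by
  classical
  have him : ∀ z, v z = 0 → z.im ∈ Icc (-C) C := by
    intro z hz
    constructor
    · by_contra h
      exact hc₂ ((hbot z (not_le.1 h)).symm.trans hz)
    · by_contra h
      exact hc₁ ((htop z (not_le.1 h)).symm.trans hz)
  have hfin : {z | v z = 0 ∧ z.re ∈ Ico (0 : ℝ) 1}.Finite := by
    by_contra hinf
    obtain ⟨x, -, hx⟩ := Set.Infinite.exists_accPt_of_subset_isCompact hinf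
      (isCompact_strip_fundamental (-C) C) (fun z hz => ⟨⟨hz.2.1, hz.2.2.le⟩, him z hz.1⟩)
    rw [accPt_iff_frequently] at hx
    have hx0 : v x = 0 := by
      have hcl : IsClosed {z | v z = 0} := isClosed_eq hv continuous_const
      exact hcl.mem_of_frequently_of_tendsto (hx.mono fun y hy => hy.2.1) tendsto_id
    obtain ⟨κ, hκ, hev⟩ := hzero x hx0
    obtain ⟨y, ⟨hyx, hy0, -⟩, hyv⟩ := (hx.and_eventually hev).exists
    rw [hy0] at hyv
    exact mul_ne_zero hκ (sub_ne_zero.2 hyx) hyv.symm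
  set Z := hfin.toFinset with hZ
  have hZm : ∀ ζ, ζ ∈ Z ↔ v ζ = 0 ∧ ζ.re ∈ Ico (0 : ℝ) 1 := fun ζ => hfin.mem_toFinset
  let P : ℂ → ℂ := fun z => ∏ ζ ∈ Z, periodicFactor ζ z
  have hfc : ∀ ζ, Continuous (periodicFactor ζ) := fun ζ => by unfold periodicFactor; fun_prop
  have hPc : Continuous P := continuous_finsetProd _ fun ζ _ => hfc ζ
  have hPper : ∀ z, P (z + 1) = P z := fun z =>
    Finset.prod_congr rfl fun ζ _ => periodicFactor_add_one ζ z
  have hPzero : ∀ z, P z = 0 ↔ v z = 0 := by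
    intro z
    rw [Finset.prod_eq_zero_iff]
    constructor
    · rintro ⟨ζ, hζ, h⟩
      obtain ⟨n, rfl⟩ := periodicFactor_eq_zero.1 h
      rw [periodic_add_int hper]
      exact ((hZm ζ).1 hζ).1
    · intro h
      refine ⟨z + (-⌊z.re⌋ : ℤ), (hZm _).2 ⟨by rw [periodic_add_int hper, h], ?_⟩,
        periodicFactor_eq_zero.2 ⟨⌊z.re⌋, by push_cast; ring⟩⟩
      have h1 := Int.floor_le z.re
      have h2 := Int.lt_floor_add_one z.re
      constructor <;> simp <;> linarith
  have hPder : ∀ z, v z = 0 → ∃ p', p' ≠ 0 ∧ HasDerivAt P p' z := by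
    intro z hz
    obtain ⟨ζ, hζ, h⟩ := Finset.prod_eq_zero_iff.1 ((hPzero z).2 hz)
    have hPe : P = fun w => periodicFactor ζ w * ∏ ξ ∈ Z.erase ζ, periodicFactor ξ w := by
      ext w
      exact (Finset.mul_prod_erase Z _ hζ).symm
    have hd : DifferentiableAt ℂ (fun w => ∏ ξ ∈ Z.erase ζ, periodicFactor ξ w) z :=
      DifferentiableAt.fun_finsetProd fun ξ _ => (hasDerivAt_periodicFactor ξ z).differentiableAt
    refine ⟨_, ?_, by rw [hPe]; exact (hasDerivAt_periodicFactor ζ z).fun_mul hd.hasDerivAt⟩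
    rw [h, zero_mul, add_zero]
    refine mul_ne_zero (neg_ne_zero.2 (mul_ne_zero (Complex.exp_ne_zero _)
      Complex.two_pi_I_ne_zero)) ?_
    rw [Finset.prod_ne_zero_iff]
    intro ξ hξ h'
    obtain ⟨n, hn⟩ := periodicFactor_eq_zero.1 h
    obtain ⟨m, hm⟩ := periodicFactor_eq_zero.1 h'
    have h1 := ((hZm ζ).1 hζ).2
    have h2 := ((hZm ξ).1 (Finset.mem_of_mem_erase hξ)).2
    have hre := congrArg Complex.re (hn.symm.trans hm)
    simp only [Complex.add_re, Complex.intCast_re] at hre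
    have h3 : ((n : ℝ) - m) < 1 := by linarith [h1.1, h2.2]
    have h4 : ((m : ℝ) - n) < 1 := by linarith [h1.2, h2.1]
    have h5 : n - m < 1 := by exact_mod_cast h3
    have h6 : m - n < 1 := by exact_mod_cast h4
    have h7 : n = m := by omega
    rw [hn, h7, add_left_inj] at hm
    exact Finset.ne_of_mem_erase hξ hm.symm
  -- the quotient, extended over the zeros
  have hq : ∃ V : ℂ → ℂ, Continuous V ∧ (∀ z, V z ≠ 0) ∧ ∀ z, P z ≠ 0 → V z = v z / P z := by
    have hchoice : ∀ z, ∃ r : ℂ, r ≠ 0 ∧ (P z ≠ 0 → r = v z / P z) ∧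
        (P z = 0 → Tendsto (fun w => v w / P w) (𝓝[≠] z) (𝓝 r)) := by
      intro z
      by_cases hz : P z = 0
      · obtain ⟨p', hp', hder⟩ := hPder z ((hPzero z).1 hz)
        obtain ⟨κ, hκ, hev⟩ := hzero z ((hPzero z).1 hz)
        refine ⟨κ / p', div_ne_zero hκ hp', fun h => absurd hz h, fun _ => ?_⟩
        have ht := (hasDerivAt_iff_tendsto_slope.1 hder)
        refine (Tendsto.div tendsto_const_nhds ht hp').congr' ?_
        filter_upwards [hev.filter_mono nhdsWithin_le_nhds, self_mem_nhdsWithin] with w hw hwz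
        have : w - z ≠ 0 := sub_ne_zero.2 hwz
        change κ / slope P z w = _
        rw [hw, slope_def_field, hz, sub_zero, div_div_eq_mul_div]
      · refine ⟨v z / P z, div_ne_zero (fun h => hz ((hPzero z).2 h)) hz, fun _ => rfl,
          fun h => absurd h hz⟩
    choose V hV0 hV1 hV2 using hchoice
    refine ⟨V, ?_, hV0, hV1⟩
    rw [continuous_iff_continuousAt]
    intro z
    by_cases hz : P z = 0
    · rw [continuousAt_iff_punctured_nhds]
      refine (hV2 z hz).congr' ?_
      obtain ⟨κ, hκ, hev⟩ := hzero z ((hPzero z).1 hz)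
      filter_upwards [hev.filter_mono nhdsWithin_le_nhds, self_mem_nhdsWithin] with w hw hwz
      refine (hV1 w fun h => ?_).symm
      rw [(hPzero w).1 h] at hw
      exact mul_ne_zero hκ (sub_ne_zero.2 hwz) hw.symm
    · have : ContinuousAt (fun w => v w / P w) z := hv.continuousAt.div hPc.continuousAt hz
      refine this.congr ?_
      filter_upwards [hPc.continuousAt.eventually_ne hz] with w hw
      exact (hV1 w hw).symm
  obtain ⟨V, hVc, hV0, hV⟩ := hq
  obtain ⟨l, hl, hle⟩ := exists_log_of_ne_zero V hVc hV0
  obtain ⟨D, hD⟩ : ∃ D : ℝ, ∀ ζ ∈ Z, |ζ.im| < D := by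
    refine ⟨|C| + 1, fun ζ hζ => ?_⟩
    have := him ζ ((hZm ζ).1 hζ).1
    have h1 := neg_abs_le C
    have h2 := le_abs_self C
    rw [abs_lt]
    constructor <;> linarith [this.1, this.2]
  set c : ℂ := 2 * Real.pi * Complex.I with hc
  set E := max C D with hE
  -- at the top
  have hdtop : ∀ z, E < z.im → l (z + 1) - l z = 0 := by
    intro z hz
    let φ : ℂ → ℂ := fun z => Complex.log c₁ - ∑ ζ ∈ Z, Complex.log (periodicFactor ζ z)
    have hslit : ∀ z : ℂ, E < z.im → ∀ ζ ∈ Z, periodicFactor ζ z ∈ Complex.slitPlane := by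
      intro z hz ζ hζ
      refine one_sub_mem_slitPlane (norm_exp_lt_one_of_im_pos ?_)
      have := (abs_lt.1 (hD ζ hζ)).2
      have := le_max_right C D
      rw [Complex.sub_im]
      linarith
    have hφ : ContinuousOn φ {z | E < z.im} := by
      refine continuousOn_const.sub (continuousOn_finsetSum _ fun ζ hζ => ?_)
      exact (hfc ζ).continuousOn.clog fun z hz => hslit z hz ζ hζ
    have hpc : IsPreconnected {z : ℂ | E < z.im} := (convex_halfSpace_im_gt E).isPreconnected
    have key := log_sub_const hpc hl.continuousOn hφ (fun z hz => by
      have h0 : ∀ ζ ∈ Z, periodicFactor ζ z ≠ 0 := fun ζ hζ =>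
        Complex.slitPlane_ne_zero (hslit z hz ζ hζ)
      rw [hle, hV z (Finset.prod_ne_zero_iff.2 h0), Complex.exp_sub, Complex.exp_log hc₁,
        Complex.exp_sum, htop z ((le_max_left C D).trans_lt hz)]
      congr 1
      exact Finset.prod_congr rfl fun ζ hζ => (Complex.exp_log (h0 ζ hζ)).symm)
      (x := z + 1) (y := z) (by simpa using hz) hz
    have hφp : φ (z + 1) = φ z := by simp only [φ, periodicFactor_add_one]
    rw [hφp] at key
    linear_combination key
  have hdbot : ∀ z, z.im < -E → l (z + 1) - l z = -(Z.card * c) := by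
    intro z hz
    let ψ : ℂ → ℂ → ℂ := fun ζ z => 1 - Complex.exp (c * (ζ - z))
    let φ : ℂ → ℂ := fun z => Complex.log c₂ -
      ∑ ζ ∈ Z, (Real.pi * Complex.I + c * (z - ζ) + Complex.log (ψ ζ z))
    have hslit : ∀ z : ℂ, z.im < -E → ∀ ζ ∈ Z, ψ ζ z ∈ Complex.slitPlane := by
      intro z hz ζ hζ
      refine one_sub_mem_slitPlane (norm_exp_lt_one_of_im_pos ?_)
      have := (abs_lt.1 (hD ζ hζ)).1
      have := le_max_right C D
      rw [Complex.sub_im]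
      linarith
    have hφ : ContinuousOn φ {z | z.im < -E} := by
      refine continuousOn_const.sub (continuousOn_finsetSum _ fun ζ hζ => ?_)
      refine ContinuousOn.add (by fun_prop) ?_
      exact ContinuousOn.clog (by fun_prop) fun z hz => hslit z hz ζ hζ
    have hpc : IsPreconnected {z : ℂ | z.im < -E} := (convex_halfSpace_im_lt (-E)).isPreconnected
    have hfac : ∀ z : ℂ, z.im < -E → ∀ ζ ∈ Z,
        Complex.exp (Real.pi * Complex.I + c * (z - ζ) + Complex.log (ψ ζ z)) =
          periodicFactor ζ z := by
      intro z hz ζ hζ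
      rw [Complex.exp_add, Complex.exp_add, Complex.exp_pi_mul_I,
        Complex.exp_log (Complex.slitPlane_ne_zero (hslit z hz ζ hζ))]
      simp only [ψ, periodicFactor, ← hc]
      rw [mul_sub, mul_one, mul_assoc (-1), ← Complex.exp_add,
        show c * (z - ζ) + c * (ζ - z) = 0 by ring, Complex.exp_zero]
      ring
    have key := log_sub_const hpc hl.continuousOn hφ (fun z hz => by
      have h0 : P z ≠ 0 := Finset.prod_ne_zero_iff.2 fun ζ hζ => by
        rw [← hfac z hz ζ hζ]; exact Complex.exp_ne_zero _
      rw [hle, hV z h0, Complex.exp_sub, Complex.exp_log hc₂,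
        Complex.exp_sum, hbot z (by
          have h1 := le_max_left C D
          have hz : z.im < -E := hz
          linarith)]
      congr 1
      exact Finset.prod_congr rfl fun ζ hζ => (hfac z hz ζ hζ).symm)
      (x := z + 1) (y := z) (by simpa using hz) hz
    have hψ : ∀ ζ, ψ ζ (z + 1) = ψ ζ z := by
      intro ζ
      simp only [ψ]
      rw [show c * (ζ - z) = c * (ζ - (z + 1)) + c by ring, Complex.exp_add, hc,
        Complex.exp_two_pi_mul_I, mul_one]
    have hφp : φ (z + 1) - φ z = -(Z.card * c) := by
      simp only [φ, hψ]
      rw [sub_sub_sub_cancel_left, ← Finset.sum_sub_distrib, Finset.sum_congr rfl (g := fun _ => -c)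
        (fun ζ _ => by ring)]
      simp
    linear_combination key + hφp
  have hconst := log_sub_const (S := univ) isPreconnected_univ (a := fun z => l (z + 1)) (b := l)
    (by fun_prop) hl.continuousOn (fun z _ => by
      rw [hle, hle]
      have hVper : ∀ z, P z ≠ 0 → V (z + 1) = V z := fun z hz => by
        rw [hV z hz, hV (z + 1) (by rwa [hPper]), hPper, hper]
      by_cases hz : P z = 0
      · -- by continuity from the nonzero points
        have hcl : IsClosed {w | V (w + 1) = V w} := isClosed_eq (by fun_prop) hVc
        obtain ⟨κ, hκ, hev⟩ := hzero z ((hPzero z).1 hz)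
        have hfr : ∃ᶠ w in 𝓝[≠] z, w ∈ {w | V (w + 1) = V w} := by
          apply Eventually.frequently
          filter_upwards [hev.filter_mono nhdsWithin_le_nhds, self_mem_nhdsWithin] with w hw hwz
          refine hVper w fun h => ?_
          rw [(hPzero w).1 h] at hw
          exact mul_ne_zero hκ (sub_ne_zero.2 hwz) hw.symm
        exact hcl.mem_of_frequently_of_tendsto hfr (tendsto_id.mono_left nhdsWithin_le_nhds)
      · exact hVper z hz)
    (mem_univ (((E + 1 : ℝ) : ℂ) * Complex.I)) (mem_univ (((-E - 1 : ℝ) : ℂ) * Complex.I))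
  rw [hdtop _ (by simp), hdbot _ (by simp)] at hconst
  have hcard : Z.card = 0 := by
    have := neg_eq_zero.1 hconst.symm
    rcases mul_eq_zero.1 this with h | h
    · exact_mod_cast h
    · exact absurd h Complex.two_pi_I_ne_zero
  intro hz
  have h1 := (hPzero z).2 hz
  simp only [P, Finset.card_eq_zero.1 hcard, Finset.prod_empty] at h1
  exact one_ne_zero h1

theorem closure_connectedComponentIn_subset {U : Set ℂ} (hU : IsOpen U) (x : ℂ) :
    closure (connectedComponentIn U x) ⊆ connectedComponentIn U x ∪ Uᶜ := by
  intro y hy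
  by_cases hyU : y ∈ U
  · left
    have ho : IsOpen (connectedComponentIn U y) := hU.connectedComponentIn
    obtain ⟨z, hz1, hz2⟩ := mem_closure_iff.1 hy _ ho (mem_connectedComponentIn hyU)
    rw [connectedComponentIn_eq hz2, ← connectedComponentIn_eq hz1]
    exact mem_connectedComponentIn hyU
  · exact Or.inr hyU

theorem isPreconnected_union_compl_connectedComponentIn {U V : Set ℂ} (hU : IsOpen U)
    (hV : IsPreconnected V) (hVU : Uᶜ ⊆ V) (hne : Uᶜ.Nonempty) (x : ℂ) :
    IsPreconnected (V ∪ (connectedComponentIn U x)ᶜ) := by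
  obtain ⟨b, hb⟩ := hne
  refine isPreconnected_of_forall b fun y hy => ?_
  by_cases hyV : y ∈ V
  · exact ⟨V, subset_union_left, hVU hb, hyV, hV⟩
  have hyU : y ∈ U := by_contra fun h => hyV (hVU h)
  have hyx : y ∉ connectedComponentIn U x := hy.resolve_left hyV
  have hsub : closure (connectedComponentIn U y) ⊆ (connectedComponentIn U x)ᶜ := by
    intro z hz hzx
    rcases closure_connectedComponentIn_subset hU y hz with h | h
    · rw [connectedComponentIn_eq hzx, ← connectedComponentIn_eq h] at hyx
      exact hyx (mem_connectedComponentIn hyU)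
    · exact h (connectedComponentIn_subset _ _ hzx)
  have hpc : IsPreconnected (closure (connectedComponentIn U y)) :=
    isPreconnected_connectedComponentIn.closure
  have hmeet : ∃ z ∈ closure (connectedComponentIn U y), z ∈ Uᶜ := by
    by_contra! hcon
    have hcl : IsClosed (connectedComponentIn U y) := by
      refine isClosed_of_closure_subset fun z hz => ?_
      exact (closure_connectedComponentIn_subset hU y hz).resolve_right (hcon z hz)
    have := IsClopen.eq_univ ⟨hcl, hU.connectedComponentIn⟩ ⟨y, mem_connectedComponentIn hyU⟩
    exact hb (connectedComponentIn_subset U y (this ▸ mem_univ b))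
  obtain ⟨z, hz1, hz2⟩ := hmeet
  refine ⟨V ∪ closure (connectedComponentIn U y), union_subset_union_right _ hsub,
    Or.inl (hVU hb), Or.inr (subset_closure (mem_connectedComponentIn hyU)), ?_⟩
  exact hV.union z (hVU hz2) hz1 hpc

/-- A path from `w` to `w + n`, `n > 0`, separates what lies below it from what lies above. -/
theorem false_of_horizontal_path {w : ℂ} {n : ℤ} (hn : 0 < n) (γ : Path w (w + n))
    {Q : Set ℂ} (hQ : IsPreconnected Q) (hdisj : ∀ t (m : ℤ), γ t + m * n ∉ Q) {a b : ℂ}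
    (ha : a ∈ Q) (hb : b ∈ Q) (hal : ∀ t, a.im < (γ t).im) (hbl : ∀ t, (γ t).im < b.im) :
    False := by
  have hnR : (0 : ℝ) < n := by exact_mod_cast hn
  have hnC : (n : ℂ) ≠ 0 := by exact_mod_cast hn.ne'
  have him : ∀ z : ℂ, (z / n).im = z.im / n := fun z => by
    rw [← Complex.ofReal_intCast, Complex.div_ofReal_im]
  set c : ℂ := 2 * Real.pi * Complex.I with hc
  let k : ℂ → ℂ → ℂ := fun a z => 1 - Complex.exp (c * ((z - a) / n))
  have hk0 : ∀ t, ∀ a ∈ Q, k a (γ t) ≠ 0 := by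
    intro t a ha h
    obtain ⟨m, hm⟩ := Complex.exp_eq_one_iff.1 (sub_eq_zero.1 h).symm
    rw [mul_comm, ← hc] at hm
    have h1 := mul_right_cancel₀ Complex.two_pi_I_ne_zero hm
    rw [div_eq_iff hnC] at h1
    refine hdisj t (-m) ?_
    push_cast
    rwa [neg_mul, ← h1, neg_sub, add_sub_cancel]
  have hk0' : ∀ a ∈ Q, k a w ≠ 0 := fun a ha => by simpa using hk0 0 a ha
  obtain ⟨l, hl, hexp, hl0⟩ := exists_log_homotopyOn (S := Q)
    (fun t a => k a (γ t) / k a w) (ContinuousOn.div (by fun_prop) (by fun_prop)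
      fun p hp => hk0' _ hp.2) (fun t a ha => div_ne_zero (hk0 t a ha) (hk0' a ha))
    (fun _ => 0) continuousOn_const (fun a ha => by simp [div_self (hk0' a ha)])
  have hend : l 1 a = l 1 b := by
    refine eqOn_of_exp_eq_one hQ (continuousOn_slice hl 1) (fun x hx => ?_) ha hb
    rw [hexp 1 x hx, γ.target]
    have : k x (w + n) = k x w := by
      simp only [k]
      rw [show c * ((w + n - x) / n) = c * ((w - x) / n) + 2 * Real.pi * Complex.I by
        rw [hc]; field_simp; ring, Complex.exp_periodic]
    rw [this, div_self (hk0' x hx)]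
  have h1 : l 1 a = 0 := by
    have hs : ∀ t, k a (γ t) ∈ Complex.slitPlane := fun t =>
      one_sub_mem_slitPlane (norm_exp_lt_one_of_im_pos (by
        rw [him, Complex.sub_im]; exact div_pos (sub_pos.2 (hal t)) hnR))
    have key := log_unique (Y := unitInterval) isPreconnected_univ
      (a := fun t => l t a) (b := fun t => Complex.log (k a (γ t)) - Complex.log (k a w))
      (continuous_slice_left hl ha).continuousOn
      (by
        refine ContinuousOn.sub (ContinuousOn.clog (by fun_prop) fun t _ => hs t) continuousOn_const)
      (fun t _ => by
        rw [hexp t a ha, Complex.exp_sub, Complex.exp_log (hk0 t a ha), Complex.exp_log (hk0' a ha)])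
      (mem_univ 0) (by simp [hl0 a ha]) (mem_univ 1)
    rw [key, γ.target]
    have : k a (w + n) = k a w := by
      simp only [k]
      rw [show c * ((w + n - a) / n) = c * ((w - a) / n) + 2 * Real.pi * Complex.I by
        rw [hc]; field_simp; ring, Complex.exp_periodic]
    rw [this, sub_self]
  have h2 : l 1 b = c := by
    let k' : ℂ → ℂ := fun z => 1 - Complex.exp (c * ((b - z) / n))
    have hs : ∀ t, k' (γ t) ∈ Complex.slitPlane := fun t =>
      one_sub_mem_slitPlane (norm_exp_lt_one_of_im_pos (by
        rw [him, Complex.sub_im]; exact div_pos (sub_pos.2 (hbl t)) hnR))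
    have hkk : ∀ z, k b z = -(Complex.exp (c * ((z - b) / n)) * k' z) := fun z => by
      simp only [k, k']
      rw [mul_sub, ← Complex.exp_add, show c * ((z - b) / n) + c * ((b - z) / n) = 0 by ring,
        Complex.exp_zero]
      ring
    have hsw : k' w ≠ 0 := by simpa using Complex.slitPlane_ne_zero (hs 0)
    have key := log_unique (Y := unitInterval) isPreconnected_univ
      (a := fun t => l t b)
      (b := fun t => c * ((γ t - w) / n) + (Complex.log (k' (γ t)) - Complex.log (k' w)))
      (continuous_slice_left hl hb).continuousOn
      (by
        refine ContinuousOn.add (by fun_prop) (ContinuousOn.sub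
          (ContinuousOn.clog (by fun_prop) fun t _ => hs t) continuousOn_const))
      (fun t _ => by
        rw [hexp t b hb, Complex.exp_add, Complex.exp_sub,
          Complex.exp_log (Complex.slitPlane_ne_zero (hs t)), Complex.exp_log hsw, hkk, hkk,
          neg_div_neg_eq, show c * ((γ t - w) / n) = c * ((γ t - b) / n) - c * ((w - b) / n) by ring,
          Complex.exp_sub]
        field_simp)
      (mem_univ 0) (by simp [hl0 b hb]) (mem_univ 1)
    rw [key, γ.target]
    have : k' (w + n) = k' w := by
      simp only [k']
      rw [show c * ((b - w) / n) = c * ((b - (w + n)) / n) + 2 * Real.pi * Complex.I by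
        rw [hc]; field_simp; ring, Complex.exp_periodic]
    rw [this, sub_self, add_zero, add_sub_cancel_left, div_self hnC, mul_one]
  exact Complex.two_pi_I_ne_zero (h2.symm.trans (hend.symm.trans h1))

theorem log_div_of_im_neg {x y : ℂ} (hx : x.im < 0) (hy : y.im < 0) :
    Complex.log (x / y) = Complex.log x - Complex.log y := by
  have hx0 : x ≠ 0 := by rintro rfl; simp at hx
  have hy0 : y ≠ 0 := by rintro rfl; simp at hy
  have hxa := Complex.arg_neg_iff.2 hx
  have hya := Complex.arg_neg_iff.2 hy
  have h1 := Complex.neg_pi_lt_arg x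
  have h2 := Complex.neg_pi_lt_arg y
  have hyp : y.arg ≠ Real.pi := by linarith [Real.pi_pos]
  rw [div_eq_mul_inv, Complex.log_mul hx0 (inv_ne_zero hy0), Complex.log_inv _ hyp, sub_eq_add_neg]
  rw [Complex.arg_inv, if_neg hyp]
  constructor <;> linarith

theorem add_int_mem_iff {U : Set ℂ} (hT : ∀ z, z + 1 ∈ U ↔ z ∈ U) (z : ℂ) (n : ℤ) :
    z + n ∈ U ↔ z ∈ U := by
  classical
  have := periodic_add_int (g := fun z => if z ∈ U then (1 : ℂ) else 0)
    (fun z => by simp only [hT]) z n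
  by_cases h : z ∈ U <;> by_cases h' : z + n ∈ U <;> simp_all

theorem add_int_mem_connectedComponentIn {U : Set ℂ} (hT : ∀ z, z + 1 ∈ U ↔ z ∈ U) {x y : ℂ}
    (hy : y ∈ connectedComponentIn U x) (n : ℤ) : y + n ∈ connectedComponentIn U (x + n) := by
  have hx : x ∈ U := connectedComponentIn_nonempty_iff.1 ⟨y, hy⟩
  have hpc : IsPreconnected ((fun z => z + (n : ℂ)) '' connectedComponentIn U x) :=
    isPreconnected_connectedComponentIn.image _ (by fun_prop)
  refine hpc.subset_connectedComponentIn ⟨x, mem_connectedComponentIn hx, rfl⟩ ?_ ⟨y, hy, rfl⟩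
  rintro _ ⟨z, hz, rfl⟩
  exact (add_int_mem_iff hT z n).2 (connectedComponentIn_subset _ _ hz)

theorem eq_of_add_int_mem_connectedComponentIn {U : Set ℂ} {C : ℝ} (hU : IsOpen U)
    (hUc : IsPreconnected Uᶜ) (hT : ∀ z, z + 1 ∈ U ↔ z ∈ U)
    (hbot : ∀ z : ℂ, z.im < -C → z ∉ U) {w : ℂ}
    (htop : ∀ z : ℂ, C < z.im → z ∉ connectedComponentIn U w) {x : ℂ} {n m : ℤ}
    (hn : x + n ∈ connectedComponentIn U w) (hm : x + m ∈ connectedComponentIn U w) : n = m := by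
  wlog hlt : n < m generalizing n m
  · rcases lt_trichotomy n m with h | h | h
    · exact this hn hm h
    · exact h
    · exact (this hm hn h).symm
  exfalso
  set W := connectedComponentIn U w with hW
  obtain ⟨N, hN⟩ : ∃ N : ℤ, N = m - n := ⟨_, rfl⟩
  have hm' : (x + n) + N ∈ W := by rw [hN]; push_cast; convert hm using 1; ring
  have hshift : ∀ y ∈ W, ∀ k : ℤ, y + k * N ∈ W := by
    have h1 : ∀ y ∈ W, y + N ∈ W := by
      intro y hy
      rw [hW, connectedComponentIn_eq hn] at hy
      have := add_int_mem_connectedComponentIn hT hy N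
      rwa [← connectedComponentIn_eq hm'] at this
    have h2 : ∀ y ∈ W, y - N ∈ W := by
      intro y hy
      rw [hW, connectedComponentIn_eq hm'] at hy
      have := add_int_mem_connectedComponentIn hT hy (-N)
      push_cast at this
      rw [← sub_eq_add_neg, ← sub_eq_add_neg, add_sub_cancel_right,
        ← connectedComponentIn_eq hn] at this
      exact this
    intro y hy k
    induction k using Int.induction_on with
    | zero => simpa using hy
    | succ i ih => have := h1 _ ih; push_cast at this ⊢; convert this using 1; ring
    | pred i ih => have := h2 _ ih; push_cast at this ⊢; convert this using 1; ring
  have hWU : W ⊆ U := connectedComponentIn_subset _ _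
  have hpath : IsPathConnected W := by
    rw [← hU.connectedComponentIn.isConnected_iff_isPathConnected]
    exact isConnected_connectedComponentIn_iff.2 (connectedComponentIn_nonempty_iff.1 ⟨_, hn⟩)
  obtain ⟨γ, hγ⟩ := hpath.joinedIn _ hn _ hm'
  have hbotmem : (⟨0, -C - 1⟩ : ℂ) ∈ Uᶜ := hbot _ (by simp)
  have hQ : IsPreconnected Wᶜ := by
    have := isPreconnected_union_compl_connectedComponentIn hU hUc subset_rfl ⟨_, hbotmem⟩ w
    rwa [union_eq_right.2 (compl_subset_compl.2 (connectedComponentIn_subset _ _))] at this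
  refine false_of_horizontal_path (n := N) (by omega) γ hQ (fun t k => not_not.2 (hshift _ (hγ t) k))
    (a := ⟨0, -C - 1⟩) (b := ⟨0, C + 1⟩) (fun h => hbotmem (hWU h)) (htop _ (by simp))
    (fun t => ?_) (fun t => ?_)
  · have := not_lt.1 fun h => hbot _ h (hWU (hγ t))
    simp only; linarith
  · have := not_lt.1 fun h => htop _ h (hγ t)
    simp only; linarith

/-- A continuous choice on `Q` of `log ((a - w) / δ a)`, normalized near the bottom end. -/
def HasKernelLog (Q : Set ℂ) (C : ℝ) (δ : ℂ → ℂ) (w : ℂ) (l : ℂ → ℂ) : Prop :=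
  ContinuousOn l Q ∧ (∀ a ∈ Q, Complex.exp (l a) * δ a = a - w) ∧
    ∀ a : ℂ, a.im < -C → l a = Complex.log (a - w) - Complex.log (δ a)

theorem HasKernelLog.step {Q : Set ℂ} {C : ℝ} {δ l : ℂ → ℂ} {w₀ w : ℂ}
    (hbot : ∀ z : ℂ, z.im < -C → z ∈ Q) (h : HasKernelLog Q C δ w₀ l)
    (hw₀ : w₀ ∉ Q) (hw : w ∉ Q) (hlt : ∀ a ∈ Q, ‖w - w₀‖ < ‖a - w₀‖) :
    HasKernelLog Q C δ w (fun a => l a + Complex.log ((a - w) / (a - w₀))) := by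
  have hne : ∀ a ∈ Q, a - w₀ ≠ 0 := fun a ha h => hw₀ (sub_eq_zero.1 h ▸ ha)
  have hne' : ∀ a ∈ Q, a - w ≠ 0 := fun a ha h => hw (sub_eq_zero.1 h ▸ ha)
  have hs : ∀ a ∈ Q, (a - w) / (a - w₀) ∈ Complex.slitPlane := by
    intro a ha
    have : (a - w) / (a - w₀) = 1 - (w - w₀) / (a - w₀) := by
      have := hne a ha
      field_simp; ring
    rw [this]
    refine one_sub_mem_slitPlane ?_
    rw [norm_div, div_lt_one ((norm_nonneg _).trans_lt (hlt a ha))]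
    exact hlt a ha
  refine ⟨h.1.add (ContinuousOn.clog (ContinuousOn.div (by fun_prop) (by fun_prop) hne) hs), ?_, ?_⟩
  · intro a ha
    rw [Complex.exp_add, Complex.exp_log (Complex.slitPlane_ne_zero (hs a ha)), mul_right_comm,
      h.2.1 a ha, mul_div_cancel₀ _ (hne a ha)]
  · intro a ha
    have h1 := not_lt.1 fun h => hw₀ (hbot _ h)
    have h2 := not_lt.1 fun h => hw (hbot _ h)
    simp only
    rw [h.2.2 a ha, log_div_of_im_neg (by simp; linarith) (by simp; linarith)]
    ring

theorem HasKernelLog.unique {Q : Set ℂ} {C : ℝ} {δ l l' : ℂ → ℂ} {w : ℂ} (hQ : IsPreconnected Q)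
    (hbot : ∀ z : ℂ, z.im < -C → z ∈ Q) (hw : w ∉ Q) (h : HasKernelLog Q C δ w l)
    (h' : HasKernelLog Q C δ w l') {a : ℂ} (ha : a ∈ Q) : l a = l' a := by
  have hb : (⟨0, -C - 1⟩ : ℂ).im < -C := by simp
  refine log_unique hQ h.1 h'.1 (fun x hx => ?_) (hbot _ hb) (by rw [h.2.2 _ hb, h'.2.2 _ hb]) ha
  have h1 := h.2.1 x hx
  have h2 := h'.2.1 x hx
  have h3 : δ x ≠ 0 := fun h0 => hw (by
    rw [h0, mul_zero] at h1; rwa [← sub_eq_zero.1 h1.symm])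
  exact mul_right_cancel₀ h3 (h1.trans h2.symm)

theorem HasKernelLog.exists_of_connected {Q : Set ℂ} {C : ℝ} {δ : ℂ → ℂ}
    (hQ : IsClosed Q) (hbot : ∀ z : ℂ, z.im < -C → z ∈ Q) {w₀ w : ℂ}
    (h : ∃ l, HasKernelLog Q C δ w₀ l) (hw : w ∈ connectedComponentIn Qᶜ w₀) :
    ∃ l, HasKernelLog Q C δ w l := by
  have key := isPreconnected_connectedComponentIn (F := Qᶜ) (x := w₀) |>.induction₂
    (fun x y => (∃ l, HasKernelLog Q C δ x l) ↔ ∃ l, HasKernelLog Q C δ y l) (fun x hx => ?_)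
    (fun x y z _ _ _ h1 h2 => h1.trans h2) (fun x y _ _ h => h.symm)
    (mem_connectedComponentIn (connectedComponentIn_nonempty_iff.1 ⟨_, hw⟩)) hw
  · exact key.1 h
  have hxQ : x ∉ Q := connectedComponentIn_subset _ _ hx
  obtain ⟨r, hr, hball⟩ := Metric.isOpen_iff.1 hQ.isOpen_compl x hxQ
  filter_upwards [mem_nhdsWithin_of_mem_nhds (ball_mem_nhds x (half_pos hr))] with y hy
  have hyQ : y ∉ Q := hball (ball_subset_ball (by linarith) hy)
  rw [mem_ball, dist_eq_norm] at hy
  have hxa : ∀ a ∈ Q, r ≤ ‖a - x‖ := fun a ha => by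
    by_contra! hlt
    exact hball (by rwa [mem_ball, dist_eq_norm]) ha
  refine ⟨fun ⟨l, hl⟩ => ⟨_, hl.step hbot hxQ hyQ fun a ha => ?_⟩,
    fun ⟨l, hl⟩ => ⟨_, hl.step hbot hyQ hxQ fun a ha => ?_⟩⟩
  · linarith [hxa a ha]
  · have h1 := hxa a ha
    have h2 : ‖a - x‖ ≤ ‖a - y‖ + ‖y - x‖ := norm_sub_le_norm_sub_add_norm_sub _ _ _
    rw [norm_sub_rev]
    linarith

open Classical in
/-- A choice of a point in a set, depending on the set only. -/
def pickPoint (S : Set ℂ) : ℂ := if h : S.Nonempty then h.some else 0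

theorem pickPoint_mem {S : Set ℂ} (h : S.Nonempty) : pickPoint S ∈ S := by
  rw [pickPoint, dif_pos h]; exact h.some_mem

theorem exists_equivariant_base {U : Set ℂ} {C : ℝ} (hU : IsOpen U)
    (hUc : IsPreconnected Uᶜ) (hT : ∀ z, z + 1 ∈ U ↔ z ∈ U)
    (hbot : ∀ z : ℂ, z.im < -C → z ∉ U) (htop : ∀ z : ℂ, C < z.im → z ∈ U) :
    ∃ c : ℂ → ℂ, (∀ w ∈ U, c w ∈ connectedComponentIn U w) ∧
      (∀ w ∈ U, w ∉ connectedComponentIn U ⟨0, C + 1⟩ →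
        c (w + 1) = c w + 1 ∧ ∀ w' ∈ connectedComponentIn U w, c w' = c w) := by
  let S : ℂ → Set ℂ := fun w => {x | ∃ n : ℤ, x + n ∈ connectedComponentIn U w}
  have hS : ∀ w ∈ U, (S w).Nonempty := fun w hw =>
    ⟨w, 0, by simpa using mem_connectedComponentIn hw⟩
  have hex : ∀ w, ∃ n : ℤ, w ∈ U → pickPoint (S w) + n ∈ connectedComponentIn U w := by
    intro w
    by_cases hw : w ∈ U
    · obtain ⟨n, hn⟩ := pickPoint_mem (hS w hw)
      exact ⟨n, fun _ => hn⟩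
    · exact ⟨0, fun h => absurd h hw⟩
  choose n hn using hex
  refine ⟨fun w => pickPoint (S w) + n w, hn, fun w hw hwtop => ?_⟩
  have hhigh : ∀ z : ℂ, C < z.im → z ∉ connectedComponentIn U w := by
    intro z hz hzw
    have hsub : {z : ℂ | C < z.im} ⊆ connectedComponentIn U z :=
      (convex_halfSpace_im_gt C).isPreconnected.subset_connectedComponentIn hz htop
    have h1 : (⟨0, C + 1⟩ : ℂ) ∈ connectedComponentIn U z := hsub (by simp)
    rw [← connectedComponentIn_eq h1, ← connectedComponentIn_eq hzw] at hwtop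
    exact hwtop (mem_connectedComponentIn hw)
  have huniq : ∀ (x : ℂ) (i j : ℤ), x + i ∈ connectedComponentIn U w → x + j ∈ connectedComponentIn U w →
      i = j := fun x i j => eq_of_add_int_mem_connectedComponentIn hU hUc hT hbot hhigh
  have hSw : S (w + 1) = S w := by
    ext x
    constructor
    · rintro ⟨i, hi⟩
      refine ⟨i - 1, ?_⟩
      have := add_int_mem_connectedComponentIn hT hi (-1)
      push_cast at this ⊢
      rw [add_assoc, add_assoc, add_neg_cancel, add_zero] at this
      rwa [sub_eq_add_neg]
    · rintro ⟨i, hi⟩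
      refine ⟨i + 1, ?_⟩
      have := add_int_mem_connectedComponentIn hT hi 1
      push_cast at this ⊢
      rwa [← add_assoc]
  constructor
  · have h1 := hn (w + 1) ((hT w).2 hw)
    rw [hSw] at h1
    have h2 := add_int_mem_connectedComponentIn hT h1 (-1)
    push_cast at h2
    rw [add_assoc w, add_neg_cancel, add_zero, add_assoc] at h2
    have h3 := huniq _ (n (w + 1) + -1) (n w) (by push_cast; exact h2) (hn w hw)
    simp only
    rw [hSw, ← h3]
    push_cast
    ring
  · intro w' hw'
    have hw'U : w' ∈ U := connectedComponentIn_subset _ _ hw'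
    have hS' : S w' = S w := by simp only [S, connectedComponentIn_eq hw']
    have h1 := hn w' hw'U
    rw [hS', ← connectedComponentIn_eq hw'] at h1
    simp only
    rw [hS', huniq _ _ _ h1 (hn w hw)]

theorem exists_kernel {Q : Set ℂ} {C : ℝ} (hQc : IsClosed Q) (hQp : IsPreconnected Q)
    (hT : ∀ z, z + 1 ∈ Q ↔ z ∈ Q) (hbot : ∀ z : ℂ, z.im < -C → z ∈ Q)
    (htop : ∀ z : ℂ, C < z.im → z ∉ Q) :
    ∃ (W : Set ℂ) (c : ℂ → ℂ) (Λ : ℂ → ℂ → ℂ), (∀ z : ℂ, C < z.im → z ∈ W) ∧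
      (∀ z, z + 1 ∈ W ↔ z ∈ W) ∧
      (∀ w, w ∉ Q → ∀ᶠ w' in 𝓝 w, (w' ∈ W ↔ w ∈ W) ∧ (w ∉ W → c w' = c w)) ∧
      (∀ w, w ∉ Q → w ∉ W → c w ∉ Q ∧ c (w + 1) = c w + 1) ∧
      ContinuousOn (uncurry Λ) (Q ×ˢ Qᶜ) ∧
      (∀ a ∈ Q, ∀ w ∉ Q, Λ (a + 1) (w + 1) = Λ a w) ∧
      (∀ a ∈ Q, ∀ w ∉ Q, w ∈ W → Complex.exp (Λ a w) = a - w) ∧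
      ∀ a ∈ Q, ∀ w ∉ Q, w ∉ W → Complex.exp (Λ a w) * (a - c w) = a - w := by
  classical
  have hTU : ∀ z, z + 1 ∈ Qᶜ ↔ z ∈ Qᶜ := fun z => not_congr (hT z)
  have hUo : IsOpen Qᶜ := hQc.isOpen_compl
  obtain ⟨c, hc1, hc2⟩ := exists_equivariant_base hUo (by rwa [compl_compl]) hTU
    (fun z hz => not_not.2 (hbot z hz)) htop
  set W := connectedComponentIn Qᶜ ⟨0, C + 1⟩ with hW
  have hWQ : W ⊆ Qᶜ := connectedComponentIn_subset _ _
  have hWhigh : ∀ z : ℂ, C < z.im → z ∈ W := fun z hz =>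
    (convex_halfSpace_im_gt C).isPreconnected.subset_connectedComponentIn
      (x := (⟨0, C + 1⟩ : ℂ)) (by simp) htop hz
  have hWn : ∀ z ∈ W, ∀ n : ℤ, z + n ∈ W := by
    intro z hz n
    have := add_int_mem_connectedComponentIn hTU hz n
    have h1 : (⟨0, C + 1⟩ : ℂ) + n ∈ W := hWhigh _ (by simp)
    rwa [← connectedComponentIn_eq h1] at this
  have hWT : ∀ z, z + 1 ∈ W ↔ z ∈ W := fun z =>
    ⟨fun h => by simpa using hWn _ h (-1), fun h => by simpa using hWn _ h 1⟩
  have hloc : ∀ w, w ∉ Q → ∀ᶠ w' in 𝓝 w, (w' ∈ W ↔ w ∈ W) ∧ (w ∉ W → c w' = c w) := by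
    intro w hw
    filter_upwards [hUo.connectedComponentIn.mem_nhds (mem_connectedComponentIn hw)] with w' hw'
    refine ⟨⟨fun h => ?_, fun h => ?_⟩, fun h => (hc2 w hw h).2 w' hw'⟩
    · rw [hW, connectedComponentIn_eq h, ← connectedComponentIn_eq hw']
      exact mem_connectedComponentIn hw
    · rw [hW, connectedComponentIn_eq h]
      exact hw'
  let δ : ℂ → ℂ → ℂ := fun w a => if w ∈ W then 1 else a - c w
  have hex : ∀ w, ∃ l, w ∉ Q → HasKernelLog Q C (δ w) w l := by
    intro w
    by_cases hw : w ∈ Q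
    · exact ⟨fun _ => 0, fun h => absurd hw h⟩
    suffices h : ∃ l, HasKernelLog Q C (δ w) w l by
      obtain ⟨l, hl⟩ := h; exact ⟨l, fun _ => hl⟩
    by_cases hwW : w ∈ W
    · have hδ : δ w = fun _ => 1 := by ext a; simp [δ, hwW]
      rw [hδ]
      refine HasKernelLog.exists_of_connected hQc hbot (w₀ := ⟨0, C + 1⟩)
        ⟨fun a => Complex.log (a - ⟨0, C + 1⟩), ?_, ?_, ?_⟩ hwW
      · refine ContinuousOn.clog (by fun_prop) fun a ha => ?_
        have := not_lt.1 fun h => htop a h ha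
        right
        simp only [Complex.sub_im]
        linarith
      · intro a ha
        rw [mul_one, Complex.exp_log]
        intro h
        rw [sub_eq_zero.1 h] at ha
        exact htop _ (by simp) ha
      · simp
    · have hδ : δ w = fun a => a - c w := by ext a; simp [δ, hwW]
      rw [hδ]
      have hcw := hc1 w hw
      refine HasKernelLog.exists_of_connected hQc hbot (w₀ := c w)
        ⟨fun _ => 0, continuousOn_const, by simp, by simp⟩ ?_
      rw [← connectedComponentIn_eq hcw]
      exact mem_connectedComponentIn hw
  choose Λ' hΛ using hex
  refine ⟨W, c, fun a w => Λ' w a, hWhigh, hWT, hloc,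
    fun w hw hwW => ⟨connectedComponentIn_subset _ _ (hc1 w hw), (hc2 w hw hwW).1⟩, ?_, ?_, ?_, ?_⟩
  · rintro ⟨a₀, w₀⟩ ⟨ha₀, hw₀⟩
    obtain ⟨r, hr, hball⟩ := Metric.isOpen_iff.1 hUo w₀ hw₀
    have hlt : ∀ w ∈ ball w₀ r, ∀ a ∈ Q, ‖w - w₀‖ < ‖a - w₀‖ := fun w hw a ha => by
      rw [mem_ball, dist_eq_norm] at hw
      by_contra! hle
      exact hball (by rw [mem_ball, dist_eq_norm]; linarith) ha
    have hne : ∀ a ∈ Q, a - w₀ ≠ 0 := fun a ha h => hw₀ (sub_eq_zero.1 h ▸ ha)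
    have hform : ∀ᶠ p in 𝓝[Q ×ˢ Qᶜ] (a₀, w₀),
        Λ' w₀ p.1 + Complex.log ((p.1 - p.2) / (p.1 - w₀)) = uncurry (fun a w => Λ' w a) p := by
      have h2 : Tendsto Prod.snd (𝓝[Q ×ˢ Qᶜ] (a₀, w₀)) (𝓝 w₀) :=
        continuous_snd.continuousAt.tendsto.mono_left nhdsWithin_le_nhds
      filter_upwards [h2 (hloc w₀ hw₀), h2 (ball_mem_nhds w₀ hr), self_mem_nhdsWithin]
        with ⟨a, w⟩ hp1 hp2 hp3
      have hδ : δ w = δ w₀ := by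
        ext x
        by_cases h : w₀ ∈ W
        · simp [δ, h, hp1.1.2 h]
        · simp [δ, h, mt hp1.1.1 h, hp1.2 h]
      have h3 := (hΛ w₀ hw₀).step hbot hw₀ hp3.2 (hlt w hp2)
      rw [← hδ] at h3
      exact h3.unique hQp hbot hp3.2 (hΛ w hp3.2) hp3.1
    refine ContinuousWithinAt.congr_of_eventuallyEq (f := fun p : ℂ × ℂ =>
      Λ' w₀ p.1 + Complex.log ((p.1 - p.2) / (p.1 - w₀))) ?_ (hform.mono fun _ h => h.symm)
      (hform.self_of_nhdsWithin ⟨ha₀, hw₀⟩).symm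
    refine ContinuousWithinAt.add ?_ ?_
    · exact ((hΛ w₀ hw₀).1 a₀ ha₀).comp continuous_fst.continuousWithinAt fun p hp => hp.1
    · refine ContinuousWithinAt.clog ?_ ?_
      · exact ContinuousWithinAt.div (by fun_prop) (by fun_prop) (hne a₀ ha₀)
      · simp only
        rw [div_self (hne a₀ ha₀)]
        exact Complex.one_mem_slitPlane
  · intro a ha w hw
    have hw1 : w + 1 ∉ Q := mt (hT w).1 hw
    have h1 := hΛ (w + 1) hw1
    have hδ : ∀ x, δ (w + 1) (x + 1) = δ w x := by
      intro x
      by_cases h : w ∈ W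
      · simp [δ, h, (hWT w).2 h]
      · simp [δ, h, mt (hWT w).1 h, (hc2 w hw h).1]
    have h2 : HasKernelLog Q C (δ w) w (fun x => Λ' (w + 1) (x + 1)) := by
      refine ⟨h1.1.comp (by fun_prop) fun x hx => (hT x).2 hx, fun x hx => ?_, fun x hx => ?_⟩
      · simp only
        rw [← hδ, h1.2.1 _ ((hT x).2 hx)]
        ring
      · simp only
        rw [h1.2.2 _ (by simpa using hx), hδ]
        congr 2
        ring
    exact h2.unique hQp hbot hw (hΛ w hw) ha
  · intro a ha w hw hwW
    have := (hΛ w hw).2.1 a ha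
    simpa [δ, hwW] using this
  · intro a ha w hw hwW
    have := (hΛ w hw).2.1 a ha
    simpa [δ, hwW] using this

theorem IsAnnular.symm_comm {f : ℂ ≃ₜ ℂ} (hf : IsAnnular f) (z : ℂ) :
    f.symm (z + 1) = f.symm z + 1 := by
  rw [f.symm_apply_eq, hf.comm, f.apply_symm_apply]

theorem IsAnnular.exists_bound_disp {f : ℂ ≃ₜ ℂ} (hf : IsAnnular f) (a b : ℝ) :
    ∃ B : ℝ, ∀ z : ℂ, z.im ∈ Icc a b → ‖f z - z‖ ≤ B :=
  exists_bound_on_strip (by fun_prop) (fun z => by rw [hf.comm]; ring) a b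

theorem IsAnnular.symm {f : ℂ ≃ₜ ℂ} (hf : IsAnnular f) : IsAnnular f.symm where
  comm := hf.symm_comm
  top := by
    intro C
    obtain ⟨M, hM⟩ := hf.bot 0
    obtain ⟨B, hB⟩ := hf.exists_bound_disp M C
    refine ⟨max (C + B) 0 + 1, fun w hw => ?_⟩
    by_contra! hlt
    obtain ⟨z, rfl⟩ := f.surjective w
    rw [f.symm_apply_apply] at hlt
    have h1 := le_max_left (C + B) 0
    have h2 := le_max_right (C + B) 0
    by_cases hz : z.im ≤ M
    · linarith [hM z hz]
    · have h3 := hB z ⟨by linarith, hlt.le⟩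
      have h4 := (Complex.abs_im_le_norm _).trans h3
      rw [Complex.sub_im] at h4
      linarith [(abs_le.1 h4).2]
  bot := by
    intro C
    obtain ⟨M, hM⟩ := hf.top 0
    obtain ⟨B, hB⟩ := hf.exists_bound_disp C M
    refine ⟨min (C - B) 0 - 1, fun w hw => ?_⟩
    by_contra! hlt
    obtain ⟨z, rfl⟩ := f.surjective w
    rw [f.symm_apply_apply] at hlt
    have h1 := min_le_left (C - B) 0
    have h2 := min_le_right (C - B) 0
    by_cases hz : M ≤ z.im
    · linarith [hM z hz]
    · have h3 := hB z ⟨hlt.le, by linarith⟩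
      have h4 := (Complex.abs_im_le_norm _).trans h3
      rw [Complex.sub_im] at h4
      linarith [(abs_le.1 h4).1]

/-- A trapping region at the lower end of the strip. -/
structure IsTrap (f : ℂ ≃ₜ ℂ) (C : ℝ) (A : Set ℂ) : Prop where
  isOpen : IsOpen A
  conn : IsPreconnected A
  per : ∀ z, z + 1 ∈ A ↔ z ∈ A
  trap : ∀ z ∈ closure A, f z ∈ A
  bot : ∀ z : ℂ, z.im < -C → z ∈ A
  top : ∀ z : ℂ, C < z.im → z ∉ closure A

theorem mem_closure_periodic {A : Set ℂ} (h : ∀ z, z + 1 ∈ A ↔ z ∈ A) (z : ℂ) :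
    z + 1 ∈ closure A ↔ z ∈ closure A := by
  have : (Homeomorph.addRight (1 : ℂ)) ⁻¹' A = A := by ext z; exact h z
  have h2 := (Homeomorph.addRight (1 : ℂ)).preimage_closure A
  rw [this] at h2
  exact Set.ext_iff.1 h2 z

/-- An extension, up to an explicit exponential factor, of the displacement `f z - z` across the
complement of a trapping region. -/
structure IsCollar (f : ℂ → ℂ) (A M : Set ℂ) (ρ B : ℂ → ℂ) : Prop where
  cont : ContinuousOn ρ Mᶜ
  cont' : ContinuousOn B (closure A \ M)
  per : ∀ z ∉ M, ρ (z + 1) = ρ z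
  per' : ∀ z ∈ closure A \ M, B (z + 1) = B z
  eq : ∀ z ∈ closure A \ M, ρ z * Complex.exp (B z) = f z - z
  zero : ∀ z ∉ M, ρ z = 0 → ∃ κ : ℂ, κ ≠ 0 ∧ ∀ᶠ w in 𝓝 z, ρ w = κ * (w - z)

theorem continuousOn_ite_of_eventually {S W : Set ℂ} {g₁ g₂ : ℂ → ℂ} [DecidablePred (· ∈ W)]
    (hloc : ∀ z ∈ S, ∀ᶠ w in 𝓝[S] z, (w ∈ W ↔ z ∈ W))
    (h1 : ∀ z ∈ S, z ∈ W → ContinuousWithinAt g₁ S z)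
    (h2 : ∀ z ∈ S, z ∉ W → ContinuousWithinAt g₂ S z) :
    ContinuousOn (fun z => if z ∈ W then g₁ z else g₂ z) S := by
  intro z hz
  by_cases hzW : z ∈ W
  · refine (h1 z hz hzW).congr_of_eventuallyEq ?_ (by simp [hzW])
    filter_upwards [hloc z hz] with w hw
    simp [hw.2 hzW]
  · refine (h2 z hz hzW).congr_of_eventuallyEq ?_ (by simp [hzW])
    filter_upwards [hloc z hz] with w hw
    simp [mt hw.1 hzW]

theorem IsTrap.exists_collar {f : ℂ ≃ₜ ℂ} (hf : IsAnnular f) {C : ℝ} {A : Set ℂ}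
    (hA : IsTrap f C A) : ∃ (C' : ℝ) (ρ B : ℂ → ℂ),
      IsCollar f A {z | f.symm z ∈ closure A} ρ B ∧ ∀ z : ℂ, C' < z.im → ρ z = 1 := by
  classical
  set M : Set ℂ := {z | f.symm z ∈ closure A} with hM
  have hMA : M ⊆ A := fun z hz => by simpa using hA.trap _ hz
  obtain ⟨N, hN⟩ := hf.symm.bot (-C - 1)
  have hMc : IsClosed M := isClosed_closure.preimage f.symm.continuous
  have hMp : IsPreconnected M := by
    have : M = f '' closure A := by rw [f.image_eq_preimage_symm]; rfl
    rw [this]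
    exact hA.conn.closure.image _ f.continuous.continuousOn
  have hMT : ∀ z, z + 1 ∈ M ↔ z ∈ M := fun z => by
    simp only [hM, mem_ofPred_eq, hf.symm_comm]
    exact mem_closure_periodic hA.per _
  obtain ⟨W, c, Λ, hW1, hW2, hW3, hc, hΛc, hΛp, hΛ1, hΛ2⟩ :=
    exists_kernel (C := max C (-N)) hMc hMp hMT (fun z hz => subset_closure (hA.bot _ (by
      have := le_max_right C (-N)
      have := hN z (by linarith)
      linarith))) (fun z hz h => hA.top z ((le_max_left _ _).trans_lt hz) (subset_closure (hMA h)))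
  obtain ⟨Θ, hΘc, hΘe, -, hΘp⟩ := hf.exists_log_ratio
  have hfM : ∀ z ∈ closure A, f z ∈ M := fun z hz => by simpa [hM] using hz
  have hne : ∀ z ∈ closure A, z ∉ M → z ∉ W → z ≠ f.symm (c z) := by
    intro z hz hzM hzW h
    have := hfM z hz
    rw [h, f.apply_symm_apply] at this
    exact (hc z hzM hzW).1 this
  refine ⟨max C (-N), fun z => if z ∈ W then 1 else z - f.symm (c z),
    fun z => if z ∈ W then Λ (f z) z else Λ (f z) z + Θ z (f.symm (c z)), ?_, fun z hz => by
      simp [hW1 z hz]⟩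
  have hcc : ∀ z ∉ M, z ∉ W → ContinuousAt (fun w => f.symm (c w)) z := by
    intro z hz hzW
    refine (continuousAt_const (y := f.symm (c z))).congr ?_
    filter_upwards [hW3 z hz] with w hw
    rw [hw.2 hzW]
  have hΛcc : ContinuousOn (fun z => Λ (f z) z) (closure A \ M) :=
    hΛc.comp (f := fun z => (f z, z)) (by fun_prop) fun z hz => ⟨hfM z hz.1, hz.2⟩
  constructor
  · refine continuousOn_ite_of_eventually
      (fun z hz => ((hW3 z hz).mono fun w hw => hw.1).filter_mono nhdsWithin_le_nhds)
      (fun z _ _ => continuousWithinAt_const) fun z hz hzW => ?_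
    exact (continuousAt_id.sub (hcc z hz hzW)).continuousWithinAt
  · refine continuousOn_ite_of_eventually
      (fun z hz => ((hW3 z hz.2).mono fun w hw => hw.1).filter_mono nhdsWithin_le_nhds)
      (fun z hz _ => hΛcc z hz) fun z hz hzW => ?_
    refine (hΛcc z hz).add (ContinuousAt.continuousWithinAt ?_)
    have hopen : {p : ℂ × ℂ | p.1 ≠ p.2} ∈ 𝓝 (z, f.symm (c z)) :=
      (isOpen_ne_fun continuous_fst continuous_snd).mem_nhds (hne z hz.1 hz.2 hzW)
    exact ContinuousAt.comp (g := uncurry Θ) (f := fun w => (w, f.symm (c w)))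
      (hΘc.continuousAt hopen) (continuousAt_id.prodMk (hcc z hz.2 hzW))
  · intro z hz
    by_cases h : z ∈ W
    · simp [h, (hW2 z).2 h]
    · simp only [h, mt (hW2 z).1 h, if_false, (hc z hz h).2, hf.symm_comm]
      ring
  · intro z hz
    have h1 : Λ (f (z + 1)) (z + 1) = Λ (f z) z := by
      rw [hf.comm, hΛp _ (hfM z hz.1) _ hz.2]
    by_cases h : z ∈ W
    · simp only [h, (hW2 z).2 h, if_true, h1]
    · simp only [h, mt (hW2 z).1 h, if_false, h1, (hc z hz.2 h).2, hf.symm_comm,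
        hΘp _ _ (hne z hz.1 hz.2 h)]
  · intro z hz
    by_cases h : z ∈ W
    · simp only [h, if_true, one_mul, hΛ1 _ (hfM z hz.1) z hz.2 h]
    · simp only [h, if_false]
      have h0 := hne z hz.1 hz.2 h
      rw [Complex.exp_add, hΘe _ _ h0, ← hΛ2 _ (hfM z hz.1) z hz.2 h, f.apply_symm_apply]
      have := sub_ne_zero.2 h0
      field_simp
  · intro z hz h0
    by_cases h : z ∈ W
    · simp [h] at h0
    · simp only [h, if_false] at h0
      refine ⟨1, one_ne_zero, ?_⟩
      filter_upwards [hW3 z hz] with w hw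
      simp only [mt hw.1.1 h, if_false, hw.2 h, ← sub_eq_zero.1 h0, one_mul]

/-- Conjugation of a homeomorphism of the plane by `z ↦ -z`. -/
def negConj (f : ℂ ≃ₜ ℂ) : ℂ ≃ₜ ℂ := (Homeomorph.neg ℂ).trans (f.trans (Homeomorph.neg ℂ))

@[simp] theorem negConj_apply (f : ℂ ≃ₜ ℂ) (z : ℂ) : negConj f z = -f (-z) := rfl

theorem mem_closure_neg {E : Set ℂ} {z : ℂ} : z ∈ closure (Neg.neg ⁻¹' E) ↔ -z ∈ closure E := by
  have h2 := (Homeomorph.neg ℂ).preimage_closure E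
  exact (Set.ext_iff.1 h2 z).symm

/-- A trapping region of the inverse map at the upper end of the strip. -/
def IsCotrap (f : ℂ ≃ₜ ℂ) (C : ℝ) (E : Set ℂ) : Prop :=
  IsTrap (negConj f.symm) C (Neg.neg ⁻¹' E)

theorem IsCotrap.isOpen {f : ℂ ≃ₜ ℂ} {C : ℝ} {E : Set ℂ} (h : IsCotrap f C E) : IsOpen E := by
  have := IsTrap.isOpen h
  exact (Homeomorph.neg ℂ).isOpen_preimage.1 this

theorem IsCotrap.conn {f : ℂ ≃ₜ ℂ} {C : ℝ} {E : Set ℂ} (h : IsCotrap f C E) :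
    IsPreconnected E := by
  have := (IsTrap.conn h).image Neg.neg continuous_neg.continuousOn
  rwa [image_preimage_eq _ neg_surjective] at this

theorem IsCotrap.per {f : ℂ ≃ₜ ℂ} {C : ℝ} {E : Set ℂ} (h : IsCotrap f C E) (z : ℂ) :
    z + 1 ∈ E ↔ z ∈ E := by
  have := (IsTrap.per h (-(z + 1))).symm
  simpa using this

theorem IsCotrap.trap {f : ℂ ≃ₜ ℂ} {C : ℝ} {E : Set ℂ} (h : IsCotrap f C E) (z : ℂ)
    (hz : z ∈ closure E) : f.symm z ∈ E := by
  have := IsTrap.trap h (-z) (mem_closure_neg.2 (by simpa using hz))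
  simpa using this

theorem IsCotrap.top {f : ℂ ≃ₜ ℂ} {C : ℝ} {E : Set ℂ} (h : IsCotrap f C E) (z : ℂ)
    (hz : C < z.im) : z ∈ E := by
  have := IsTrap.bot h (-z) (by simpa using hz)
  simpa using this

theorem IsCotrap.bot {f : ℂ ≃ₜ ℂ} {C : ℝ} {E : Set ℂ} (h : IsCotrap f C E) (z : ℂ)
    (hz : z.im < -C) : z ∉ closure E := by
  have := IsTrap.top h (-z) (by simp; linarith)
  rwa [mem_closure_neg, neg_neg] at this

theorem IsCotrap.mk {f : ℂ ≃ₜ ℂ} {C : ℝ} {E : Set ℂ} (h1 : IsOpen E) (h2 : IsPreconnected E)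
    (h3 : ∀ z, z + 1 ∈ E ↔ z ∈ E) (h4 : ∀ z ∈ closure E, f.symm z ∈ E)
    (h5 : ∀ z : ℂ, C < z.im → z ∈ E) (h6 : ∀ z : ℂ, z.im < -C → z ∉ closure E) :
    IsCotrap f C E where
  isOpen := h1.preimage continuous_neg
  conn := by
    have := h2.image Neg.neg continuous_neg.continuousOn
    rwa [image_neg_eq_neg] at this
  per z := by
    have := h3 (-(z + 1))
    simpa using this.symm
  trap z hz := by simpa using h4 _ (mem_closure_neg.1 hz)
  bot z hz := h5 _ (by simp; linarith)
  top z hz := by rw [mem_closure_neg]; exact h6 _ (by simpa using hz)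

theorem IsCotrap.exists_collar {f : ℂ ≃ₜ ℂ} (hf : IsAnnular f) {C : ℝ} {E : Set ℂ}
    (hE : IsCotrap f C E) : ∃ (C' : ℝ) (ρ B : ℂ → ℂ),
      IsCollar f E {z | f z ∈ closure E} ρ B ∧ ∀ z : ℂ, z.im < -C' → ρ z = 1 := by
  classical
  set M : Set ℂ := {z | f z ∈ closure E} with hM
  set Q : Set ℂ := closure (Neg.neg ⁻¹' E) with hQ
  have hQm : ∀ z ∈ closure E, -z ∈ Q := fun z hz => mem_closure_neg.2 (by simpa using hz)
  have hMQ : ∀ z ∉ M, -f z ∉ Q := fun z hz h => hz (by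
    have := mem_closure_neg.1 h
    rwa [neg_neg] at this)
  obtain ⟨W, c, Λ, hW1, hW2, hW3, hc, hΛc, hΛp, hΛ1, hΛ2⟩ :=
    exists_kernel (Q := Q) (C := C) isClosed_closure (IsTrap.conn hE).closure
      (mem_closure_periodic (IsTrap.per hE)) (fun z hz => subset_closure (IsTrap.bot hE z hz))
      (IsTrap.top hE)
  obtain ⟨N, hN⟩ := hf.bot (-C - 1)
  refine ⟨-N, fun z => if z ∈ {z | -f z ∈ W} then 1 else -z - c (-f z),
    fun z => Λ (-z) (-f z), ?_, fun z hz => by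
      have h1 : -f z ∈ W := hW1 _ (by
        have := hN z (by linarith)
        rw [Complex.neg_im]; linarith)
      simp [h1]⟩
  have hfn : Continuous fun z => -f z := by fun_prop
  have hloc : ∀ z ∉ M, ∀ᶠ w in 𝓝 z, (-f w ∈ W ↔ -f z ∈ W) ∧ (-f z ∉ W → c (-f w) = c (-f z)) :=
    fun z hz => hfn.continuousAt.eventually (hW3 _ (hMQ z hz))
  have hsub : ∀ z, -f (z + 1) = -f z - 1 := fun z => by rw [hf.comm]; ring
  have hWsub : ∀ z, z - 1 ∈ W ↔ z ∈ W := fun z => by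
    have := hW2 (z - 1)
    rw [sub_add_cancel] at this
    exact this.symm
  have hQT := mem_closure_periodic (IsTrap.per hE)
  have hQsub : ∀ z, z - 1 ∈ Q ↔ z ∈ Q := fun z => by
    have := hQT (z - 1)
    rw [sub_add_cancel] at this
    exact this.symm
  have hcsub : ∀ w, w ∉ Q → w ∉ W → c (w - 1) = c w - 1 := fun w h1 h2 => by
    have := (hc (w - 1) (mt (hQsub w).1 h1) (mt (hWsub w).1 h2)).2
    rw [sub_add_cancel] at this
    rw [this]; ring
  constructor
  · refine continuousOn_ite_of_eventually
      (fun z hz => ((hloc z hz).mono fun w hw => hw.1).filter_mono nhdsWithin_le_nhds)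
      (fun z _ _ => continuousWithinAt_const) fun z hz hzW => ?_
    refine ContinuousAt.continuousWithinAt ?_
    refine continuous_neg.continuousAt.sub ((continuousAt_const (y := c (-f z))).congr ?_)
    filter_upwards [hloc z hz] with w hw
    rw [hw.2 hzW]
  · exact hΛc.comp (f := fun z => (-z, -f z)) (by fun_prop) fun z hz =>
      ⟨hQm z hz.1, hMQ z hz.2⟩
  · intro z hz
    by_cases h : -f z ∈ W
    · simp only [mem_ofPred_eq, h, hsub, (hWsub _).2 h, if_true]
    · simp only [mem_ofPred_eq, h, hsub, mt (hWsub _).1 h, if_false, hcsub _ (hMQ z hz) h]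
      ring
  · intro z hz
    have h1 := hΛp (-(z + 1)) ((by
      have := (hQsub (-z)).2 (hQm z hz.1)
      rwa [neg_add, ← sub_eq_add_neg])) (-f (z + 1)) (by
        rw [hsub]; exact mt (hQsub _).1 (hMQ z hz.2))
    rw [← h1, hsub]
    congr 1 <;> ring
  · intro z hz
    by_cases h : -f z ∈ W
    · simp only [mem_ofPred_eq, h, if_true, one_mul, hΛ1 _ (hQm z hz.1) _ (hMQ z hz.2) h]
      ring
    · simp only [mem_ofPred_eq, h, if_false]
      rw [mul_comm, hΛ2 _ (hQm z hz.1) _ (hMQ z hz.2) h]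
      ring
  · intro z hz h0
    by_cases h : -f z ∈ W
    · simp [h] at h0
    · simp only [mem_ofPred_eq, h, if_false] at h0
      refine ⟨-1, by simp, ?_⟩
      filter_upwards [hloc z hz] with w hw
      simp only [mt hw.1.1 h, if_false, hw.2 h, ← sub_eq_zero.1 h0]
      ring

theorem infDist_periodic {S : Set ℂ} (h : ∀ z, z + 1 ∈ S ↔ z ∈ S) (z : ℂ) :
    infDist (z + 1) S = infDist z S := by
  have him : (fun z : ℂ => z + 1) '' S = S := by
    ext w
    refine ⟨?_, fun hw => ⟨w - 1, ?_, by simp⟩⟩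
    · rintro ⟨z, hz, rfl⟩; exact (h z).2 hz
    · have := h (w - 1); rw [sub_add_cancel] at this; exact this.1 hw
  have hiso : Isometry fun z : ℂ => z + 1 := isometry_add_right 1
  conv_lhs => rw [← him]
  exact infDist_image hiso

theorem exists_periodic_cutoff {S T : Set ℂ} (hS : IsClosed S) (hT : IsClosed T)
    (hS0 : S.Nonempty) (hT0 : T.Nonempty) (hd : Disjoint S T) (hSp : ∀ z, z + 1 ∈ S ↔ z ∈ S)
    (hTp : ∀ z, z + 1 ∈ T ↔ z ∈ T) :
    ∃ σ : ℂ → ℝ, Continuous σ ∧ (∀ z, σ (z + 1) = σ z) ∧ (∀ z ∈ S, σ z = 0) ∧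
      ∀ z ∈ T, ∀ᶠ w in 𝓝 z, σ w = 1 := by
  have hpos : ∀ z, 0 < infDist z S + infDist z T := by
    intro z
    have h1 := infDist_nonneg (x := z) (s := S)
    have h2 := infDist_nonneg (x := z) (s := T)
    by_contra! h
    exact hd.ne_of_mem ((hS.mem_iff_infDist_zero hS0).2 (by linarith))
      ((hT.mem_iff_infDist_zero hT0).2 (by linarith)) rfl
  refine ⟨fun z => min 1 (2 * infDist z S / (infDist z S + infDist z T)), ?_, ?_, ?_, ?_⟩
  · refine continuous_const.min (Continuous.div ?_ ?_ fun z => (hpos z).ne')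
    · exact continuous_const.mul (continuous_infDist_pt S)
    · exact (continuous_infDist_pt S).add (continuous_infDist_pt T)
  · intro z
    simp only [infDist_periodic hSp, infDist_periodic hTp]
  · intro z hz
    simp [infDist_zero_of_mem hz]
  · intro z hz
    have h0 : infDist z T < infDist z S := by
      have := hpos z
      rw [infDist_zero_of_mem hz] at this ⊢
      linarith
    filter_upwards [(continuous_infDist_pt T).continuousAt.eventually_lt
      (continuous_infDist_pt S).continuousAt h0] with w hw
    rw [min_eq_left]
    rw [one_le_div (hpos w)]
    linarith

theorem continuousAt_of_collar {A M : Set ℂ} {ρ B û : ℂ → ℂ} {σ : ℂ → ℝ} {z₀ : ℂ}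
    (hM : IsClosed M) (hz₀ : z₀ ∉ A) (hz₀M : z₀ ∉ M) (hρ : ContinuousOn ρ Mᶜ)
    (hB : ContinuousOn B (closure A \ M)) (hσ : Continuous σ) (hσ0 : ∀ z ∉ A, σ z = 0)
    (h1 : ∀ᶠ z in 𝓝 z₀, z ∉ A → û z = ρ z)
    (h2 : ∀ᶠ z in 𝓝 z₀, z ∈ A → û z = ρ z * Complex.exp (σ z * B z)) : ContinuousAt û z₀ := by
  have hρ0 : ContinuousAt ρ z₀ := hρ.continuousAt (hM.isOpen_compl.mem_nhds hz₀M)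
  have he1 : ∀ᶠ z in 𝓝[Aᶜ] z₀, û z = ρ z := by
    filter_upwards [nhdsWithin_le_nhds h1, self_mem_nhdsWithin] with z hz hzA
    exact hz hzA
  have hc1 : ContinuousWithinAt û Aᶜ z₀ :=
    hρ0.continuousWithinAt.congr_of_eventuallyEq he1 (he1.self_of_nhdsWithin hz₀)
  have he2 : ∀ᶠ z in 𝓝[closure A] z₀, û z = ρ z * Complex.exp (σ z * B z) := by
    filter_upwards [nhdsWithin_le_nhds h1, nhdsWithin_le_nhds h2] with z hz hz'
    by_cases hzA : z ∈ A
    · exact hz' hzA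
    · simp [hz hzA, hσ0 z hzA]
  have hMn : ∀ᶠ z in 𝓝[closure A] z₀, z ∉ M := nhdsWithin_le_nhds (hM.isOpen_compl.mem_nhds hz₀M)
  have hc2 : ContinuousWithinAt û (closure A) z₀ := by
    by_cases hz₀A : z₀ ∈ closure A
    · refine ContinuousWithinAt.congr_of_eventuallyEq ?_ he2 (he2.self_of_nhdsWithin hz₀A)
      refine hρ0.continuousWithinAt.mul (ContinuousWithinAt.cexp ?_)
      refine ContinuousWithinAt.mul (by fun_prop) ?_
      exact (hB z₀ ⟨hz₀A, hz₀M⟩).mono_of_mem_nhdsWithin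
        (by filter_upwards [hMn, self_mem_nhdsWithin] with z hz hz'; exact ⟨hz', hz⟩)
    · rw [ContinuousWithinAt, notMem_closure_iff_nhdsWithin_eq_bot.1 (by rwa [closure_closure])]
      exact tendsto_bot
  have huniv : Aᶜ ∪ closure A = univ := by
    rw [eq_univ_iff_forall]
    intro z
    by_cases h : z ∈ A
    · exact Or.inr (subset_closure h)
    · exact Or.inl h
  rw [← continuousWithinAt_univ, ← huniv]
  exact hc1.union hc2

/-- A pair of complementary trapping regions between which `f` has no fixed points. -/
structure IsTrapPair (f : ℂ ≃ₜ ℂ) (C : ℝ) (A E : Set ℂ) : Prop where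
  trap : IsTrap f C A
  cotrap : IsCotrap f C E
  union : A ∪ E = univ
  ne : ∀ z ∈ A ∩ E, f z ≠ z

theorem IsTrapPair.exists_log {f : ℂ ≃ₜ ℂ} (hf : IsAnnular f) {C : ℝ} {A E : Set ℂ}
    (h : IsTrapPair f C A E) :
    ∃ l, ContinuousOn l (A ∩ E) ∧ ∀ z ∈ A ∩ E, Complex.exp (l z) = f z - z := by
  classical
  obtain ⟨C₁, ρ, B, hρ, hρt⟩ := h.trap.exists_collar hf
  obtain ⟨C₂, ρ', B', hρ', hρb⟩ := h.cotrap.exists_collar hf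
  set M : Set ℂ := {z | f.symm z ∈ closure A} with hM
  set M' : Set ℂ := {z | f z ∈ closure E} with hM'
  have hAo := h.trap.isOpen
  have hEo := h.cotrap.isOpen
  have hMc : IsClosed M := isClosed_closure.preimage f.symm.continuous
  have hMc' : IsClosed M' := isClosed_closure.preimage f.continuous
  have hMA : M ⊆ A := fun z hz => by simpa using h.trap.trap _ hz
  have hME : M' ⊆ E := fun z hz => by simpa using h.cotrap.trap _ hz
  have hmem : ∀ z, z ∈ A ∨ z ∈ E := fun z => by
    have := mem_univ z; rwa [← h.union] at this
  have hbotmem : (⟨0, -C - 1⟩ : ℂ) ∉ E := fun h' =>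
    h.cotrap.bot _ (by simp) (subset_closure h')
  have htopmem : (⟨0, C + 1⟩ : ℂ) ∉ A := fun h' => h.trap.top _ (by simp) (subset_closure h')
  have hMp : ∀ z, z + 1 ∈ M ↔ z ∈ M := fun z => by
    simp only [hM, mem_ofPred_eq, hf.symm_comm]
    exact mem_closure_periodic h.trap.per _
  have hMp' : ∀ z, z + 1 ∈ M' ↔ z ∈ M' := fun z => by
    simp only [hM', mem_ofPred_eq, hf.comm]
    exact mem_closure_periodic h.cotrap.per _
  obtain ⟨σ, hσ, hσp, hσ0, hσ1⟩ := exists_periodic_cutoff (S := Aᶜ) (T := Eᶜ ∪ M)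
    hAo.isClosed_compl (hEo.isClosed_compl.union hMc) ⟨_, htopmem⟩ ⟨_, Or.inl hbotmem⟩
    (disjoint_left.2 fun z hz hz' => hz'.elim (fun h' => (hmem z).elim hz h') fun h' => hz (hMA h'))
    (fun z => not_congr (h.trap.per z)) (fun z => or_congr (not_congr (h.cotrap.per z)) (hMp z))
  obtain ⟨τ, hτ, hτp, hτ0, hτ1⟩ := exists_periodic_cutoff (S := Eᶜ) (T := Aᶜ ∪ M')
    hEo.isClosed_compl (hAo.isClosed_compl.union hMc') ⟨_, hbotmem⟩ ⟨_, Or.inl htopmem⟩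
    (disjoint_left.2 fun z hz hz' => hz'.elim (fun h' => (hmem z).elim h' hz) fun h' => hz (hME h'))
    (fun z => not_congr (h.cotrap.per z)) (fun z => or_congr (not_congr (h.trap.per z)) (hMp' z))
  have hσM : ∀ z ∈ M, σ z = 1 := fun z hz => (hσ1 z (Or.inr hz)).self_of_nhds
  have hτM : ∀ z ∈ M', τ z = 1 := fun z hz => (hτ1 z (Or.inr hz)).self_of_nhds
  let b : ℂ → ℂ := fun z => (1 - σ z) * B z
  let b' : ℂ → ℂ := fun z => (1 - τ z) * B' z
  have hcut : ∀ {S N : Set ℂ} {s : ℂ → ℝ} {G : ℂ → ℂ}, IsOpen S → IsClosed N → Continuous s →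
      (∀ z ∈ N, ∀ᶠ w in 𝓝 z, s w = 1) → ContinuousOn G (closure S \ N) →
      ∀ z ∈ S, ContinuousAt (fun z => (1 - s z) * G z) z := by
    intro S N s G hSo hN hs hs1 hG z hz
    by_cases hzN : z ∈ N
    · refine (continuousAt_const (y := (0 : ℂ))).congr ?_
      filter_upwards [hs1 z hzN] with w hw
      simp [hw]
    · refine ContinuousAt.mul (by fun_prop) (hG.continuousAt ?_)
      filter_upwards [hSo.mem_nhds hz, hN.isOpen_compl.mem_nhds hzN] with w hw hw'
      exact ⟨subset_closure hw, hw'⟩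
  have hb : ∀ z ∈ A, ContinuousAt b z :=
    hcut hAo hMc hσ (fun z hz => hσ1 z (Or.inr hz)) hρ.cont'
  have hb' : ∀ z ∈ E, ContinuousAt b' z :=
    hcut hEo hMc' hτ (fun z hz => hτ1 z (Or.inr hz)) hρ'.cont'
  let û : ℂ → ℂ := fun z => if z ∈ A then if z ∈ E then
    (f z - z) * Complex.exp (-(b z + b' z)) else ρ' z else ρ z
  have hûA : ∀ z, z ∉ A → û z = ρ z := fun z hz => by simp [û, hz]
  have hûE : ∀ z, z ∉ E → û z = ρ' z := fun z hz => by
    simp [û, hz, (hmem z).resolve_right hz]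
  have hûm : ∀ z, z ∈ A → z ∈ E → û z = (f z - z) * Complex.exp (-(b z + b' z)) :=
    fun z h1 h2 => by simp [û, h1, h2]
  have hcont : Continuous û := by
    rw [continuous_iff_continuousAt]
    intro z
    by_cases hzA : z ∈ A
    · by_cases hzE : z ∈ E
      · have : ContinuousAt (fun z => (f z - z) * Complex.exp (-(b z + b' z))) z :=
          ContinuousAt.mul (by fun_prop) ((hb z hzA).add (hb' z hzE)).neg.cexp
        refine this.congr ?_
        filter_upwards [hAo.mem_nhds hzA, hEo.mem_nhds hzE] with w h1 h2
        exact (hûm w h1 h2).symm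
      · refine continuousAt_of_collar (σ := τ) hMc' hzE (fun h' => hzE (hME h')) hρ'.cont
          hρ'.cont' hτ hτ0 (Eventually.of_forall hûE) ?_
        filter_upwards [hσ1 z (Or.inl hzE), hAo.mem_nhds hzA,
          hMc'.isOpen_compl.mem_nhds fun h' => hzE (hME h')] with w hw hwA hwM hwE
        rw [hûm w hwA hwE, ← hρ'.eq w ⟨subset_closure hwE, hwM⟩, mul_assoc, ← Complex.exp_add]
        simp only [b, b', hw]
        congr 2
        push_cast
        ring
    · refine continuousAt_of_collar (σ := σ) hMc hzA (fun h' => hzA (hMA h')) hρ.cont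
          hρ.cont' hσ hσ0 (Eventually.of_forall hûA) ?_
      filter_upwards [hτ1 z (Or.inl hzA), hEo.mem_nhds ((hmem z).resolve_left hzA),
        hMc.isOpen_compl.mem_nhds fun h' => hzA (hMA h')] with w hw hwE hwM hwA
      rw [hûm w hwA hwE, ← hρ.eq w ⟨subset_closure hwA, hwM⟩, mul_assoc, ← Complex.exp_add]
      simp only [b, b', hw]
      congr 2
      push_cast
      ring
  have hper : ∀ z, û (z + 1) = û z := by
    intro z
    by_cases hzA : z ∈ A
    · by_cases hzE : z ∈ E
      · have hbp : b (z + 1) = b z := by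
          by_cases hz : z ∈ M
          · simp [b, hσp, hσM z hz]
          · simp only [b, hσp, hρ.per' z ⟨subset_closure hzA, hz⟩]
        have hbp' : b' (z + 1) = b' z := by
          by_cases hz : z ∈ M'
          · simp [b', hτp, hτM z hz]
          · simp only [b', hτp, hρ'.per' z ⟨subset_closure hzE, hz⟩]
        rw [hûm z hzA hzE, hûm _ ((h.trap.per z).2 hzA) ((h.cotrap.per z).2 hzE), hbp, hbp', hf.comm]
        ring
      · rw [hûE z hzE, hûE _ (mt (h.cotrap.per z).1 hzE), hρ'.per z fun h' => hzE (hME h')]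
    · rw [hûA z hzA, hûA _ (mt (h.trap.per z).1 hzA), hρ.per z fun h' => hzA (hMA h')]
  have hzero : ∀ z, û z = 0 → ∃ κ : ℂ, κ ≠ 0 ∧ ∀ᶠ w in 𝓝 z, û w = κ * (w - z) := by
    intro z hz
    by_cases hzA : z ∈ A
    · by_cases hzE : z ∈ E
      · rw [hûm z hzA hzE] at hz
        exact absurd hz (mul_ne_zero (sub_ne_zero.2 (h.ne z ⟨hzA, hzE⟩)) (Complex.exp_ne_zero _))
      · have hzM : z ∉ M' := fun h' => hzE (hME h')
        rw [hûE z hzE] at hz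
        have hcl : z ∉ closure E := fun hcl => by
          have := hρ'.eq z ⟨hcl, hzM⟩
          rw [hz, zero_mul, eq_comm, sub_eq_zero] at this
          have h2 := h.cotrap.trap z hcl
          rw [← this, f.symm_apply_apply] at h2
          exact hzE h2
        obtain ⟨κ, hκ, hev⟩ := hρ'.zero z hzM hz
        refine ⟨κ, hκ, ?_⟩
        filter_upwards [hev, isClosed_closure.isOpen_compl.mem_nhds hcl] with w hw hwE
        rw [hûE w fun h' => hwE (subset_closure h'), hw]
    · have hzM : z ∉ M := fun h' => hzA (hMA h')
      rw [hûA z hzA] at hz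
      have hcl : z ∉ closure A := fun hcl => by
        have := hρ.eq z ⟨hcl, hzM⟩
        rw [hz, zero_mul, eq_comm, sub_eq_zero] at this
        have h2 := h.trap.trap z hcl
        rw [this] at h2
        exact hzA h2
      obtain ⟨κ, hκ, hev⟩ := hρ.zero z hzM hz
      refine ⟨κ, hκ, ?_⟩
      filter_upwards [hev, isClosed_closure.isOpen_compl.mem_nhds hcl] with w hw hwA
      rw [hûA w fun h' => hwA (subset_closure h'), hw]
  have hne := ne_zero_of_periodic_of_const_ends (C := max C (max C₁ C₂)) (c₁ := 1) (c₂ := 1) hcont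
    hper one_ne_zero one_ne_zero (fun z hz => by
      simp only [max_lt_iff] at hz
      rw [hûA z fun h' => h.trap.top z hz.1 (subset_closure h'), hρt z hz.2.1])
    (fun z hz => by
      rw [lt_neg] at hz
      simp only [max_lt_iff] at hz
      rw [hûE z fun h' => h.cotrap.bot z (by linarith) (subset_closure h'), hρb z (by linarith)])
    hzero
  obtain ⟨l, hl, hle⟩ := exists_log_of_ne_zero û hcont hne
  refine ⟨fun z => l z + (b z + b' z), fun z hz => ?_, fun z hz => ?_⟩
  · exact (hl.continuousAt.add ((hb z hz.1).add (hb' z hz.2))).continuousWithinAt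
  · rw [Complex.exp_add, hle, hûm z hz.1 hz.2, Complex.exp_neg, mul_assoc,
      inv_mul_cancel₀ (Complex.exp_ne_zero _), mul_one]

theorem IsAnnular.negConj {f : ℂ ≃ₜ ℂ} (hf : IsAnnular f) : IsAnnular (negConj f) where
  comm z := by
    have := hf.comm (-(z + 1))
    rw [neg_add, neg_add_cancel_right] at this
    simp only [negConj_apply, neg_add, this]
    ring
  top C := by
    obtain ⟨M, hM⟩ := hf.bot (-C)
    refine ⟨-M, fun z hz => ?_⟩
    have := hM (-z) (by simp; linarith)
    simp; linarith
  bot C := by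
    obtain ⟨M, hM⟩ := hf.top (-C)
    refine ⟨-M, fun z hz => ?_⟩
    have := hM (-z) (by simp; linarith)
    simp; linarith

theorem IsTrap.mono {f : ℂ ≃ₜ ℂ} {C C' : ℝ} {A : Set ℂ} (h : IsTrap f C A) (hC : C ≤ C') :
    IsTrap f C' A :=
  { h with
    bot := fun z hz => h.bot z (by linarith)
    top := fun z hz => h.top z (by linarith) }

theorem IsTrap.preimage {f : ℂ ≃ₜ ℂ} (hf : IsAnnular f) {C : ℝ} {A : Set ℂ} (h : IsTrap f C A) :
    ∃ C', IsTrap f C' (f ⁻¹' A) := by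
  obtain ⟨M, hM⟩ := hf.top (C + 1)
  obtain ⟨N, hN⟩ := hf.bot (-C - 1)
  refine ⟨max M (-N), h.isOpen.preimage f.continuous, ?_, fun z => ?_, fun z hz => ?_,
    fun z hz => ?_, fun z hz hz' => ?_⟩
  · rw [← f.image_symm]
    exact h.conn.image _ f.symm.continuous.continuousOn
  · simp only [mem_preimage, hf.comm, h.per]
  · rw [← f.preimage_closure] at hz
    exact h.trap _ hz
  · have := le_max_right M (-N)
    exact h.bot _ (by have := hN z (by linarith); linarith)
  · rw [← f.preimage_closure] at hz'
    have := le_max_left M (-N)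
    exact h.top _ (by have := hM z (by linarith); linarith) hz'

theorem IsCotrap.preimage {f : ℂ ≃ₜ ℂ} (hf : IsAnnular f) {C : ℝ} {E : Set ℂ}
    (h : IsCotrap f C E) : ∃ C', IsCotrap f C' (f.symm ⁻¹' E) := by
  obtain ⟨C', h'⟩ := IsTrap.preimage hf.symm.negConj h
  refine ⟨C', ?_⟩
  have : negConj f.symm ⁻¹' (Neg.neg ⁻¹' E) = Neg.neg ⁻¹' (f.symm ⁻¹' E) := by
    ext z; simp
  rwa [this] at h'

theorem IsTrapPair.preimage {f : ℂ ≃ₜ ℂ} (hf : IsAnnular f) {C : ℝ} {A E : Set ℂ}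
    (h : IsTrapPair f C A E) : ∃ C', IsTrapPair f C' (f ⁻¹' A) (f.symm ⁻¹' E) := by
  obtain ⟨C₁, h₁⟩ := h.trap.preimage hf
  obtain ⟨C₂, h₂⟩ := h.cotrap.preimage hf
  refine ⟨max C₁ C₂, h₁.mono (le_max_left _ _), IsTrap.mono h₂ (le_max_right _ _), ?_, ?_⟩
  · rw [eq_univ_iff_forall]
    intro z
    have hz := mem_univ z
    rw [← h.union] at hz
    rcases hz with hz | hz
    · exact Or.inl (h.trap.trap z (subset_closure hz))
    · exact Or.inr (h.cotrap.trap z (subset_closure hz))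
  · rintro z ⟨h1, h2⟩ hz
    rw [mem_preimage, hz] at h1
    rw [mem_preimage, f.symm_apply_eq.2 hz.symm] at h2
    exact h.ne z ⟨h1, h2⟩ hz

/-- The pieces of the exhaustion of the invariant region generated by a trap pair. -/
def trapPiece (f : ℂ ≃ₜ ℂ) (A E : Set ℂ) (n : ℕ) : Set ℂ :=
  {z | f^[n] z ∈ A ∧ f.symm^[n] z ∈ E}

theorem IsTrapPair.iterate {f : ℂ ≃ₜ ℂ} (hf : IsAnnular f) {C : ℝ} {A E : Set ℂ}
    (h : IsTrapPair f C A E) (n : ℕ) :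
    ∃ C', IsTrapPair f C' {z | f^[n] z ∈ A} {z | f.symm^[n] z ∈ E} := by
  induction n with
  | zero => exact ⟨C, h⟩
  | succ n ih =>
    obtain ⟨C', h'⟩ := ih
    exact h'.preimage hf

theorem trapPiece_mono {f : ℂ ≃ₜ ℂ} {C : ℝ} {A E : Set ℂ} (h : IsTrapPair f C A E) :
    Monotone (trapPiece f A E) := by
  refine monotone_nat_of_le_succ fun n z hz => ⟨?_, ?_⟩
  · rw [iterate_succ_apply']
    exact h.trap.trap _ (subset_closure hz.1)
  · rw [iterate_succ_apply']
    exact h.cotrap.trap _ (subset_closure hz.2)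

theorem IsTrapPair.isOpen_piece {f : ℂ ≃ₜ ℂ} (hf : IsAnnular f) {C : ℝ} {A E : Set ℂ}
    (h : IsTrapPair f C A E) (n : ℕ) : IsOpen (trapPiece f A E n) := by
  obtain ⟨C', h'⟩ := h.iterate hf n
  exact h'.trap.isOpen.inter h'.cotrap.isOpen

theorem IsTrapPair.isPreconnected_piece {f : ℂ ≃ₜ ℂ} (hf : IsAnnular f) {C : ℝ} {A E : Set ℂ}
    (h : IsTrapPair f C A E) (n : ℕ) : IsPreconnected (trapPiece f A E n) := by
  obtain ⟨C', h'⟩ := h.iterate hf n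
  exact isPreconnected_inter_of_union_eq_univ h'.trap.isOpen h'.cotrap.isOpen h'.trap.conn
    h'.cotrap.conn h'.union

theorem IsTrapPair.exists_log_iUnion {f : ℂ ≃ₜ ℂ} (hf : IsAnnular f) {C : ℝ} {A E : Set ℂ}
    (h : IsTrapPair f C A E) {z₀ : ℂ} (hz₀ : z₀ ∈ A ∩ E) :
    ∃ l, ContinuousOn l (⋃ n, trapPiece f A E n) ∧
      ∀ z ∈ ⋃ n, trapPiece f A E n, Complex.exp (l z) = f z - z := by
  have hex : ∀ n, ∃ l, ContinuousOn l (trapPiece f A E n) ∧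
      ∀ z ∈ trapPiece f A E n, Complex.exp (l z) = f z - z := fun n => by
    obtain ⟨C', h'⟩ := h.iterate hf n
    exact h'.exists_log hf
  choose L hLc hLe using hex
  have hz : ∀ n, z₀ ∈ trapPiece f A E n := fun n => trapPiece_mono h (Nat.zero_le n) hz₀
  let l : ℕ → ℂ → ℂ := fun n z => L n z - (L n z₀ - L 0 z₀)
  have hlc : ∀ n, ContinuousOn (l n) (trapPiece f A E n) := fun n => (hLc n).sub continuousOn_const
  have hle : ∀ n, ∀ z ∈ trapPiece f A E n, Complex.exp (l n z) = f z - z := by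
    intro n z hzn
    have := h.ne z₀ hz₀
    simp only [l]
    rw [Complex.exp_sub, Complex.exp_sub, hLe n z hzn, hLe n z₀ (hz n), hLe 0 z₀ (hz 0),
      div_self (sub_ne_zero.2 this), div_one]
  have hmn : ∀ m n, m ≤ n → ∀ z ∈ trapPiece f A E m, l m z = l n z := by
    intro m n hmn z hzm
    have hsub := trapPiece_mono h hmn
    refine log_unique (h.isPreconnected_piece hf m) (hlc m) ((hlc n).mono hsub) (fun x hx => ?_)
      (hz m) (by simp [l]) hzm
    rw [hle m x hx, hle n x (hsub hx)]
  have hall : ∀ m n, ∀ z, z ∈ trapPiece f A E m → z ∈ trapPiece f A E n → l m z = l n z := by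
    intro m n z h1 h2
    rcases le_total m n with hle | hle
    · exact hmn m n hle z h1
    · exact (hmn n m hle z h2).symm
  have hN : ∀ z, ∃ n, (z ∈ ⋃ n, trapPiece f A E n) → z ∈ trapPiece f A E n := by
    intro z
    by_cases hz : z ∈ ⋃ n, trapPiece f A E n
    · obtain ⟨n, hn⟩ := mem_iUnion.1 hz
      exact ⟨n, fun _ => hn⟩
    · exact ⟨0, fun h => absurd h hz⟩
  choose N hN using hN
  refine ⟨fun z => l (N z) z, fun z hzU => ?_, fun z hzU => hle _ z (hN z hzU)⟩
  obtain ⟨n, hn⟩ := mem_iUnion.1 hzU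
  have hnh := (h.isOpen_piece hf n).mem_nhds hn
  refine (((hlc n).continuousAt hnh).congr ?_).continuousWithinAt
  filter_upwards [hnh] with w hw
  exact hall _ _ w hw (hN w (mem_iUnion.2 ⟨n, hw⟩))

theorem IsTrapPair.isBrouwerOn {f : ℂ ≃ₜ ℂ} (hf : IsAnnular f) {C : ℝ} {A E : Set ℂ}
    (h : IsTrapPair f C A E) {z₀ : ℂ} (hz₀ : z₀ ∈ A ∩ E) :
    IsBrouwerOn f (⋃ n, trapPiece f A E n) where
  inv := by
    intro z
    simp only [mem_iUnion]
    constructor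
    · rintro ⟨n, h1, h2⟩
      refine ⟨n + 1, h1, ?_⟩
      rw [iterate_succ_apply']
      refine h.cotrap.trap _ (subset_closure ?_)
      cases n with
      | zero =>
        have := h.cotrap.trap _ (subset_closure h2)
        simpa using this
      | succ n =>
        rw [iterate_succ_apply, f.symm_apply_apply] at h2
        rw [iterate_succ_apply']
        exact h.cotrap.trap _ (subset_closure h2)
    · rintro ⟨n, h1, h2⟩
      refine ⟨n + 1, ?_, ?_⟩
      · rw [← iterate_succ_apply f, iterate_succ_apply', iterate_succ_apply']
        exact h.trap.trap _ (subset_closure (h.trap.trap _ (subset_closure h1)))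
      · rwa [iterate_succ_apply, f.symm_apply_apply]
  log_disp := h.exists_log_iUnion hf hz₀
  log_ratio := by
    obtain ⟨Θ, h1, h2, h3, -⟩ := hf.exists_log_ratio
    exact ⟨Θ, h1, h2, h3⟩

theorem IsTrapPair.no_closed_chain {f : ℂ ≃ₜ ℂ} (hf : IsAnnular f) {C : ℝ} {A E : Set ℂ}
    (h : IsTrapPair f C A E) : ∃ ε > 0, ∀ (n : ℕ) (z : ℕ → ℂ), 1 ≤ n → z n = z 0 →
      (∀ i < n, dist (f (z i)) (z (i + 1)) < ε) → (∀ i < n, z i ∈ A ∩ E) → False := by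
  set Ω := ⋃ n, trapPiece f A E n with hΩ
  have hΩo : IsOpen Ω := isOpen_iUnion fun n => h.isOpen_piece hf n
  have hper : ∀ z, z ∈ Ω → ∀ n : ℤ, z + n ∈ Ω := by
    intro z hz n
    obtain ⟨m, hm⟩ := mem_iUnion.1 hz
    obtain ⟨C', h'⟩ := h.iterate hf m
    exact mem_iUnion.2 ⟨m, (add_int_mem_iff h'.trap.per z n).2 hm.1,
      (add_int_mem_iff h'.cotrap.per z n).2 hm.2⟩
  let P : ℂ → ℝ → Prop := fun y r => ball y r ⊆ Ω ∧ ∀ w ∈ ball y r, f w ∉ ball y r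
  have hPper : ∀ y r, P y r → ∀ n : ℤ, P (y + n) r := by
    rintro y r ⟨h1, h2⟩ n
    have hb : ∀ w, w ∈ ball (y + n) r → w + (-n : ℤ) ∈ ball y r := fun w hw => by
      rw [mem_ball, dist_eq_norm] at hw ⊢
      convert hw using 2
      push_cast; ring
    refine ⟨fun w hw => ?_, fun w hw hfw => ?_⟩
    · have := hper _ (h1 (hb w hw)) n
      push_cast at this
      rwa [neg_add_cancel_right] at this
    · refine h2 _ (hb w hw) ?_
      rw [map_add_int hf.comm]
      exact hb _ hfw
  have hPloc : ∀ y ∈ Ω, f y ≠ y → ∃ r > 0, P y r := by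
    intro y hy hne
    have hev : ∀ᶠ w in 𝓝 y, dist (f w) y > dist (f y) y / 2 := by
      have : ContinuousAt (fun w => dist (f w) y) y := by fun_prop
      exact this.eventually (lt_mem_nhds (half_lt_self (dist_pos.2 hne)))
    obtain ⟨r₁, hr₁, h₁⟩ := Metric.eventually_nhds_iff_ball.1 hev
    obtain ⟨r₂, hr₂, h₂⟩ := Metric.isOpen_iff.1 hΩo y hy
    refine ⟨min (min r₁ r₂) (dist (f y) y / 2), lt_min (lt_min hr₁ hr₂) (half_pos (dist_pos.2 hne)),
      ?_, fun w hw hfw => ?_⟩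
    · exact (ball_subset_ball ((min_le_left _ _).trans (min_le_right _ _))).trans h₂
    · have := h₁ w (ball_subset_ball ((min_le_left _ _).trans (min_le_left _ _)) hw)
      have h3 := ball_subset_ball (min_le_right _ _) hfw
      rw [mem_ball] at h3
      linarith
  set K : Set ℂ := {z | z.re ∈ Icc (0 : ℝ) 1 ∧ z.im ∈ Icc (-C) C} ∩ (closure A ∩ closure E) with hK
  have hKc : IsCompact K := (isCompact_strip_fundamental (-C) C).inter_right
    (isClosed_closure.inter isClosed_closure)
  have hmono : ∀ y r s, s ≤ r → P y r → P y s := fun y r s hs h' =>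
    ⟨(ball_subset_ball hs).trans h'.1, fun w hw hfw =>
      h'.2 w (ball_subset_ball hs hw) (ball_subset_ball hs hfw)⟩
  have hfK : ∀ z ∈ closure A ∩ closure E, f z ∈ Ω ∧ f (f z) ≠ f z := by
    rintro z ⟨h1, h2⟩
    have h3 := h.trap.trap z h1
    have h4 := h.cotrap.trap z h2
    refine ⟨mem_iUnion.2 ⟨2, ?_, ?_⟩, fun heq => ?_⟩
    · exact h.trap.trap _ (subset_closure (h.trap.trap _ (subset_closure h3)))
    · change f.symm (f.symm (f z)) ∈ E
      rwa [f.symm_apply_apply]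
    · have h5 := f.injective heq
      rw [h5] at h3
      rw [f.symm_apply_eq.2 h5.symm] at h4
      exact h.ne z ⟨h3, h4⟩ h5
  have hunif : ∃ r > 0, ∀ z ∈ K, P (f z) r := by
    refine hKc.induction_on (p := fun S => ∃ r > 0, ∀ z ∈ S, P (f z) r) ⟨1, one_pos, by simp⟩
      (fun s t hst ⟨r, hr, h'⟩ => ⟨r, hr, fun z hz => h' z (hst hz)⟩)
      (fun s t ⟨r, hr, h'⟩ ⟨r', hr', h''⟩ => ⟨min r r', lt_min hr hr', ?_⟩) (fun z hz => ?_)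
    · rintro z (hz | hz)
      · exact hmono _ _ _ (min_le_left _ _) (h' z hz)
      · exact hmono _ _ _ (min_le_right _ _) (h'' z hz)
    · obtain ⟨r, hr, hP⟩ := hPloc (f z) (hfK z hz.2).1 (hfK z hz.2).2
      have hnh : {w | dist (f w) (f z) < r / 2} ∈ 𝓝 z :=
        f.continuous.continuousAt.preimage_mem_nhds (ball_mem_nhds _ (half_pos hr))
      refine ⟨_, mem_nhdsWithin_of_mem_nhds hnh, r / 2, half_pos hr, fun w hw => ?_⟩
      have hsub : ball (f w) (r / 2) ⊆ ball (f z) r :=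
        ball_subset_ball' (by have : dist (f w) (f z) < r / 2 := hw; linarith)
      exact ⟨hsub.trans hP.1, fun x hx hfx => hP.2 x (hsub hx) (hsub hfx)⟩
  obtain ⟨r, hr, hP⟩ := hunif
  have hPall : ∀ z ∈ A ∩ E, P (f z) r := by
    intro z hz
    obtain ⟨n, hn⟩ := exists_int_translate_mem z
    have hzn : z + n ∈ K := by
      refine ⟨⟨hn, ?_⟩, subset_closure ((add_int_mem_iff h.trap.per z n).2 hz.1),
        subset_closure ((add_int_mem_iff h.cotrap.per z n).2 hz.2)⟩
      have h1 := not_lt.1 fun hlt => h.trap.top z hlt (subset_closure hz.1)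
      have h2 := not_lt.1 fun hlt => h.cotrap.bot z hlt (subset_closure hz.2)
      simpa using ⟨by linarith, h1⟩
    have := hPper _ _ (hP _ hzn) (-n)
    rw [map_add_int hf.comm] at this
    push_cast at this
    rwa [add_neg_cancel_right] at this
  refine ⟨r / 2, half_pos hr, fun n z hn hz hchain hmem => ?_⟩
  have hz0 := hmem 0 (by omega)
  have hΩc : IsConnected Ω := by
    refine ⟨⟨z 0, mem_iUnion.2 ⟨0, hz0⟩⟩, ?_⟩
    refine isPreconnected_iUnion ⟨z 0, mem_iInter.2 fun n => trapPiece_mono h (Nat.zero_le n) hz0⟩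
      fun n => h.isPreconnected_piece hf n
  refine IsBrouwerOn.no_closed_chain hΩo hΩc (h.isBrouwerOn hf hz0) hn z hz hchain ?_ ?_
  · intro i hi
    rw [mul_div_cancel₀ _ two_ne_zero]
    exact (hPall _ (hmem i hi)).1
  · intro i hi
    rw [mul_div_cancel₀ _ two_ne_zero]
    exact (hPall _ (hmem i hi)).2

section

open ComplexConjugate

/-- The rank-one projection `(1 + a·σ)/2` associated with a point of the sphere. -/
def blochMat (a : S2) : Matrix (Fin 2) (Fin 2) ℂ :=
  !![(1 + ((a.1 2 : ℝ) : ℂ)) / 2, (((a.1 0 : ℝ) : ℂ) - ((a.1 1 : ℝ) : ℂ) * Complex.I) / 2;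
     (((a.1 0 : ℝ) : ℂ) + ((a.1 1 : ℝ) : ℂ) * Complex.I) / 2, (1 - ((a.1 2 : ℝ) : ℂ)) / 2]

/-- A four-point invariant on the sphere, which vanishes only if `w` or `x` is one of `p`, `m`. -/
def bargmann (w x p m : S2) : ℂ :=
  (blochMat w * (blochMat p).adjugate * blochMat x * (blochMat m).adjugate).trace

/-- The vector `(u, v)` represents the line onto which `blochMat a` projects. -/
def IsSpinor (a : S2) (u v : ℂ) : Prop :=
  blochMat a = !![u * conj u, u * conj v; v * conj u, v * conj v]

theorem sq_sum_coord (a : S2) : a.1 0 ^ 2 + a.1 1 ^ 2 + a.1 2 ^ 2 = 1 := by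
  have h := mem_sphere_zero_iff_norm.1 a.2
  rw [EuclideanSpace.norm_eq, Real.sqrt_eq_one, Fin.sum_univ_three] at h
  simpa only [Real.norm_eq_abs, sq_abs] using h

theorem exists_isSpinor (a : S2) : ∃ u v : ℂ, IsSpinor a u v := by
  have ha := sq_sum_coord a
  set x := a.1 0 with hx
  set y := a.1 1 with hy
  set z := a.1 2 with hz
  have hz1 : 0 ≤ 1 + z := by nlinarith [sq_nonneg x, sq_nonneg y]
  by_cases h0 : 1 + z = 0
  · refine ⟨0, 1, ?_⟩
    have hz' : z = -1 := by linarith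
    have hx0 : x = 0 := by nlinarith [sq_nonneg x, sq_nonneg y]
    have hy0 : y = 0 := by nlinarith [sq_nonneg x, sq_nonneg y]
    simp [IsSpinor, blochMat, ← hx, ← hy, ← hz, hx0, hy0, hz']
  · have hpos : 0 < (1 + z) / 2 := by
      have := lt_of_le_of_ne hz1 (Ne.symm h0); linarith
    set s := √((1 + z) / 2) with hs
    have hs0 : s ≠ 0 := (Real.sqrt_pos.2 hpos).ne'
    have hss : s * s = (1 + z) / 2 := Real.mul_self_sqrt hpos.le
    have hsc : (s : ℂ) ≠ 0 := by exact_mod_cast hs0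
    have hssc : (s : ℂ) * s = (1 + z) / 2 := by exact_mod_cast hss
    have hac : (x : ℂ) ^ 2 + (y : ℂ) ^ 2 + (z : ℂ) ^ 2 = 1 := by
      have := congrArg (fun r : ℝ => (r : ℂ)) ha
      push_cast at this
      exact this
    refine ⟨s, (x + y * Complex.I) / (2 * s), ?_⟩
    simp only [IsSpinor, blochMat, ← hx, ← hy, ← hz, map_div₀, map_add, map_mul,
      Complex.conj_ofReal, Complex.conj_I, Complex.conj_ofNat]
    congr 1
    ext i j
    fin_cases i <;> fin_cases j
    · simp [hssc]
    · simp; field_simp; ring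
    · simp; field_simp
    · have : (1 - (z : ℂ)) * (1 + z) = (x + y * Complex.I) * (x - y * Complex.I) := by
        linear_combination -hac + y ^ 2 * Complex.I_sq
      simp
      rw [div_mul_div_comm, ← sub_eq_add_neg, ← this,
        eq_div_iff (mul_ne_zero (mul_ne_zero two_ne_zero hsc) (mul_ne_zero two_ne_zero hsc))]
      linear_combination 2 * (1 - (z : ℂ)) * hssc

theorem bargmann_eq {w x p m : S2} {wu wv xu xv pu pv mu mv : ℂ} (hw : IsSpinor w wu wv)
    (hx : IsSpinor x xu xv) (hp : IsSpinor p pu pv) (hm : IsSpinor m mu mv) :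
    bargmann w x p m = conj (pu * wv - pv * wu) * (pu * xv - pv * xu) *
      (conj (mu * xv - mv * xu) * (mu * wv - mv * wu)) := by
  rw [bargmann, hw, hx, hp, hm]
  simp only [Matrix.adjugate_fin_two_of, Matrix.mul_fin_two, Matrix.trace_fin_two_of, map_sub,
    map_mul]
  ring

theorem IsSpinor.det_ne_zero {p w : S2} {pu pv wu wv : ℂ} (hp : IsSpinor p pu pv)
    (hw : IsSpinor w wu wv) (hne : p ≠ w) : pu * wv - pv * wu ≠ 0 := by
  intro h0
  have e (i j) := congrFun (congrFun hp i) j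
  have e' (i j) := congrFun (congrFun hw i) j
  have p00 := e 0 0
  have p01 := e 0 1
  have p10 := e 1 0
  have p11 := e 1 1
  have w00 := e' 0 0
  have w01 := e' 0 1
  have w10 := e' 1 0
  have w11 := e' 1 1
  simp [blochMat] at p00 p01 p10 p11 w00 w01 w10 w11
  have key : (pu * wv - pv * wu) * conj (pu * wv - pv * wu) =
      (1 - ((p.1 0 * w.1 0 + p.1 1 * w.1 1 + p.1 2 * w.1 2 : ℝ) : ℂ)) / 2 := by
    have : (pu * wv - pv * wu) * conj (pu * wv - pv * wu) =
      (pu * conj pu) * (wv * conj wv) - (pu * conj pv) * (wv * conj wu)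
        - (pv * conj pu) * (wu * conj wv) + (pv * conj pv) * (wu * conj wu) := by
      simp only [map_sub, map_mul]; ring
    rw [this, ← p00, ← p01, ← p10, ← p11, ← w00, ← w01, ← w10, ← w11]
    push_cast
    linear_combination (-(1 / 2 : ℂ)) * p.1 1 * w.1 1 * (-Complex.I_sq)
  rw [h0, zero_mul] at key
  have h1 : (1 : ℝ) - (p.1 0 * w.1 0 + p.1 1 * w.1 1 + p.1 2 * w.1 2) = 0 := by
    have := key.symm
    rw [div_eq_zero_iff] at this
    exact Complex.ofReal_eq_zero.1 (by
      rw [Complex.ofReal_sub, Complex.ofReal_one]; exact this.resolve_right two_ne_zero)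
  have hp1 := sq_sum_coord p
  have hw1 := sq_sum_coord w
  have hsum : (p.1 0 - w.1 0) ^ 2 + (p.1 1 - w.1 1) ^ 2 + (p.1 2 - w.1 2) ^ 2 = 0 := by nlinarith
  apply hne
  ext i
  fin_cases i
  · change p.1 0 = w.1 0
    nlinarith [sq_nonneg (p.1 0 - w.1 0), sq_nonneg (p.1 1 - w.1 1), sq_nonneg (p.1 2 - w.1 2)]
  · change p.1 1 = w.1 1
    nlinarith [sq_nonneg (p.1 0 - w.1 0), sq_nonneg (p.1 1 - w.1 1), sq_nonneg (p.1 2 - w.1 2)]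
  · change p.1 2 = w.1 2
    nlinarith [sq_nonneg (p.1 0 - w.1 0), sq_nonneg (p.1 1 - w.1 1), sq_nonneg (p.1 2 - w.1 2)]

theorem bargmann_ne_zero {w x p m : S2} (hwp : w ≠ p) (hwm : w ≠ m) (hxp : x ≠ p) (hxm : x ≠ m) :
    bargmann w x p m ≠ 0 := by
  obtain ⟨wu, wv, hw⟩ := exists_isSpinor w
  obtain ⟨xu, xv, hx⟩ := exists_isSpinor x
  obtain ⟨pu, pv, hp⟩ := exists_isSpinor p
  obtain ⟨mu, mv, hm⟩ := exists_isSpinor m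
  rw [bargmann_eq hw hx hp hm]
  exact mul_ne_zero (mul_ne_zero ((map_ne_zero _).2 (hp.det_ne_zero hw hwp.symm))
    (hp.det_ne_zero hx hxp.symm)) (mul_ne_zero ((map_ne_zero _).2 (hm.det_ne_zero hx hxm.symm))
    (hm.det_ne_zero hw hwm.symm))

theorem exists_bargmann_change (x y p m : S2) (hxp : x ≠ p) (hxm : x ≠ m) (hyp : y ≠ p)
    (hym : y ≠ m) : ∃ c : ℂ, c ≠ 0 ∧ ∀ w, bargmann w y p m = c * bargmann w x p m := by
  obtain ⟨xu, xv, hx⟩ := exists_isSpinor x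
  obtain ⟨yu, yv, hy⟩ := exists_isSpinor y
  obtain ⟨pu, pv, hp⟩ := exists_isSpinor p
  obtain ⟨mu, mv, hm⟩ := exists_isSpinor m
  have h1 := hp.det_ne_zero hx hxp.symm
  have h2 : conj (mu * xv - mv * xu) ≠ 0 := (map_ne_zero _).2 (hm.det_ne_zero hx hxm.symm)
  have h3 := hp.det_ne_zero hy hyp.symm
  have h4 : conj (mu * yv - mv * yu) ≠ 0 := (map_ne_zero _).2 (hm.det_ne_zero hy hym.symm)
  refine ⟨(pu * yv - pv * yu) * conj (mu * yv - mv * yu) /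
    ((pu * xv - pv * xu) * conj (mu * xv - mv * xu)),
    div_ne_zero (mul_ne_zero h3 h4) (mul_ne_zero h1 h2), fun w => ?_⟩
  obtain ⟨wu, wv, hw⟩ := exists_isSpinor w
  rw [bargmann_eq hw hx hp hm, bargmann_eq hw hy hp hm, div_mul_eq_mul_div, eq_div_iff
    (mul_ne_zero h1 h2)]
  ring

theorem continuous_blochMat : Continuous blochMat := by
  have h (i : Fin 3) : Continuous fun a : S2 => a.1 i := by fun_prop
  refine continuous_matrix fun i j => ?_
  have h0 := Complex.continuous_ofReal.comp (h 0)
  have h1 := Complex.continuous_ofReal.comp (h 1)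
  have h2 := Complex.continuous_ofReal.comp (h 2)
  fin_cases i <;> fin_cases j
  · exact (continuous_const.add h2).div_const _
  · exact (h0.sub (h1.mul continuous_const)).div_const _
  · exact (h0.add (h1.mul continuous_const)).div_const _
  · exact (continuous_const.sub h2).div_const _

theorem Continuous.bargmann {X : Type*} [TopologicalSpace X] {w x p m : X → S2}
    (hw : Continuous w) (hx : Continuous x) (hp : Continuous p) (hm : Continuous m) :
    Continuous fun t => _root_.bargmann (w t) (x t) (p t) (m t) := by
  have a := continuous_blochMat
  exact ((((a.comp hw).matrix_mul (a.comp hp).matrix_adjugate).matrix_mul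
    (a.comp hx)).matrix_mul (a.comp hm).matrix_adjugate).matrix_trace

/-- Nonzero spinors represent points of the sphere, continuously. -/
theorem exists_point_of_spinor {X : Type*} [TopologicalSpace X] {u v : X → ℂ} (hu : Continuous u) (hv : Continuous v)
    (hne : ∀ t, u t ≠ 0 ∨ v t ≠ 0) : ∃ a : X → S2, Continuous a ∧ ∃ N : X → ℝ, Continuous N ∧
      (∀ t, 0 < N t) ∧ ∀ t, IsSpinor (a t) (N t * u t) (N t * v t) := by
  have hpos : ∀ t, 0 < Complex.normSq (u t) + Complex.normSq (v t) := fun t => by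
    rcases hne t with h | h
    · exact add_pos_of_pos_of_nonneg (Complex.normSq_pos.2 h) (Complex.normSq_nonneg _)
    · exact add_pos_of_nonneg_of_pos (Complex.normSq_nonneg _) (Complex.normSq_pos.2 h)
  set S : X → ℝ := fun t => Complex.normSq (u t) + Complex.normSq (v t) with hS
  have hSc : Continuous S := (Complex.continuous_normSq.comp hu).add
    (Complex.continuous_normSq.comp hv)
  let b : X → EuclideanSpace ℝ (Fin 3) := fun t =>
    !₂[2 * (v t * conj (u t)).re / S t, 2 * (v t * conj (u t)).im / S t,
      (Complex.normSq (u t) - Complex.normSq (v t)) / S t]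
  have hb : ∀ t, b t ∈ sphere (0 : EuclideanSpace ℝ (Fin 3)) 1 := fun t => by
    rw [mem_sphere_zero_iff_norm, EuclideanSpace.norm_eq, Real.sqrt_eq_one, Fin.sum_univ_three]
    simp only [Real.norm_eq_abs, sq_abs, b]
    have := (hpos t).ne'
    simp
    have hS' : S t ≠ 0 := this
    field_simp
    simp only [hS, Complex.normSq_apply]
    ring
  refine ⟨fun t => ⟨b t, hb t⟩, ?_, fun t => 1 / √(S t), ?_, fun t => ?_, fun t => ?_⟩
  · refine Continuous.subtype_mk ?_ _
    have hm : Continuous fun t => v t * conj (u t) := hv.mul (Complex.continuous_conj.comp hu)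
    refine (PiLp.continuous_toLp 2 _).comp (continuous_pi fun i => ?_)
    fin_cases i
    · exact (continuous_const.mul (Complex.continuous_re.comp hm)).div hSc fun t => (hpos t).ne'
    · exact (continuous_const.mul (Complex.continuous_im.comp hm)).div hSc fun t => (hpos t).ne'
    · exact ((Complex.continuous_normSq.comp hu).sub (Complex.continuous_normSq.comp hv)).div hSc
        fun t => (hpos t).ne'
  · exact continuous_const.div (Real.continuous_sqrt.comp hSc) fun t =>
      (Real.sqrt_pos.2 (hpos t)).ne'
  · exact div_pos one_pos (Real.sqrt_pos.2 (hpos t))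
  · have hsq : ((√(S t) : ℝ) : ℂ) * (√(S t) : ℝ) = S t := by
      exact_mod_cast Real.mul_self_sqrt (hpos t).le
    have hne : ((√(S t) : ℝ) : ℂ) ≠ 0 := by exact_mod_cast (Real.sqrt_pos.2 (hpos t)).ne'
    have hSne : (S t : ℂ) ≠ 0 := by exact_mod_cast (hpos t).ne'
    have hSe : (S t : ℂ) = u t * conj (u t) + v t * conj (v t) := by
      rw [Complex.mul_conj, Complex.mul_conj]; exact_mod_cast rfl
    have hre : ∀ z w : ℂ, (((1 / √(S t) : ℝ) : ℂ) * z) * conj (((1 / √(S t) : ℝ) : ℂ) * w) =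
        z * conj w / S t := fun z w => by
      rw [map_mul, Complex.conj_ofReal]
      push_cast
      field_simp
      rw [mul_comm, mul_comm (S t : ℂ), ← hsq]; ring
    rw [IsSpinor, hre, hre, hre, hre, blochMat]
    have hnu : ∀ z : ℂ, ((Complex.normSq z : ℝ) : ℂ) = z * conj z := fun z =>
      (Complex.mul_conj z).symm
    have hri : (((v t * conj (u t)).re : ℝ) : ℂ) + ((v t * conj (u t)).im : ℝ) * Complex.I =
      v t * conj (u t) := Complex.re_add_im _
    have hri' : (((v t * conj (u t)).re : ℝ) : ℂ) - ((v t * conj (u t)).im : ℝ) * Complex.I =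
      u t * conj (v t) := by
      have := congrArg conj hri
      simp only [map_add, map_mul, Complex.conj_ofReal, Complex.conj_I, Complex.conj_conj] at this
      linear_combination this
    have b0 : (b t) 0 = 2 * (v t * conj (u t)).re / S t := rfl
    have b1 : (b t) 1 = 2 * (v t * conj (u t)).im / S t := rfl
    have b2 : (b t) 2 = (Complex.normSq (u t) - Complex.normSq (v t)) / S t := rfl
    simp only [b0, b1, b2]
    push_cast
    rw [hnu, hnu]
    generalize (((v t * conj (u t)).re : ℝ) : ℂ) = r at hri hri' ⊢
    generalize (((v t * conj (u t)).im : ℝ) : ℂ) = s at hri hri' ⊢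
    congr 1
    ext i j
    fin_cases i <;> fin_cases j
    · simp; field_simp; rw [hSe]; ring
    · simp; field_simp; linear_combination hri'
    · simp; field_simp; linear_combination hri
    · simp; field_simp; rw [hSe]; ring

end

section

open ComplexConjugate

theorem isOpenQuotientMap_annP : IsOpenQuotientMap annP :=
  (QuotientAddGroup.isOpenQuotientMap_mk (G := ℝ) (N := AddSubgroup.zmultiples (1 : ℝ))).prodMap
    IsOpenQuotientMap.id

theorem annP_eq_iff {z w : ℝ × ℝ} : annP z = annP w ↔ ∃ n : ℤ, w = (z.1 + n, z.2) := by
  have h : ((z.1 : Circle1) = (w.1 : Circle1)) ↔ ∃ n : ℤ, w.1 = z.1 + n := by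
    rw [eq_comm, ← sub_eq_zero, ← AddCircle.coe_sub, AddCircle.coe_eq_zero_iff]
    refine exists_congr fun n => ?_
    rw [zsmul_one]
    constructor <;> intro h <;> linarith
  simp only [annP, Prod.ext_iff, h]
  constructor
  · rintro ⟨⟨n, hn⟩, h2⟩
    exact ⟨n, hn, h2.symm⟩
  · rintro ⟨n, hn, h2⟩
    exact ⟨⟨n, hn⟩, h2.symm⟩

theorem IsSpinor.det_eq_zero {p : S2} {pu pv wu wv : ℂ} (hp : IsSpinor p pu pv)
    (hw : IsSpinor p wu wv) : pu * wv - pv * wu = 0 := by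
  have h := hp.symm.trans hw
  have e (i j) := congrFun (congrFun h i) j
  have e00 := e 0 0
  have e01 := e 0 1
  have e10 := e 1 0
  have e11 := e 1 1
  simp at e00 e01 e10 e11
  have : (pu * wv - pv * wu) * conj (pu * wv - pv * wu) =
    (pu * conj pu) * (wv * conj wv) - (pu * conj pv) * (wv * conj wu)
      - (pv * conj pu) * (wu * conj wv) + (pv * conj pv) * (wu * conj wu) := by
    simp only [map_sub, map_mul]; ring
  rw [e00, e01, e10, e11] at this
  have h0 : (pu * wv - pv * wu) * conj (pu * wv - pv * wu) = 0 := by rw [this]; ring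
  rcases mul_eq_zero.1 h0 with h | h
  · exact h
  · exact (map_eq_zero _).1 h

theorem no_log_bargmann {x p m : S2} (hpm : p ≠ m)
    (l : ({p, m}ᶜ : Set S2) → ℂ) (hl : Continuous l)
    (hexp : ∀ w, Complex.exp (l w) = bargmann w x p m) : False := by
  obtain ⟨xu, xv, hx⟩ := exists_isSpinor x
  obtain ⟨pu, pv, hp⟩ := exists_isSpinor p
  obtain ⟨mu, mv, hm⟩ := exists_isSpinor m
  have hD := hp.det_ne_zero hm hpm
  obtain ⟨c, hc, N, hN, hNpos, hcs⟩ := exists_point_of_spinor (X := ℂ)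
    (u := fun ζ => pu + ζ * mu) (v := fun ζ => pv + ζ * mv) (by fun_prop) (by fun_prop)
    (fun ζ => by
      by_contra hcon
      push Not at hcon
      exact hD (by linear_combination mv * hcon.1 - mu * hcon.2))
  have hNne : ∀ ζ, (N ζ : ℂ) ≠ 0 := fun ζ => by exact_mod_cast (hNpos ζ).ne'
  have hcm : ∀ ζ, c ζ ≠ m := fun ζ h => by
    have := hcs ζ
    rw [h] at this
    have := hm.det_eq_zero this
    exact mul_ne_zero (hNne ζ) hD (by linear_combination -this)
  have hcp : ∀ ζ, ζ ≠ 0 → c ζ ≠ p := fun ζ h0 h => by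
    have := hcs ζ
    rw [h] at this
    have := hp.det_eq_zero this
    exact mul_ne_zero (mul_ne_zero (hNne ζ) h0) hD (by linear_combination this)
  have hE : ∀ t : ℝ, Complex.exp (t * Complex.I) ≠ 0 := fun t => Complex.exp_ne_zero _
  let γ : ℝ → ({p, m}ᶜ : Set S2) := fun t => ⟨c (Complex.exp (t * Complex.I)), by
    simp only [mem_compl_iff, mem_insert_iff, mem_singleton_iff, not_or]
    exact ⟨hcp _ (hE t), hcm _⟩⟩
  have hEc : Continuous fun t : ℝ => Complex.exp (t * Complex.I) := by fun_prop
  have hγ : Continuous γ := (hc.comp hEc).subtype_mk _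
  set K : ℂ := conj (pu * mv - pv * mu) * (pu * xv - pv * xu) *
    (conj (mu * xv - mv * xu) * (mu * pv - mv * pu)) with hK
  have hval : ∀ t : ℝ, bargmann (γ t) x p m =
      K * (N (Complex.exp (t * Complex.I)) ^ 2 : ℝ) * Complex.exp (-(t * Complex.I)) := fun t => by
    have h1 : conj (Complex.exp (t * Complex.I)) = Complex.exp (-(t * Complex.I)) := by
      rw [← Complex.exp_conj]; simp
    rw [bargmann_eq (hcs _) hx hp hm, ← h1, hK]
    simp only [map_sub, map_mul, map_add, Complex.conj_ofReal]
    push_cast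
    ring
  let d : ℝ → ℂ := fun t => l (γ t) + t * Complex.I -
    (Real.log (N (Complex.exp (t * Complex.I)) ^ 2) : ℝ)
  have hd : Continuous d := by
    refine ((hl.comp hγ).add (by fun_prop)).sub (Complex.continuous_ofReal.comp ?_)
    exact Continuous.log ((hN.comp hEc).pow 2) fun t => (pow_pos (hNpos _) 2).ne'
  have hdexp : ∀ t, Complex.exp (d t) = K := fun t => by
    have hpos := pow_pos (hNpos (Complex.exp (t * Complex.I))) 2
    have hne : ((N (Complex.exp (t * Complex.I)) ^ 2 : ℝ) : ℂ) ≠ 0 := by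
      exact_mod_cast hpos.ne'
    change Complex.exp (l (γ t) + t * Complex.I - _) = K
    rw [Complex.exp_sub, Complex.exp_add, hexp, hval, ← Complex.ofReal_exp, Real.exp_log hpos,
      mul_assoc, ← Complex.exp_add, neg_add_cancel, Complex.exp_zero, mul_one,
      mul_div_assoc, div_self hne, mul_one]
  have hKne : K ≠ 0 := hdexp 0 ▸ Complex.exp_ne_zero _
  have h1 := eqOn_of_exp_eq_one (S := (univ : Set ℝ)) isPreconnected_univ
    (d := fun t => d t - d 0) (hd.sub continuous_const).continuousOn
    (fun t _ => by rw [Complex.exp_sub, hdexp, hdexp, div_self hKne])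
    (mem_univ (2 * Real.pi)) (mem_univ 0)
  have hE1 : Complex.exp (((2 * Real.pi : ℝ) : ℂ) * Complex.I) = Complex.exp ((0 : ℝ) * Complex.I) := by
    push_cast
    rw [Complex.exp_two_pi_mul_I]; simp
  have hγe : γ (2 * Real.pi) = γ 0 := Subtype.ext (by
    change c _ = c _
    rw [hE1])
  have h2 : d (2 * Real.pi) - d 0 = ((2 * Real.pi : ℝ) : ℂ) * Complex.I := by
    simp only [d]
    rw [hE1, hγe]
    push_cast
    ring
  have h3 : ((2 * Real.pi : ℝ) : ℂ) * Complex.I = 0 := by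
    rw [← h2]
    simpa using h1
  simp [Real.pi_ne_zero] at h3

theorem lift_add_one {h : S2 ≃ₜ S2} (hiso : IsotopicToId h) {p m : S2} (hpm : p ≠ m)
    (hp : h p = p) (hm : h m = m) {hA : Ann → Ann} (e : Ann ≃ₜ ({p, m}ᶜ : Set S2))
    (he : ∀ z, (e (hA z) : S2) = h (e z)) {ht : ℝ × ℝ → ℝ × ℝ} (hl : IsAnnulusLift hA ht)
    (z : ℝ × ℝ) : ht (z.1 + 1, z.2) = ((ht z).1 + 1, (ht z).2) := by
  obtain ⟨F, hF, hF0, hF1⟩ := hiso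
  have hne : ∀ w : Ann, (e w : S2) ≠ p ∧ (e w : S2) ≠ m := fun w => by
    have := (e w).2
    simpa only [mem_compl_iff, mem_insert_iff, mem_singleton_iff, not_or] using this
  set T : ℝ × ℝ → ℝ × ℝ := fun z => (z.1 + 1, z.2) with hT
  have hTc : Continuous T := by fun_prop
  have hannT : ∀ z, annP (T z) = annP z := fun z => (annP_eq_iff.2 ⟨1, by simp [hT]⟩).symm
  set x : S2 := (e (annP 0)).1 with hx
  have hannc : Continuous annP := isOpenQuotientMap_annP.continuous
  have hec : Continuous fun z : ℝ × ℝ => (e (annP z) : S2) :=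
    continuous_subtype_val.comp (e.continuous.comp hannc)
  let G : ℝ × (ℝ × ℝ) → ℂ := fun y => bargmann (F y.1 (e (annP y.2))) (F y.1 x) (F y.1 p) (F y.1 m)
  have hFc : ∀ a : S2, Continuous fun y : ℝ × (ℝ × ℝ) => F y.1 a := fun a =>
    hF.comp (continuous_fst.prodMk continuous_const)
  have hGc : Continuous G :=
    Continuous.bargmann (hF.comp (continuous_fst.prodMk (hec.comp continuous_snd)))
      (hFc _) (hFc _) (hFc _)
  have hG0 : ∀ y, G y ≠ 0 := fun y =>
    bargmann_ne_zero ((F y.1).injective.ne (hne _).1) ((F y.1).injective.ne (hne _).2)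
      ((F y.1).injective.ne (hne _).1) ((F y.1).injective.ne (hne _).2)
  obtain ⟨L, hL, hLe⟩ := exists_log_of_ne_zero G hGc hG0
  have hconst : ∀ y y' : ℝ × (ℝ × ℝ), L (y.1, T y.2) - L y = L (y'.1, T y'.2) - L y' := fun y y' =>
    eqOn_of_exp_eq_one (S := (univ : Set (ℝ × (ℝ × ℝ)))) isPreconnected_univ
      (d := fun y => L (y.1, T y.2) - L y)
      ((hL.comp (continuous_fst.prodMk (hTc.comp continuous_snd))).sub hL).continuousOn
      (fun y _ => by
        rw [Complex.exp_sub, hLe, hLe]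
        change bargmann (F y.1 (e (annP (T y.2)))) _ _ _ / _ = 1
        rw [hannT]
        exact div_self (hG0 y)) (mem_univ _) (mem_univ _)
  let ψ : ℝ × ℝ → ℂ := fun z => L (0, z)
  have hψ : Continuous ψ := hL.comp (by fun_prop)
  set D : ℂ := ψ (T 0) - ψ 0 with hD
  have hψT : ∀ z, ψ (T z) = ψ z + D := fun z => by
    have := hconst (0, z) (0, 0)
    exact sub_eq_iff_eq_add'.1 this
  have hψn : ∀ (n : ℤ) z, ψ (z.1 + n, z.2) = ψ z + n * D := fun n => by
    induction n using Int.induction_on with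
    | zero => intro z; simp
    | succ n ih =>
      intro z
      have := hψT (z.1 + (n : ℤ), z.2)
      rw [ih] at this
      simp only [hT] at this
      push_cast at this ⊢
      rw [← add_assoc, this]; ring
    | pred n ih =>
      intro z
      have := hψT (z.1 + ((-(n : ℤ) - 1 : ℤ) : ℝ), z.2)
      have h2 := ih z
      simp only [hT] at this
      push_cast at this h2 ⊢
      rw [show z.1 + (-(n : ℝ) - 1) + 1 = z.1 + -(n : ℝ) by ring, h2] at this
      linear_combination -this
  have hψe : ∀ z, Complex.exp (ψ z) = bargmann (e (annP z)) x p m := fun z => by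
    rw [hLe]
    change bargmann (F 0 _) (F 0 _) (F 0 _) (F 0 _) = _
    rw [hF0]; rfl
  have hD0 : D ≠ 0 := fun h0 => by
    have hfac : ∀ z w, annP z = annP w → ψ z = ψ w := fun z w hzw => by
      obtain ⟨n, rfl⟩ := annP_eq_iff.1 hzw
      rw [hψn, h0, mul_zero, add_zero]
    let l : Ann → ℂ := fun a => ψ (Function.surjInv isOpenQuotientMap_annP.surjective a)
    have hl' : ∀ z, l (annP z) = ψ z := fun z =>
      hfac _ _ (Function.surjInv_eq isOpenQuotientMap_annP.surjective _)
    have hlc : Continuous l := by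
      rw [isOpenQuotientMap_annP.isQuotientMap.continuous_iff]
      exact hψ.congr fun z => (hl' z).symm
    refine no_log_bargmann hpm (x := x) (fun w => l (e.symm w))
      (hlc.comp e.symm.continuous) fun w => ?_
    obtain ⟨z, hz⟩ := isOpenQuotientMap_annP.surjective (e.symm w)
    rw [← hz, hl', hψe, hz, e.apply_symm_apply]
  obtain ⟨hlc, hle⟩ := hl
  obtain ⟨d, hd⟩ : ∃ d : ℤ, ht (T z) = ((ht z).1 + d, (ht z).2) :=
    annP_eq_iff.1 (by rw [hle, hle, hannT])
  have hdz : ∀ w : ℝ × ℝ, ∃ n : ℤ, ht (T w) = ((ht w).1 + n, (ht w).2) := fun w =>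
    annP_eq_iff.1 (by rw [hle, hle, hannT])
  obtain ⟨c, hc, hcb⟩ := exists_bargmann_change x (h x) p m (hne _).1 (hne _).2
    (fun h' => (hne (annP 0)).1 (h.injective (h'.trans hp.symm)))
    (fun h' => (hne (annP 0)).2 (h.injective (h'.trans hm.symm)))
  have hL1 : ∀ w, Complex.exp (L (1, w)) = c * Complex.exp (ψ (ht w)) := fun w => by
    rw [hLe, hψe, ← hcb, hle, he]
    change bargmann (F 1 _) (F 1 _) (F 1 _) (F 1 _) = _
    rw [hF1, hp, hm]
  have hdiff : L (1, T z) - ψ (ht (T z)) = L (1, z) - ψ (ht z) := by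
    have h1 := eqOn_of_exp_eq_one (S := (univ : Set (ℝ × ℝ))) isPreconnected_univ
      (d := fun w => (L (1, w) - ψ (ht w)) - (L (1, z) - ψ (ht z)))
      (((hL.comp (by fun_prop)).sub (hψ.comp hlc)).sub continuous_const).continuousOn
      (fun w _ => by
        rw [Complex.exp_sub, Complex.exp_sub, Complex.exp_sub, hL1, hL1,
          mul_div_cancel_right₀ _ (Complex.exp_ne_zero _),
          mul_div_cancel_right₀ _ (Complex.exp_ne_zero _), div_self hc])
      (mem_univ (T z)) (mem_univ z)
    have h2 : (L (1, T z) - ψ (ht (T z))) - (L (1, z) - ψ (ht z)) =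
      (L (1, z) - ψ (ht z)) - (L (1, z) - ψ (ht z)) := h1
    rw [sub_self] at h2
    exact sub_eq_zero.1 h2
  have h1 : L (1, T z) - L (1, z) = D := hconst (1, z) (0, 0)
  rw [hd, hψn] at hdiff
  have h2 : D = d * D := by linear_combination hdiff - h1
  have h3 : (d : ℂ) = 1 := by
    have := mul_right_cancel₀ hD0 ((one_mul D).trans h2)
    exact this.symm
  have h4 : d = 1 := by exact_mod_cast h3
  rw [h4] at hd
  simpa [hT] using hd

end

/-- `P` is a universal covering of the sphere minus the two points `p` and `m`, with deck
transformation `z ↦ z + 1`, such that `p` lies at the upper end and `m` at the lower end. -/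
structure IsAnnCover (P : ℂ → S2) (p m : S2) : Prop where
  cont : Continuous P
  isOpenMap : IsOpenMap P
  eq_iff : ∀ z w, P z = P w ↔ ∃ n : ℤ, w = z + n
  ne : p ≠ m
  ne_top : ∀ z, P z ≠ p
  ne_bot : ∀ z, P z ≠ m
  surj : ∀ a, a ≠ p → a ≠ m → ∃ z, P z = a
  top : ∀ U, IsOpen U → p ∈ U → ∃ M, ∀ z : ℂ, M ≤ z.im → P z ∈ U
  bot : ∀ U, IsOpen U → m ∈ U → ∃ M, ∀ z : ℂ, z.im ≤ M → P z ∈ U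

theorem IsAnnCover.add_int {P : ℂ → S2} {p m : S2} (h : IsAnnCover P p m) (z : ℂ) (n : ℤ) :
    P (z + n) = P z := ((h.eq_iff _ _).2 ⟨n, rfl⟩).symm

theorem IsAnnCover.neg {P : ℂ → S2} {p m : S2} (h : IsAnnCover P p m) :
    IsAnnCover (fun z => P (-z)) m p where
  cont := h.cont.comp continuous_neg
  isOpenMap := h.isOpenMap.comp (Homeomorph.neg ℂ).isOpenMap
  eq_iff z w := by
    rw [h.eq_iff]
    constructor
    · rintro ⟨n, hn⟩
      exact ⟨-n, by push_cast; linear_combination -hn⟩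
    · rintro ⟨n, hn⟩
      exact ⟨-n, by push_cast; linear_combination -hn⟩
  ne := h.ne.symm
  ne_top z := h.ne_bot _
  ne_bot z := h.ne_top _
  surj a ha hb := by
    obtain ⟨z, hz⟩ := h.surj a hb ha
    exact ⟨-z, by rw [neg_neg, hz]⟩
  top U hU hm := by
    obtain ⟨M, hM⟩ := h.bot U hU hm
    exact ⟨-M, fun z hz => hM _ (by rw [Complex.neg_im]; linarith)⟩
  bot U hU hm := by
    obtain ⟨M, hM⟩ := h.top U hU hm
    exact ⟨-M, fun z hz => hM _ (by rw [Complex.neg_im]; linarith)⟩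

theorem IsAnnCover.exists_nhds_top {P : ℂ → S2} {p m : S2} (h : IsAnnCover P p m) (C : ℝ) :
    ∃ U, IsOpen U ∧ p ∈ U ∧ ∀ z, P z ∈ U → C < z.im := by
  obtain ⟨Up, Um, hUp, hUm, hp, hm, hd⟩ := t2_separation h.ne
  obtain ⟨M, hM⟩ := h.bot Um hUm hm
  set K : Set S2 := P '' {z : ℂ | z.re ∈ Icc (0 : ℝ) 1 ∧ z.im ∈ Icc M C} with hK
  have hKc : IsClosed K := ((isCompact_strip_fundamental M C).image h.cont).isClosed
  refine ⟨Up ∩ Kᶜ, hUp.inter hKc.isOpen_compl, ⟨hp, ?_⟩, fun z hz => ?_⟩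
  · rintro ⟨z, -, hz⟩
    exact h.ne_top z hz
  · by_contra! hlt
    rcases le_total z.im M with h1 | h1
    · exact disjoint_left.1 hd hz.1 (hM z h1)
    · obtain ⟨n, hn⟩ := exists_int_translate_mem z
      exact hz.2 ⟨z + n, ⟨hn, by simpa using ⟨h1, hlt⟩⟩, h.add_int z n⟩

theorem IsAnnCover.exists_nhds_bot {P : ℂ → S2} {p m : S2} (h : IsAnnCover P p m) (C : ℝ) :
    ∃ U, IsOpen U ∧ m ∈ U ∧ ∀ z, P z ∈ U → z.im < C := by
  obtain ⟨U, hU, hm, hz⟩ := h.neg.exists_nhds_top (-C)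
  refine ⟨U, hU, hm, fun z hzU => ?_⟩
  have := hz (-z) (by rwa [neg_neg])
  rw [Complex.neg_im] at this
  linarith

theorem IsAnnCover.isAnnular {P : ℂ → S2} {p m : S2} (h : IsAnnCover P p m) {g : S2 → S2}
    (hg : Continuous g) (hp : g p = p) (hm : g m = m) {f : ℂ ≃ₜ ℂ} (hf : ∀ z, f (z + 1) = f z + 1)
    (hfg : ∀ z, P (f z) = g (P z)) : IsAnnular f where
  comm := hf
  top C := by
    obtain ⟨U, hU, hpU, hz⟩ := h.exists_nhds_top C
    obtain ⟨M, hM⟩ := h.top (g ⁻¹' U) (hU.preimage hg) (by rwa [mem_preimage, hp])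
    exact ⟨M, fun z hzM => (hz _ (by rw [hfg]; exact hM z hzM)).le⟩
  bot C := by
    obtain ⟨U, hU, hpU, hz⟩ := h.exists_nhds_bot C
    obtain ⟨M, hM⟩ := h.bot (g ⁻¹' U) (hU.preimage hg) (by rwa [mem_preimage, hm])
    exact ⟨M, fun z hzM => (hz _ (by rw [hfg]; exact hM z hzM)).le⟩

theorem isAnnCover_of_homeomorph {p m : S2} (hpm : p ≠ m) (e : Ann ≃ₜ ({p, m}ᶜ : Set S2))
    (htop : Tendsto (fun a : Ann => (e a : S2)) (comap Prod.snd atTop) (𝓝 p))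
    (hbot : Tendsto (fun a : Ann => (e a : S2)) (comap Prod.snd atBot) (𝓝 m)) :
    IsAnnCover (fun z => (e (annP (Complex.equivRealProd z))).1) p m := by
  have hne : ∀ w : Ann, (e w : S2) ≠ p ∧ (e w : S2) ≠ m := fun w => by
    have := (e w).2
    simpa only [mem_compl_iff, mem_insert_iff, mem_singleton_iff, not_or] using this
  have hO : IsOpen ({p, m}ᶜ : Set S2) := ((finite_singleton m).insert p).isClosed.isOpen_compl
  refine ⟨?_, ?_, fun z w => ?_, hpm, fun z => (hne _).1, fun z => (hne _).2, fun a ha hb => ?_,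
    fun U hU hp => ?_, fun U hU hm => ?_⟩
  · exact continuous_subtype_val.comp (e.continuous.comp
      (isOpenQuotientMap_annP.continuous.comp Complex.equivRealProdCLM.continuous))
  · exact hO.isOpenEmbedding_subtypeVal.isOpenMap.comp (e.isOpenMap.comp
      (isOpenQuotientMap_annP.isOpenMap.comp Complex.equivRealProdCLM.toHomeomorph.isOpenMap))
  · rw [← Subtype.ext_iff, e.injective.eq_iff, annP_eq_iff]
    refine exists_congr fun n => ?_
    rw [Complex.ext_iff, Prod.ext_iff]
    simp
  · obtain ⟨z, hz⟩ := isOpenQuotientMap_annP.surjective (e.symm ⟨a, by simp [ha, hb]⟩)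
    exact ⟨Complex.equivRealProd.symm z, by simp [hz]⟩
  · have := htop (hU.mem_nhds hp)
    rw [mem_map, mem_comap] at this
    obtain ⟨s, hs, hsub⟩ := this
    obtain ⟨M, hM⟩ := mem_atTop_sets.1 hs
    exact ⟨M, fun z hz => hsub (show annP (Complex.equivRealProd z) ∈ Prod.snd ⁻¹' s from hM _ hz)⟩
  · have := hbot (hU.mem_nhds hm)
    rw [mem_map, mem_comap] at this
    obtain ⟨s, hs, hsub⟩ := this
    obtain ⟨M, hM⟩ := mem_atBot_sets.1 hs
    exact ⟨M, fun z hz => hsub (show annP (Complex.equivRealProd z) ∈ Prod.snd ⁻¹' s from hM _ hz)⟩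

theorem isLocalHomeomorph_annP : IsLocalHomeomorph annP := by
  refine IsLocalHomeomorph.mk annP fun z => ?_
  obtain ⟨u, hu, hue⟩ := AddCircle.isLocalHomeomorph_coe (1 : ℝ) z.1
  refine ⟨u.prod (OpenPartialHomeomorph.refl ℝ), ⟨hu, mem_univ _⟩, fun w hw => ?_⟩
  exact Prod.ext (congrFun hue w.1) rfl

theorem IsAnnulusLift.exists_homeomorph {hA : Ann ≃ₜ Ann} {ht : ℝ × ℝ → ℝ × ℝ}
    (hl : IsAnnulusLift hA ht) (hT : ∀ z : ℝ × ℝ, ht (z.1 + 1, z.2) = ((ht z).1 + 1, (ht z).2)) :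
    ∃ F : ℂ ≃ₜ ℂ, (∀ z, F (z + 1) = F z + 1) ∧
      ∀ z, Complex.equivRealProd (F z) = ht (Complex.equivRealProd z) := by
  have hTn : ∀ (n : ℤ) (z : ℝ × ℝ), ht (z.1 + n, z.2) = ((ht z).1 + n, (ht z).2) := fun n => by
    induction n using Int.induction_on with
    | zero => intro z; simp
    | succ n ih =>
      intro z
      have h1 := hT (z.1 + (n : ℤ), z.2)
      rw [ih] at h1
      simp only at h1
      push_cast at h1 ⊢
      rw [← add_assoc, h1, ← add_assoc]
    | pred n ih =>
      intro z
      have h1 := hT (z.1 + ((-(n : ℤ) - 1 : ℤ) : ℝ), z.2)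
      have h2 := ih z
      simp only at h1
      push_cast at h1 h2 ⊢
      rw [show z.1 + (-(n : ℝ) - 1) + 1 = z.1 + -(n : ℝ) by ring, h2, Prod.ext_iff] at h1
      obtain ⟨h3, h4⟩ := h1
      refine Prod.ext ?_ h4.symm
      simp only at h3 ⊢
      linarith
  have hbij : Bijective ht := by
    constructor
    · intro z w hzw
      have h1 : annP z = annP w := hA.injective (by rw [← hl.2, ← hl.2, hzw])
      obtain ⟨n, rfl⟩ := annP_eq_iff.1 h1
      rw [hTn, Prod.ext_iff] at hzw
      have : (n : ℝ) = 0 := by have := hzw.1; simp only at this; linarith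
      simp [this]
    · intro y
      obtain ⟨z, hz⟩ := isOpenQuotientMap_annP.surjective (hA.symm (annP y))
      have h1 : annP (ht z) = annP y := by rw [hl.2, hz, hA.apply_symm_apply]
      obtain ⟨n, rfl⟩ := annP_eq_iff.1 h1
      exact ⟨_, hTn n z⟩
  have hloc : IsLocalHomeomorph ht := by
    refine IsLocalHomeomorph.of_comp (g := annP) ?_ isLocalHomeomorph_annP hl.1
    have : annP ∘ ht = hA ∘ annP := funext hl.2
    rw [this]
    exact hA.isLocalHomeomorph.comp isLocalHomeomorph_annP
  let F0 := hloc.toHomeomorphOfBijective hbij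
  let E : ℂ ≃ₜ ℝ × ℝ := Complex.equivRealProdCLM.toHomeomorph
  have hF : ∀ z, Complex.equivRealProd (E.symm (F0 (E z))) = ht (Complex.equivRealProd z) :=
    fun z => E.apply_symm_apply _
  refine ⟨(E.trans F0).trans E.symm, fun z => ?_, hF⟩
  apply Complex.equivRealProd.injective
  change Complex.equivRealProd (E.symm (F0 (E (z + 1)))) =
    Complex.equivRealProd (E.symm (F0 (E z)) + 1)
  have h1 := hF z
  rw [hF]
  have h2 := hT (Complex.equivRealProd z)
  rw [← h1] at h2
  simpa using h2

/-- `ReachIn h δ S n a b`: there is a `δ`-chain of `h` of length `n` from `a` to `b` inside `S`. -/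
inductive ReachIn {X : Type*} [PseudoMetricSpace X] (h : X → X) (δ : ℝ) (S : Set X) :
    ℕ → X → X → Prop
  | refl {a : X} (ha : a ∈ S) : ReachIn h δ S 0 a a
  | step {n : ℕ} {a b c : X} (hab : ReachIn h δ S n a b) (hbc : dist (h b) c < δ) (hc : c ∈ S) :
      ReachIn h δ S (n + 1) a c

namespace ReachIn

variable {X : Type*} [PseudoMetricSpace X] {h : X → X} {δ : ℝ} {S : Set X} {n m : ℕ} {a b c : X}

theorem mem_left (hab : ReachIn h δ S n a b) : a ∈ S := by
  induction hab with
  | refl ha => exact ha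
  | step _ _ _ ih => exact ih

theorem mem_right (hab : ReachIn h δ S n a b) : b ∈ S := by
  cases hab with
  | refl ha => exact ha
  | step _ _ hc => exact hc

theorem trans (hab : ReachIn h δ S n a b) (hbc : ReachIn h δ S m b c) :
    ReachIn h δ S (n + m) a c := by
  induction hbc with
  | refl => exact hab
  | step _ h1 h2 ih => exact (ih hab).step h1 h2

theorem mono (hab : ReachIn h δ S n a b) {δ' : ℝ} (hδ : δ ≤ δ') {S' : Set X} (hS : S ⊆ S') :
    ReachIn h δ' S' n a b := by
  induction hab with
  | refl ha => exact refl (hS ha)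
  | step _ h1 h2 ih => exact ih.step (h1.trans_le hδ) (hS h2)

theorem iterate (hδ : 0 < δ) (n : ℕ) (ha : ∀ i ≤ n, h^[i] a ∈ S) :
    ReachIn h δ S n a (h^[n] a) := by
  induction n with
  | zero => exact refl (ha 0 le_rfl)
  | succ n ih =>
    refine (ih fun i hi => ha i (hi.trans n.le_succ)).step ?_ (ha _ le_rfl)
    rw [iterate_succ_apply', dist_self]
    exact hδ

theorem loop (haa : ReachIn h δ S n a a) (k : ℕ) : ReachIn h δ S (k * n) a a := by
  induction k with
  | zero => rw [zero_mul]; exact refl haa.mem_left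
  | succ k ih => rw [Nat.succ_mul]; exact ih.trans haa

theorem split (m : ℕ) (hab : ReachIn h δ S (n + m) a b) :
    ∃ c, ReachIn h δ S n a c ∧ ReachIn h δ S m c b := by
  induction m generalizing b with
  | zero => exact ⟨b, hab, refl hab.mem_right⟩
  | succ m ih =>
    cases hab with
    | step h0 h1 h2 =>
      obtain ⟨c, hc, hc'⟩ := ih h0
      exact ⟨c, hc, hc'.step h1 h2⟩

theorem exists_fun (hab : ReachIn h δ S n a b) : ∃ z : ℕ → X, z 0 = a ∧ z n = b ∧
    (∀ i ≤ n, z i ∈ S) ∧ ∀ i < n, dist (h (z i)) (z (i + 1)) < δ := by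
  induction hab with
  | @refl a ha => exact ⟨fun _ => a, rfl, rfl, fun _ _ => ha, fun i hi => absurd hi (Nat.not_lt_zero i)⟩
  | @step n a b c _ h1 h2 ih =>
    obtain ⟨z, h3, h4, h5, h6⟩ := ih
    refine ⟨fun i => if i ≤ n then z i else c, by simp [h3], by simp, fun i hi => ?_,
      fun i hi => ?_⟩
    · dsimp only
      split_ifs with hin
      · exact h5 i hin
      · exact h2
    · dsimp only
      rw [if_pos (Nat.lt_succ_iff.1 hi)]
      split_ifs with hin
      · exact h6 i hin
      · have : i = n := by omega
        rw [this, h4]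
        exact h1

theorem of_fun {z : ℕ → X} (hz : ∀ i < n, dist (h (z i)) (z (i + 1)) < δ) :
    ReachIn h δ univ n (z 0) (z n) := by
  induction n with
  | zero => exact refl (mem_univ _)
  | succ n ih =>
    exact (ih fun i hi => hz i (hi.trans n.lt_succ_self)).step (hz n n.lt_succ_self) (mem_univ _)

theorem map {Y : Type*} [PseudoMetricSpace Y] {h' : Y → Y} {S' : Set Y}
    (hab : ReachIn h δ S n a b) (φ : X → Y)
    (hφ : ∀ z y, dist (h z) y < δ → dist (h' (φ z)) (φ y) < δ) (hS : ∀ z ∈ S, φ z ∈ S') :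
    ReachIn h' δ S' n (φ a) (φ b) := by
  induction hab with
  | refl ha => exact refl (hS _ ha)
  | step _ h1 h2 ih => exact ih.step (hφ _ _ h1) (hS _ h2)

theorem restrict (hab : ReachIn h δ S n a b) {A : Set X} (ha : a ∈ A)
    (hA : ∀ z ∈ S, z ∈ A → ∀ y ∈ S, dist (h z) y < δ → y ∈ A) :
    ReachIn h δ (S ∩ A) n a b := by
  induction hab with
  | refl h0 => exact refl ⟨h0, ha⟩
  | step h0 h1 h2 ih =>
    exact (ih ha).step h1 ⟨h2, hA _ h0.mem_right (ih ha).mem_right.2 _ h2 h1⟩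

theorem reverse (hab : ReachIn h δ S n a b) {h' : X → X} {ε : ℝ}
    (hh : ∀ z ∈ S, ∀ y ∈ S, dist (h z) y < δ → dist (h' y) z < ε) :
    ReachIn h' ε S n b a := by
  induction hab with
  | refl h0 => exact refl h0
  | @step n a b c h0 h1 h2 ih =>
    rw [add_comm]
    have : ReachIn h' ε S (0 + 1) c b := (refl h2).step (hh _ h0.mem_right _ h2 h1) h0.mem_right
    exact this.trans ih

theorem exists_dist_iterate_lt (hh : UniformContinuous h) (q : ℕ) :
    ∀ ε > 0, ∃ δ > 0, ∀ a b, ReachIn h δ univ q a b → dist (h^[q] a) b < ε := by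
  induction q with
  | zero =>
    refine fun ε hε => ⟨1, one_pos, fun a b hab => ?_⟩
    cases hab
    simpa using hε
  | succ q ih =>
    intro ε hε
    obtain ⟨η, hη, hη'⟩ := Metric.uniformContinuous_iff.1 hh (ε / 2) (half_pos hε)
    obtain ⟨δ, hδ, hδ'⟩ := ih η hη
    refine ⟨min δ (ε / 2), lt_min hδ (half_pos hε), fun a b hab => ?_⟩
    cases hab with
    | @step _ _ c _ h0 h1 _ =>
      have h2 := hη' (hδ' a c (h0.mono (min_le_left _ _) subset_rfl))
      rw [iterate_succ_apply']
      have h3 := h1.trans_le (min_le_right _ _)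
      have := dist_triangle (h (h^[q] a)) (h c) b
      linarith

theorem iterate_map {q : ℕ} {ε : ℝ}
    (hδ : ∀ a b, ReachIn h δ univ q a b → dist (h^[q] a) b < ε) (n : ℕ)
    (hab : ReachIn h δ univ (n * q) a b) : ReachIn h^[q] ε univ n a b := by
  induction n generalizing b with
  | zero =>
    rw [zero_mul] at hab
    cases hab
    exact refl (mem_univ _)
  | succ n ih =>
    rw [Nat.succ_mul] at hab
    obtain ⟨c, h1, h2⟩ := hab.split
    exact (ih h1).step (hδ _ _ h2) (mem_univ _)

theorem exists_common_iterate (hh : UniformContinuous h) {q : ℕ} (hq : 0 < q)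
    (hb : h^[q] b = b) (hab : ∀ ε > 0, ∃ r, ReachIn h ε univ r a b)
    (hba : ∀ ε > 0, ∃ r, ReachIn h ε univ r b a) :
    ∃ j, ∀ ε > 0, (∃ n, ReachIn h^[q] ε univ n a (h^[j] b)) ∧
      ∃ n, ReachIn h^[q] ε univ n (h^[j] b) a := by
  obtain ⟨j, hj⟩ : ∃ j : Fin q, ∀ ε > 0, ∃ r, q ∣ r + j ∧ ReachIn h ε univ r a b := by
    by_contra! hcon
    choose δ hδ hδ' using hcon
    have : Nonempty (Fin q) := ⟨⟨0, hq⟩⟩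
    obtain ⟨i, -, hi⟩ := Finset.exists_min_image Finset.univ δ Finset.univ_nonempty
    obtain ⟨r, hr⟩ := hab (δ i) (hδ i)
    refine hδ' ⟨(q - r % q) % q, Nat.mod_lt _ hq⟩ r ?_
      (hr.mono (hi _ (Finset.mem_univ _)) subset_rfl)
    have h1 := (Nat.mod_lt r hq).le
    have h2 : (r + (q - r % q) % q) % q = 0 := by
      rw [Nat.add_mod_mod, ← Nat.mod_add_mod, Nat.add_sub_cancel' h1, Nat.mod_self]
    exact Nat.dvd_of_mod_eq_zero h2
  refine ⟨j, fun ε hε => ?_⟩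
  obtain ⟨δ, hδ, hδ'⟩ := exists_dist_iterate_lt hh q ε hε
  obtain ⟨r, hr, hr'⟩ := hj δ hδ
  obtain ⟨s, hs⟩ := hba δ hδ
  have h1 : ReachIn h δ univ (r + j) a (h^[j] b) :=
    hr'.trans (iterate hδ j fun _ _ => mem_univ _)
  have h2 : ReachIn h δ univ (q - j) (h^[j] b) b := by
    have := iterate (S := univ) (h := h) (a := h^[j] b) hδ (q - j) fun _ _ => mem_univ _
    rwa [← iterate_add_apply, Nat.sub_add_cancel j.2.le, hb] at this
  have h3 := h2.trans hs
  have h4 := ((h3.trans h1).loop (q - 1)).trans h3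
  obtain ⟨k, hk⟩ := hr
  refine ⟨⟨k, iterate_map hδ' k (by rwa [mul_comm, ← hk])⟩, q - j + s + (q - 1) * k,
    iterate_map hδ' _ ?_⟩
  convert h4 using 1
  obtain ⟨q', rfl⟩ : ∃ q', q = q' + 1 := ⟨q - 1, by omega⟩
  rw [hk]
  simp only [Nat.add_sub_cancel]
  ring

end ReachIn

theorem EpsChainFromTo.reachIn {X : Type*} [MetricSpace X] {h : X → X} {ε : ℝ} {x y : X}
    (hxy : EpsChainFromTo h ε x y) : ∃ r, ReachIn h ε univ r x y := by
  obtain ⟨r, z, ⟨-, hz⟩, rfl, rfl⟩ := hxy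
  exact ⟨r, ReachIn.of_fun hz⟩

/-- A periodic local property holds uniformly on horizontal strips. -/
theorem exists_pos_on_strip {Q : ℂ → ℝ → Prop} (R : ℝ) (hper : ∀ z (n : ℤ) δ, Q (z + n) δ → Q z δ)
    (hmono : ∀ z δ δ', δ' ≤ δ → Q z δ → Q z δ') (hloc : ∀ z, ∃ δ > 0, ∀ᶠ w in 𝓝 z, Q w δ) :
    ∃ δ > 0, ∀ z : ℂ, |z.im| ≤ R → Q z δ := by
  obtain ⟨δ, hδ, h⟩ := (isCompact_strip_fundamental (-R) R).induction_on
    (p := fun s => ∃ δ > 0, ∀ z ∈ s, Q z δ) ⟨1, one_pos, fun z hz => hz.elim⟩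
    (fun s t hst ⟨δ, hδ, h⟩ => ⟨δ, hδ, fun z hz => h z (hst hz)⟩)
    (fun s t ⟨δ, hδ, h⟩ ⟨δ', hδ', h'⟩ => ⟨min δ δ', lt_min hδ hδ', fun z hz => hz.elim
      (fun hz => hmono _ _ _ (min_le_left _ _) (h z hz))
      (fun hz => hmono _ _ _ (min_le_right _ _) (h' z hz))⟩)
    (fun z _ => by
      obtain ⟨δ, hδ, h⟩ := hloc z
      exact ⟨_, mem_nhdsWithin_of_mem_nhds h, δ, hδ, fun w hw => hw⟩)
  refine ⟨δ, hδ, fun z hz => ?_⟩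
  obtain ⟨n, hn⟩ := exists_int_translate_mem z
  exact hper z n δ (h _ ⟨hn, by simpa using abs_le.1 hz⟩)

theorem exists_dist_lt_on_strip {F : ℂ → ℂ} (hF : Continuous F) (hc : ∀ z, F (z + 1) = F z + 1)
    (R : ℝ) {ε : ℝ} (hε : 0 < ε) :
    ∃ δ > 0, ∀ z : ℂ, |z.im| ≤ R → ∀ w, dist z w < δ → dist (F z) (F w) < ε := by
  refine exists_pos_on_strip (Q := fun z δ => ∀ w, dist z w < δ → dist (F z) (F w) < ε) R
    (fun z n δ hQ w hw => ?_) (fun z δ δ' hle hQ w hw => hQ w (hw.trans_le hle)) fun z => ?_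
  · have := hQ (w + n) (by rwa [dist_add_right])
    rwa [map_add_int hc, map_add_int hc, dist_add_right] at this
  · obtain ⟨δ, hδ, h⟩ := Metric.continuousAt_iff.1 (hF.continuousAt (x := z)) (ε / 2)
      (half_pos hε)
    refine ⟨δ / 2, half_pos hδ, ?_⟩
    filter_upwards [ball_mem_nhds z (half_pos hδ)] with y hy w hw
    have h1 := h (x := y) (by have := mem_ball.1 hy; linarith)
    have h2 := h (x := w) (by
      have := mem_ball.1 hy
      have := dist_triangle w y z
      rw [dist_comm w y] at this; linarith)
    have := dist_triangle_right (F y) (F w) (F z)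
    linarith

theorem exists_ball_subset_on_strip {f : ℂ → ℂ} (hf : Continuous f)
    (hc : ∀ z, f (z + 1) = f z + 1) {A : Set ℂ} (hA : IsOpen A) (hper : ∀ z, z + 1 ∈ A ↔ z ∈ A)
    {B : Set ℂ} (hB : IsClosed B) (hBper : ∀ z, z + 1 ∈ B ↔ z ∈ B)
    (htrap : ∀ z ∈ B, f z ∈ A) (R : ℝ) :
    ∃ ε > 0, ∀ z : ℂ, |z.im| ≤ R → z ∈ B → ball (f z) ε ⊆ A := by
  refine exists_pos_on_strip (Q := fun z δ => z ∈ B → ball (f z) δ ⊆ A) R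
    (fun z n δ hQ hz w hw => ?_) (fun z δ δ' hle hQ hz => (ball_subset_ball hle).trans (hQ hz))
    fun z => ?_
  · rw [← add_int_mem_iff hper _ n]
    refine hQ ((add_int_mem_iff hBper _ n).2 hz) ?_
    rw [map_add_int hc, mem_ball, dist_add_right]
    exact hw
  · by_cases hz : z ∈ B
    · obtain ⟨ε, hε, hb⟩ := Metric.isOpen_iff.1 hA _ (htrap z hz)
      refine ⟨ε / 2, half_pos hε, ?_⟩
      filter_upwards [hf.continuousAt (x := z) (ball_mem_nhds _ (half_pos hε))] with w hw _ y hy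
      refine hb ?_
      have h1 := mem_ball.1 hw
      have h2 := mem_ball.1 hy
      have := dist_triangle y (f w) (f z)
      exact mem_ball.2 (by linarith)
    · refine ⟨1, one_pos, ?_⟩
      filter_upwards [hB.isOpen_compl.mem_nhds hz] with w hw hw'
      exact absurd hw' hw

theorem IsAnnCover.exists_lift_near {P : ℂ → S2} {p m : S2} (h : IsAnnCover P p m) (R : ℝ) {ε : ℝ}
    (hε : 0 < ε) :
    ∃ δ > 0, ∀ z : ℂ, |z.im| ≤ R → ∀ y, dist (P z) y < δ → ∃ w, P w = y ∧ dist z w < ε := by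
  refine exists_pos_on_strip (Q := fun z δ => ∀ y, dist (P z) y < δ → ∃ w, P w = y ∧ dist z w < ε) R
    (fun z n δ hQ y hy => ?_) (fun z δ δ' hle hQ y hy => hQ y (hy.trans_le hle)) fun z => ?_
  · rw [← h.add_int z n] at hy
    obtain ⟨w, hw, hd⟩ := hQ y hy
    refine ⟨w - n, ?_, ?_⟩
    · rw [← h.add_int _ n, sub_add_cancel, hw]
    · rwa [← dist_add_right _ _ (n : ℂ), sub_add_cancel]
  · have h1 := h.isOpenMap.image_mem_nhds (ball_mem_nhds z (half_pos hε))
    obtain ⟨δ, hδ, hb⟩ := Metric.mem_nhds_iff.1 h1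
    refine ⟨δ / 2, half_pos hδ, ?_⟩
    filter_upwards [ball_mem_nhds z (half_pos hε),
      h.cont.continuousAt (x := z) (ball_mem_nhds _ (half_pos hδ))] with w hw hw' y hy
    obtain ⟨v, hv, rfl⟩ := hb (mem_ball.2 (show dist y (P z) < δ by
      have := dist_triangle y (P w) (P z)
      have := mem_ball.1 hw'
      rw [dist_comm y (P w)] at *
      linarith))
    refine ⟨v, rfl, ?_⟩
    have h2 := mem_ball.1 hw
    have h3 := mem_ball.1 hv
    have := dist_triangle_right w v z
    linarith

theorem exists_dist_lt_of_trap {X : Type*} [PseudoMetricSpace X] {g : X → X} (hg : Continuous g)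
    {K O : Set X} (hK : IsCompact K) (hO : IsOpen O) (hKO : ∀ z ∈ K, g z ∈ O) :
    ∃ δ > 0, ∀ z ∈ K, ∀ y, dist (g z) y < δ → y ∈ O := by
  obtain ⟨δ, hδ, h⟩ := (hK.image hg).exists_thickening_subset_open hO (image_subset_iff.2 hKO)
  refine ⟨δ, hδ, fun z hz y hy => h ?_⟩
  rw [mem_thickening_iff]
  exact ⟨g z, mem_image_of_mem g hz, by rwa [dist_comm]⟩

theorem ReachIn.restrict_compl {X : Type*} [PseudoMetricSpace X] {h : X → X} {δ : ℝ} {S : Set X}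
    {n : ℕ} {a b : X} (hab : ReachIn h δ S n a b) {B : Set X} (hb : b ∉ B)
    (hB : ∀ z ∈ S, z ∈ B → ∀ y, dist (h z) y < δ → y ∈ B) :
    ReachIn h δ (S ∩ Bᶜ) n a b := by
  induction hab with
  | refl h0 => exact .refl ⟨h0, hb⟩
  | step h0 h1 h2 ih => exact (ih fun hbB => hb (hB _ h0.mem_right hbB _ h1)).step h1 ⟨h2, hb⟩

theorem IsAnnCover.exists_lift_chain {P : ℂ → S2} {p m : S2} (hP : IsAnnCover P p m) {g : S2 → S2}
    {f : ℂ ≃ₜ ℂ} (hf : IsAnnular f) (hfg : ∀ z, P (f z) = g (P z)) (R : ℝ) {ε : ℝ} (hε : 0 < ε) :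
    ∃ δ > 0, ∀ (S : Set S2), (∀ z, P z ∈ S → |z.im| ≤ R) → ∀ δ' ≤ δ, ∀ n x b,
      ReachIn g δ' S n (P x) b → ∃ y, P y = b ∧ ReachIn f ε {z | |z.im| ≤ R} n x y := by
  obtain ⟨B, hB⟩ := hf.exists_bound_disp (-R) R
  obtain ⟨δ, hδ, h⟩ := hP.exists_lift_near (R + B) hε
  refine ⟨δ, hδ, fun S hS δ' hδ' n x b hxb => ?_⟩
  obtain ⟨X, hX⟩ : ∃ X, X = P x := ⟨_, rfl⟩
  rw [← hX] at hxb
  induction hxb with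
  | refl h0 => exact ⟨x, hX.symm, .refl (hS _ (hX ▸ h0))⟩
  | step h0 h1 h2 ih =>
    obtain ⟨y, rfl, hxy⟩ := ih hX
    have hy : |y.im| ≤ R := hxy.mem_right
    have h3 : |(f y).im| ≤ R + B := by
      have h4 := hB y (abs_le.1 hy)
      have h5 := (Complex.abs_im_le_norm (f y - y)).trans h4
      rw [Complex.sub_im] at h5
      have := abs_sub_abs_le_abs_sub (f y).im y.im
      linarith
    obtain ⟨w, rfl, hw⟩ := h (f y) h3 _ (by rw [hfg]; exact h1.trans_le hδ')
    exact ⟨w, rfl, hxy.step hw (hS _ h2)⟩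

theorem IsAnnular.reach_add_int {f : ℂ ≃ₜ ℂ} (hf : IsAnnular f) {ε : ℝ} {S : Set ℂ}
    (hS : ∀ z, z + 1 ∈ S ↔ z ∈ S) {n : ℕ} {a b : ℂ} (hab : ReachIn f ε S n a b) (k : ℤ) :
    ReachIn f ε S n (a + k) (b + k) :=
  hab.map (fun z => z + k) (fun z y h => by rwa [map_add_int hf.comm, dist_add_right])
    fun z hz => (add_int_mem_iff hS z k).2 hz

theorem apply_mem_component {f : ℂ ≃ₜ ℂ} (hf : IsAnnular f) {A : Set ℂ}
    (hper : ∀ z, z + 1 ∈ A ↔ z ∈ A) (htrap : ∀ z ∈ A, f z ∈ A) {x z : ℂ} (hx : x ∈ A) {d : ℤ}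
    (hfx : f x = x + d) {k : ℤ} (hz : z ∈ connectedComponentIn A (x + k)) :
    f z ∈ connectedComponentIn A (x + (k + d : ℤ)) := by
  have hxk : x + (k : ℂ) ∈ A := (add_int_mem_iff hper _ _).2 hx
  have h1 : IsPreconnected (f '' connectedComponentIn A (x + k)) :=
    isPreconnected_connectedComponentIn.image _ f.continuous.continuousOn
  refine h1.subset_connectedComponentIn ⟨_, mem_connectedComponentIn hxk, ?_⟩ ?_ ⟨z, hz, rfl⟩
  · rw [map_add_int hf.comm, hfx]
    push_cast
    ring
  · rintro _ ⟨w, hw, rfl⟩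
    exact htrap _ (connectedComponentIn_subset _ _ hw)

theorem iterate_mem_component {f : ℂ ≃ₜ ℂ} (hf : IsAnnular f) {A : Set ℂ}
    (hper : ∀ z, z + 1 ∈ A ↔ z ∈ A) (htrap : ∀ z ∈ A, f z ∈ A) {x z : ℂ} (hx : x ∈ A) {d : ℤ}
    (hfx : f x = x + d) (hz : z ∈ connectedComponentIn A x) (n : ℕ) :
    f^[n] z ∈ connectedComponentIn A (x + (n * d : ℤ)) := by
  induction n with
  | zero => simpa using hz
  | succ n ih =>
    rw [iterate_succ_apply']
    convert apply_mem_component hf hper htrap hx hfx ih using 3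
    push_cast
    ring

theorem ReachIn.mem_component {f : ℂ ≃ₜ ℂ} (hf : IsAnnular f) {A S : Set ℂ}
    (hper : ∀ z, z + 1 ∈ A ↔ z ∈ A) (htrap : ∀ z ∈ A, f z ∈ A) {x w : ℂ} (hx : x ∈ A) {d : ℤ}
    (hfx : f x = x + d) {ε : ℝ} (hball : ∀ z ∈ S, z ∈ A → ball (f z) ε ⊆ A) {n : ℕ}
    (hxw : ReachIn f ε S n x w) : w ∈ connectedComponentIn A (x + (n * d : ℤ)) := by
  induction hxw with
  | refl => simpa using mem_connectedComponentIn hx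
  | @step n a b c h0 h1 h2 ih =>
    have hb := ih hx hfx
    have hfb := apply_mem_component hf hper htrap hx hfx hb
    have hsub := hball b h0.mem_right (connectedComponentIn_subset _ _ hb)
    have hε : 0 < ε := dist_nonneg.trans_lt h1
    have h3 := (convex_ball (f b) ε).isPreconnected.subset_connectedComponentIn
      (mem_ball_self hε) hsub
    rw [← connectedComponentIn_eq hfb] at h3
    have := h3 (mem_ball'.2 h1)
    convert this using 3
    push_cast
    ring

theorem ReachIn.add_int_mem_component {f : ℂ ≃ₜ ℂ} (hf : IsAnnular f) {A S : Set ℂ}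
    (hper : ∀ z, z + 1 ∈ A ↔ z ∈ A) (htrap : ∀ z ∈ A, f z ∈ A) {x w : ℂ} (hx : x ∈ A) {d k : ℤ}
    (hfx : f x = x + d) (hfw : f w = w + k) {ε : ℝ}
    (hball : ∀ z ∈ S, z ∈ A → ball (f z) ε ⊆ A) {n : ℕ}
    (hxw : ReachIn f ε S n x w) : x + (k - d : ℤ) ∈ connectedComponentIn A x := by
  have h1 := hxw.mem_component hf hper htrap hx hfx hball
  have h2 := apply_mem_component hf hper htrap hx hfx h1
  have h3 := add_int_mem_connectedComponentIn hper h1 k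
  rw [hfw] at h2
  have h4 := (connectedComponentIn_eq h2).trans (connectedComponentIn_eq h3).symm
  have h5 : x + (n * d : ℤ) + (k : ℂ) ∈ connectedComponentIn A (x + (n * d + d : ℤ)) := by
    rw [h4]
    exact mem_connectedComponentIn ((add_int_mem_iff hper _ _).2 ((add_int_mem_iff hper _ _).2 hx))
  have h6 := add_int_mem_connectedComponentIn hper h5 (-(n * d + d))
  rw [show x + ((n * d + d : ℤ) : ℂ) + ((-(n * d + d) : ℤ) : ℂ) = x by push_cast; ring] at h6
  convert h6 using 1
  push_cast
  ring

theorem IsAnnCover.exists_joined_high {P : ℂ → S2} {p m : S2} (hP : IsAnnCover P p m) {W : Set S2}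
    (hW : IsOpen W) (hWc : IsPreconnected W) (hp : p ∈ W) (hm : m ∉ W) {c : ℂ} (hc : P c ∈ W)
    (M : ℝ) : ∃ z, JoinedIn (P ⁻¹' W) c z ∧ M < z.im := by
  have hO : IsOpen (P ⁻¹' W) := hW.preimage hP.cont
  have hT : ∀ z, z + 1 ∈ P ⁻¹' W ↔ z ∈ P ⁻¹' W := fun z => by
    have := hP.add_int z 1
    rw [mem_preimage, mem_preimage, ← this]
    simp
  set Q := connectedComponentIn (P ⁻¹' W) c with hQ
  have hQo : IsOpen Q := hO.connectedComponentIn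
  have hQc : IsConnected Q := ⟨⟨c, mem_connectedComponentIn hc⟩, isPreconnected_connectedComponentIn⟩
  have hQp := hQo.isConnected_iff_isPathConnected.1 hQc
  suffices h : ∃ z ∈ Q, M < z.im by
    obtain ⟨z, hz, hzM⟩ := h
    exact ⟨z, (hQp.joinedIn c (mem_connectedComponentIn hc) z hz).mono
      (connectedComponentIn_subset _ _), hzM⟩
  by_contra! hcon
  have hsub : W ⊆ P '' Q := by
    refine hWc.subset_of_closure_inter_subset (hP.isOpenMap _ hQo)
      ⟨P c, hc, mem_image_of_mem _ (mem_connectedComponentIn hc)⟩ ?_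
    rintro y ⟨hy, hyW⟩
    have hyp : y ≠ p := by
      rintro rfl
      obtain ⟨U, hU, hyU, hUz⟩ := hP.exists_nhds_top M
      obtain ⟨_, h1, q, hq, rfl⟩ := mem_closure_iff.1 hy U hU hyU
      exact (hUz q h1).not_ge (hcon q hq)
    have hym : y ≠ m := fun h => hm (h ▸ hyW)
    obtain ⟨w, rfl⟩ := hP.surj y hyp hym
    obtain ⟨r, hr, hb⟩ := Metric.isOpen_iff.1 hO w hyW
    obtain ⟨_, ⟨b, hbw, rfl⟩, q, hq, hqb⟩ := mem_closure_iff.1 hy (P '' ball w r)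
      (hP.isOpenMap _ isOpen_ball) (mem_image_of_mem _ (mem_ball_self hr))
    obtain ⟨n, rfl⟩ := (hP.eq_iff _ _).1 hqb
    have h1 := add_int_mem_connectedComponentIn hT hq n
    have h2 := (convex_ball w r).isPreconnected.subset_connectedComponentIn hbw hb
    rw [← connectedComponentIn_eq h1] at h2
    have h3 := add_int_mem_connectedComponentIn hT (h2 (mem_ball_self hr)) (-n)
    refine ⟨w + (-n : ℤ), ?_, hP.add_int _ _⟩
    convert h3 using 2
    push_cast
    ring
  obtain ⟨z, -, hz⟩ := hsub hp
  exact hP.ne_top z hz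

theorem IsAnnCover.exists_joined_low {P : ℂ → S2} {p m : S2} (hP : IsAnnCover P p m) {W : Set S2}
    (hW : IsOpen W) (hWc : IsPreconnected W) (hp : p ∉ W) (hm : m ∈ W) {c : ℂ} (hc : P c ∈ W)
    (M : ℝ) : ∃ z, JoinedIn (P ⁻¹' W) c z ∧ z.im < M := by
  obtain ⟨z, ⟨γ, hγ⟩, hzM⟩ := hP.neg.exists_joined_high hW hWc hm hp (c := -c)
    (by simpa using hc) (-M)
  refine ⟨-z, ⟨(γ.map continuous_neg).cast (neg_neg c).symm rfl, fun t => ?_⟩, ?_⟩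
  · have := hγ t
    simpa using this
  · rw [Complex.neg_im]
    linarith

theorem component_contains_bottom {P : ℂ → S2} {p m : S2} (hP : IsAnnCover P p m) {f : ℂ ≃ₜ ℂ}
    (hf : IsAnnular f) {A : Set ℂ} (hA : IsOpen A) (hper : ∀ z, z + 1 ∈ A ↔ z ∈ A)
    (htrap : ∀ z ∈ A, f z ∈ A) {M : ℝ} (hM : ∀ z ∈ A, z.im ≤ M) {Wp Wm : Set S2} (hWp : IsOpen Wp)
    (hWpc : IsPreconnected Wp) (hpWp : p ∈ Wp) (hmWp : m ∉ Wp) (hWm : IsOpen Wm)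
    (hWmc : IsPreconnected Wm) (hmWm : m ∈ Wm) (hpWm : p ∉ Wm) (hne : (Wp ∩ Wm).Nonempty)
    (hesc : ∀ K, IsCompact K → K ⊆ Wp → ∃ n : ℕ, ∀ y ∈ A, P (f^[n] y) ∉ K)
    (hdown : ∀ z, P z ∈ Wm → ∀ C : ℝ, ∃ n : ℕ, (f^[n] z).im < C)
    (hbot : ∀ y ∈ A, P y ∈ Wm → ∃ C : ℝ, ∀ z : ℂ, z.im < C → z ∈ A)
    {x : ℂ} (hx : x ∈ A) {d : ℤ} (hfx : f x = x + d) {j : ℤ} (hj : 0 < j)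
    (hxj : x + j ∈ connectedComponentIn A x) :
    ∃ C : ℝ, ∀ z : ℂ, z.im < C → z ∈ connectedComponentIn A x := by
  have hshift : ∀ (z : ℂ) (k : ℤ), z ∈ connectedComponentIn A (x + k) →
      z + (-k : ℤ) ∈ connectedComponentIn A x := fun z k hz => by
    have := add_int_mem_connectedComponentIn hper hz (-k)
    rwa [show x + (k : ℂ) + ((-k : ℤ) : ℂ) = x by push_cast; ring] at this
  obtain ⟨y, hy, hyW⟩ : ∃ y ∈ connectedComponentIn A x, P y ∈ Wm := by
    by_contra! hcon
    obtain ⟨c', hc'⟩ := hne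
    obtain ⟨c, rfl⟩ := hP.surj c' (fun h => hpWm (h ▸ hc'.2)) (fun h => hmWp (h ▸ hc'.1))
    obtain ⟨M', hM'⟩ := hP.bot Wm hWm hmWm
    obtain ⟨a, ha, haM⟩ := hP.exists_joined_low hWm hWmc hpWm hmWm hc'.2 M'
    obtain ⟨b, hb, hbM⟩ := hP.exists_joined_high hWp hWpc hpWp hmWp hc'.1 M
    obtain ⟨β, hβ⟩ : JoinedIn (P ⁻¹' (Wp ∪ Wm)) a b :=
      (ha.symm.mono (preimage_mono subset_union_right)).trans
        (hb.mono (preimage_mono subset_union_left))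
    obtain ⟨n, hn⟩ := hesc (range (P ∘ β) ∩ Wmᶜ)
      ((isCompact_range (hP.cont.comp β.continuous)).inter_right hWm.isClosed_compl) (by
        rintro _ ⟨⟨t, rfl⟩, ht⟩
        exact (hβ t).resolve_right ht)
    have hpc := hA.connectedComponentIn.isConnected_iff_isPathConnected.1
      ⟨⟨x, mem_connectedComponentIn hx⟩, isPreconnected_connectedComponentIn⟩
    obtain ⟨γ, hγ⟩ := hpc.joinedIn x (mem_connectedComponentIn hx) _ hxj
    have hfn : Continuous f^[n] := f.continuous.iterate n
    have hcomm : ∀ z, f^[n] (z + 1) = f^[n] z + 1 := fun z => by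
      have h1 : Function.Commute f (fun z => z + 1) := fun z => hf.comm z
      exact h1.iterate_left n z
    have hmem : ∀ t, f^[n] (γ t) ∈ connectedComponentIn A (x + (n * d : ℤ)) := fun t =>
      iterate_mem_component hf hper htrap hx hfx (hγ t) n
    have hlow : ∀ t, P (f^[n] (γ t)) ∉ Wm := fun t ht => by
      refine hcon _ (hshift _ _ (hmem t)) ?_
      rwa [hP.add_int]
    refine false_of_horizontal_path hj ((γ.map hfn).cast rfl (map_add_int hcomm x j).symm)
      (Q := range β) (isPreconnected_range β.continuous) (fun t k => ?_)
      (a := a) (b := b) ⟨0, β.source⟩ ⟨1, β.target⟩ (fun t => ?_) fun t => ?_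
    · rintro ⟨s, hs⟩
      have hs' : P (β s) = P (f^[n] (γ t)) := by
        rw [hs]
        have := hP.add_int (f^[n] (γ t)) (k * j)
        push_cast at this
        exact this
      exact hn (γ t) (connectedComponentIn_subset _ _ (hγ t)) ⟨⟨s, hs'⟩, hlow t⟩
    · by_contra! hle
      exact hlow t (hM' _ (hle.trans haM.le))
    · exact (hM _ (connectedComponentIn_subset _ _ (hmem t))).trans_lt hbM
  obtain ⟨C, hC⟩ := hbot y (connectedComponentIn_subset _ _ hy) hyW
  obtain ⟨n, hn⟩ := hdown y hyW C
  have h1 := hshift _ _ (iterate_mem_component hf hper htrap hx hfx hy n)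
  have h2 : IsPreconnected {z : ℂ | z.im < C} := (convex_halfSpace_im_lt C).isPreconnected
  have h3 := h2.subset_connectedComponentIn (x := f^[n] y + ((-(n * d) : ℤ) : ℂ))
    (by simpa using hn) hC
  rw [← connectedComponentIn_eq h1] at h3
  exact ⟨C, fun z hz => h3 hz⟩

/-- `V` is a trapping neighbourhood of the attracting fixed point `m`, with basin `W`. -/
structure IsSink {X : Type*} [TopologicalSpace X] (g : X ≃ₜ X) (m : X) (V W : Set X) : Prop where
  isOpen : IsOpen V
  mem : m ∈ V
  trap : ∀ y ∈ closure V, g y ∈ V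
  isOpen_basin : IsOpen W
  conn : IsPreconnected W
  subset : V ⊆ W
  absorb : ∀ K, IsCompact K → K ⊆ W → ∃ n : ℕ, ∀ y ∈ K, g^[n] y ∈ V
  shrink : ∀ U, IsOpen U → m ∈ U → ∃ n : ℕ, ∀ y ∈ V, g^[n] y ∈ U

namespace IsSink

variable {X : Type*} [TopologicalSpace X] {g : X ≃ₜ X} {m : X} {V W : Set X}

theorem iterate_mem (h : IsSink g m V W) {y : X} (hy : y ∈ V) (n : ℕ) : g^[n] y ∈ V := by
  induction n with
  | zero => exact hy
  | succ n ih =>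
    rw [iterate_succ_apply']
    exact h.trap _ (subset_closure ih)

theorem eq_of_fixed [T1Space X] (h : IsSink g m V W) {y : X} (hy : y ∈ closure V) (hg : g y = y) :
    y = m := by
  by_contra hne
  obtain ⟨n, hn⟩ := h.shrink {y}ᶜ isOpen_compl_singleton (Ne.symm hne)
  refine hn y (hg ▸ h.trap y hy) ?_
  exact iterate_fixed hg n

theorem tendsto (h : IsSink g m V W) {y : X} (hy : y ∈ W) {U : Set X} (hU : IsOpen U)
    (hmU : m ∈ U) : ∃ n : ℕ, g^[n] y ∈ U := by
  obtain ⟨n, hn⟩ := h.absorb {y} isCompact_singleton (singleton_subset_iff.2 hy)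
  obtain ⟨k, hk⟩ := h.shrink U hU hmU
  exact ⟨k + n, by rw [iterate_add_apply]; exact hk _ (hn y rfl)⟩

theorem exists_small (h : IsSink g m V W) (hm : g m = m) {U : Set X} (hU : IsOpen U)
    (hmU : m ∈ U) : ∃ V', IsSink g m V' W ∧ closure V' ⊆ U := by
  obtain ⟨n, hn⟩ := h.shrink U hU hmU
  have hc : Continuous g.symm^[n + 1] := g.symm.continuous.iterate _
  have hcl : closure (g.symm^[n + 1] ⁻¹' V) ⊆ g.symm^[n + 1] ⁻¹' closure V :=
    hc.closure_preimage_subset V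
  have hgs : ∀ k y, g^[k] (g.symm^[k] y) = y := fun k => LeftInverse.iterate g.apply_symm_apply k
  have hsg : ∀ k y, g.symm^[k] (g^[k] y) = y := fun k => LeftInverse.iterate g.symm_apply_apply k
  have hcomm : ∀ y, g.symm^[n + 1] (g y) = g (g.symm^[n + 1] y) := fun y => by
    rw [iterate_succ_apply, g.symm_apply_apply, iterate_succ_apply', g.apply_symm_apply]
  have hV : ∀ y ∈ V, g^[n + 1] y ∈ g.symm^[n + 1] ⁻¹' V := fun y hy => by
    rwa [mem_preimage, hsg]
  refine ⟨g.symm^[n + 1] ⁻¹' V, ⟨h.isOpen.preimage hc, ?_, fun y hy => ?_, h.isOpen_basin, h.conn,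
    fun y hy => ?_, fun K hK hKW => ?_, fun O hO hmO => ?_⟩, fun y hy => ?_⟩
  · rw [mem_preimage, iterate_fixed (g.symm_apply_eq.2 hm.symm)]
    exact h.mem
  · rw [mem_preimage, hcomm]
    exact h.trap _ (hcl hy)
  · refine h.subset ?_
    rw [← hgs (n + 1) y]
    exact h.iterate_mem hy _
  · obtain ⟨k, hk⟩ := h.absorb K hK hKW
    exact ⟨n + 1 + k, fun y hy => by rw [iterate_add_apply]; exact hV _ (hk y hy)⟩
  · obtain ⟨k, hk⟩ := h.shrink O hO hmO
    refine ⟨k, fun y hy => hk y ?_⟩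
    rw [← hgs (n + 1) y]
    exact h.iterate_mem hy _
  · rw [← hgs (n + 1) y, iterate_succ_apply]
    exact hn _ (h.trap _ (hcl hy))

theorem iterate_ge_mem (h : IsSink g m V W) {y : X} {n k : ℕ} (hy : g^[n] y ∈ V) (hk : n ≤ k) :
    g^[k] y ∈ V := by
  obtain ⟨j, rfl⟩ := Nat.exists_eq_add_of_le' hk
  rw [iterate_add_apply]
  exact h.iterate_mem hy j

theorem iterate (h : IsSink g m V W) {q : ℕ} (hq : 0 < q) {G : X ≃ₜ X}
    (hG : ∀ y, G y = g^[q] y) : IsSink G m V W := by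
  have hGn : ∀ n y, G^[n] y = g^[q * n] y := fun n y => by
    rw [iterate_mul, show (G : X → X) = g^[q] from funext hG]
  refine ⟨h.isOpen, h.mem, fun y hy => ?_, h.isOpen_basin, h.conn, h.subset, fun K hK hKW => ?_,
    fun U hU hmU => ?_⟩
  · obtain ⟨k, rfl⟩ := Nat.exists_eq_succ_of_ne_zero hq.ne'
    rw [hG, iterate_succ_apply]
    exact h.iterate_mem (h.trap y hy) k
  · obtain ⟨n, hn⟩ := h.absorb K hK hKW
    exact ⟨n, fun y hy => by rw [hGn]; exact h.iterate_ge_mem (hn y hy) (Nat.le_mul_of_pos_left n hq)⟩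
  · obtain ⟨k, hk⟩ := h.shrink U hU hmU
    refine ⟨k, fun y hy => ?_⟩
    obtain ⟨j, hj⟩ := Nat.exists_eq_add_of_le (Nat.le_mul_of_pos_left k hq)
    rw [hGn, hj, iterate_add_apply]
    exact hk _ (h.iterate_mem hy j)

end IsSink

theorem IsOpenDisk.isPreconnected {V : Set S2} (hV : IsOpenDisk V) : IsPreconnected V := by
  obtain ⟨-, ⟨φ⟩⟩ := hV
  have h1 : PreconnectedSpace (ball (0 : EuclideanSpace ℝ (Fin 2)) 1) :=
    isPreconnected_iff_preconnectedSpace.1 (convex_ball _ _).isPreconnected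
  have h2 : range (Subtype.val ∘ φ.symm) = V := by
    rw [φ.symm.surjective.range_comp, Subtype.range_coe]
  rw [← h2]
  exact isPreconnected_range (continuous_subtype_val.comp φ.symm.continuous)

theorem AttractorWithBasin.exists_isSink {h : S2 ≃ₜ S2} {m : S2} {W : Set S2}
    (hW : AttractorWithBasin h m W) : h m = m ∧ ∃ V, IsSink h m V W := by
  obtain ⟨hm, V, hV, hmV, hVV, hInt, rfl⟩ := hW
  have htrap : ∀ y ∈ closure V, h y ∈ V := fun y hy => hVV (mem_image_of_mem h hy)
  have hgs : ∀ k y, h^[k] (h.symm^[k] y) = y := fun k => LeftInverse.iterate h.apply_symm_apply k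
  have hsg : ∀ k y, h.symm^[k] (h^[k] y) = y := fun k => LeftInverse.iterate h.symm_apply_apply k
  have hpre : ∀ i : ℕ, h.symm^[i] '' V = h^[i] ⁻¹' V := fun i => by
    ext y
    constructor
    · rintro ⟨z, hz, rfl⟩
      rwa [mem_preimage, hgs]
    · exact fun hy => ⟨_, hy, hsg i y⟩
  have hms : h.symm m = m := h.symm_apply_eq.2 hm.symm
  have hopen : ∀ i : ℕ, IsOpen (h.symm^[i] '' V) := fun i => by
    rw [hpre]
    exact hV.1.preimage (h.continuous.iterate i)
  have hmono : Monotone fun i : ℕ => h.symm^[i] '' V := by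
    refine monotone_nat_of_le_succ fun i => ?_
    rw [hpre, hpre]
    intro y hy
    rw [mem_preimage, iterate_succ_apply']
    exact htrap _ (subset_closure hy)
  refine ⟨hm, V, hV.1, hmV, htrap, isOpen_iUnion hopen, ?_, ?_, ?_, ?_⟩
  · exact isPreconnected_iUnion ⟨m, mem_iInter.2 fun i => ⟨m, hmV, iterate_fixed hms i⟩⟩ fun i =>
      hV.isPreconnected.image _ (h.symm.continuous.iterate i).continuousOn
  · exact subset_iUnion_of_subset 0 (by simp)
  · intro K hK hKW
    obtain ⟨n, hn⟩ := hK.elim_directed_cover _ hopen hKW hmono.directed_le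
    refine ⟨n, fun y hy => ?_⟩
    have := hn hy
    rwa [hpre] at this
  · intro U hU hmU
    have hanti : Antitone fun i : ℕ => h^[i] '' closure V := by
      refine antitone_nat_of_succ_le fun i => ?_
      rintro _ ⟨y, hy, rfl⟩
      exact ⟨h y, subset_closure (htrap y hy), rfl⟩
    obtain ⟨n, hn⟩ := exists_subset_nhds_of_isCompact' (V := fun i : ℕ => h^[i] '' closure V)
      hanti.directed_ge (fun i => isClosed_closure.isCompact.image (h.continuous.iterate i))
      (fun i => (isClosed_closure.isCompact.image (h.continuous.iterate i)).isClosed) (U := U) (by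
        intro y hy
        have : y ∈ ⋂ i : ℕ, h^[i] '' V := by
          refine mem_iInter.2 fun i => ?_
          obtain ⟨z, hz, rfl⟩ := mem_iInter.1 hy (i + 1)
          exact ⟨h z, htrap z hz, rfl⟩
        rw [hInt] at this
        rw [mem_singleton_iff.1 this]
        exact hU.mem_nhds hmU)
    exact ⟨n, fun y hy => hn ⟨y, subset_closure hy, rfl⟩⟩

theorem semiconj_iterate {P : ℂ → S2} {g : S2 → S2} {f : ℂ → ℂ}
    (hfg : ∀ z, P (f z) = g (P z)) (n : ℕ) (z : ℂ) : P (f^[n] z) = g^[n] (P z) :=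
  (Semiconj.iterate_right (f := P) (ga := f) (gb := g) hfg n) z

theorem exists_isTrap_component {P : ℂ → S2} {p m : S2} (hP : IsAnnCover P p m) {g : S2 ≃ₜ S2}
    {f : ℂ ≃ₜ ℂ} (hf : IsAnnular f) (hfg : ∀ z, P (f z) = g (P z)) {Vp Wp Vm Wm : Set S2}
    (hp : IsSink g.symm p Vp Wp) (hm : IsSink g m Vm Wm) (hpWm : p ∉ Wm) (hmWp : m ∉ Wp)
    (hne : (Wp ∩ Wm).Nonempty) {A : Set ℂ} (hA : IsOpen A) (hper : ∀ z, z + 1 ∈ A ↔ z ∈ A)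
    (htrap : ∀ z ∈ closure A, f z ∈ A) {M : ℝ} (hM : ∀ z ∈ A, z.im ≤ M) {N : ℕ}
    (hesc : ∀ y ∈ A, P (f^[N] y) ∉ Vp)
    (hbot : ∀ y ∈ A, P y ∈ Wm → ∃ C : ℝ, ∀ z : ℂ, z.im < C → z ∈ A)
    {x : ℂ} (hx : x ∈ A) {d : ℤ} (hfx : f x = x + d) {k : ℤ} (hdk : d < k) {R : ℝ}
    (hch : ∀ ε > 0, ∃ n w, f w = w + k ∧ ReachIn f ε {z : ℂ | |z.im| ≤ R} n x w) :
    ∃ C, IsTrap f C (connectedComponentIn A x) := by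
  have htrap' : ∀ z ∈ A, f z ∈ A := fun z hz => htrap z (subset_closure hz)
  obtain ⟨ε, hε, hball⟩ := exists_ball_subset_on_strip f.continuous hf.comm hA hper isClosed_closure
    (mem_closure_periodic hper) htrap R
  obtain ⟨n, w, hfw, hxw⟩ := hch ε hε
  have hj := hxw.add_int_mem_component hf hper htrap' hx hfx hfw
    fun z hz hzA => hball z hz (subset_closure hzA)
  obtain ⟨C, hC⟩ := component_contains_bottom hP hf hA hper htrap' hM hp.isOpen_basin hp.conn
    (hp.subset hp.mem) hmWp hm.isOpen_basin hm.conn (hm.subset hm.mem) hpWm hne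
    (fun K hK hKW => by
      obtain ⟨n, hn⟩ := hp.absorb K hK hKW
      refine ⟨n + N, fun y hy hyK => hesc y hy ?_⟩
      rw [iterate_add_apply, semiconj_iterate hfg] at hyK
      have := hn _ hyK
      rwa [LeftInverse.iterate g.symm_apply_apply n] at this)
    (fun z hz C => by
      obtain ⟨U, hU, hmU, hUC⟩ := hP.exists_nhds_bot C
      obtain ⟨n, hn⟩ := hm.tendsto hz hU hmU
      exact ⟨n, hUC _ (by rwa [semiconj_iterate hfg])⟩)
    hbot hx hfx (sub_pos.2 hdk) hj
  set D := connectedComponentIn A x with hD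
  have hDA : D ⊆ A := connectedComponentIn_subset A x
  have hshift : ∀ z (n : ℤ), z ∈ D → z + n ∈ D := by
    intro z n hz
    have h1 := add_int_mem_connectedComponentIn hper hz n
    set w : ℂ := ⟨0, C - 1⟩
    have hw : w ∈ D := hC w (by simp [w])
    have hw' : w + n ∈ D := hC (w + n) (by simp [w])
    have h2 := add_int_mem_connectedComponentIn hper hw n
    have h3 := (connectedComponentIn_eq h2).trans (connectedComponentIn_eq hw').symm
    rwa [h3] at h1
  have hDper : ∀ z, z + 1 ∈ D ↔ z ∈ D := fun z =>
    ⟨fun h => by simpa using hshift _ (-1) h, fun h => by simpa using hshift _ 1 h⟩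
  have hmap : ∀ z ∈ D, f z ∈ D := fun z hz => by
    have h1 := apply_mem_component hf hper htrap' hx hfx (k := 0) (by simpa using hz)
    have h2 := (connectedComponentIn_eq (hshift x (0 + d) (mem_connectedComponentIn hx))).symm
    rwa [h2] at h1
  refine ⟨max M (-C), hA.connectedComponentIn, isPreconnected_connectedComponentIn, hDper,
    fun z hz => ?_, fun z hz => hC z ?_, fun z hz hzD => ?_⟩
  · have hfz := htrap z (closure_mono hDA hz)
    obtain ⟨r, hr, hb⟩ := Metric.isOpen_iff.1 hA _ hfz
    obtain ⟨w, hw, hwD⟩ := mem_closure_iff.1 hz (f ⁻¹' ball (f z) r)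
      (isOpen_ball.preimage f.continuous) (mem_ball_self hr)
    have h1 := (convex_ball (f z) r).isPreconnected.subset_connectedComponentIn hw hb
    rw [← connectedComponentIn_eq (hmap w hwD)] at h1
    exact h1 (mem_ball_self hr)
  · have := le_max_right M (-C)
    linarith
  · have h1 : closure D ⊆ {z : ℂ | z.im ≤ M} :=
      closure_minimal (fun z hz => hM z (hDA hz)) (isClosed_le Complex.continuous_im continuous_const)
    exact (h1 hzD).not_gt ((le_max_left _ _).trans_lt hz)

/-- Chains on the sphere between points away from the two ends lift to chains in a strip. -/
theorem exists_strip_chain {P : ℂ → S2} {p m : S2} (hP : IsAnnCover P p m) {g : S2 ≃ₜ S2}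
    {f : ℂ ≃ₜ ℂ} (hf : IsAnnular f) (hfg : ∀ z, P (f z) = g (P z)) {Vp Wp Vm Wm : Set S2}
    (hp : IsSink g.symm p Vp Wp) (hm : IsSink g m Vm Wm) :
    ∃ R, ∀ x y, P x ∉ Vp → P y ∉ closure Vm → (∀ ε > 0, ∃ n, ReachIn g ε univ n (P x) (P y)) →
      ∀ ε > 0, ∃ n, ∃ α : ℤ, ReachIn f ε {z : ℂ | |z.im| ≤ R} n x (y + α) := by
  obtain ⟨M, hM⟩ := hP.top Vp hp.isOpen hp.mem
  obtain ⟨M', hM'⟩ := hP.bot Vm hm.isOpen hm.mem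
  refine ⟨max M (-M'), fun x y hx hy hch ε hε => ?_⟩
  obtain ⟨δ₁, hδ₁, h1⟩ := exists_dist_lt_of_trap g.continuous hp.isOpen.isClosed_compl.isCompact
    (isClosed_closure (s := Vp)).isOpen_compl fun z hz hz' => hz (by
      simpa using hp.trap _ hz')
  obtain ⟨δ₂, hδ₂, h2⟩ := exists_dist_lt_of_trap g.continuous
    (isClosed_closure (s := Vm)).isCompact hm.isOpen hm.trap
  obtain ⟨δ₃, hδ₃, h3⟩ := hP.exists_lift_chain hf hfg (max M (-M')) hε
  obtain ⟨n, hn⟩ := hch (min δ₁ (min δ₂ δ₃)) (lt_min hδ₁ (lt_min hδ₂ hδ₃))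
  have h4 := (hn.restrict (A := Vpᶜ) hx fun z _ hz y _ hzy h =>
    h1 z hz y (hzy.trans_le (min_le_left _ _)) (subset_closure h)).restrict_compl hy fun z _ hz y hzy =>
    subset_closure (h2 z hz y (hzy.trans_le ((min_le_right _ _).trans (min_le_left _ _))))
  obtain ⟨w, hw, hxw⟩ := h3 _ (fun z hz => by
    rw [abs_le]
    constructor
    · by_contra! h
      have := le_max_right M (-M')
      exact hz.2 (subset_closure (hM' z (by linarith)))
    · by_contra! h
      exact hz.1.2 (hM z ((le_max_left _ _).trans h.le))) _
    ((min_le_right _ _).trans (min_le_right _ _)) _ _ _ h4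
  obtain ⟨α, rfl⟩ := (hP.eq_iff _ _).1 hw.symm
  exact ⟨n, α, hxw⟩

theorem exists_reverse_chain {f : ℂ ≃ₜ ℂ} (hf : IsAnnular f) (R : ℝ) {ε : ℝ} (hε : 0 < ε) :
    ∃ δ > 0, ∀ n a b, ReachIn f δ {z : ℂ | |z.im| ≤ R} n a b →
      ReachIn (negConj f.symm) ε {z : ℂ | |z.im| ≤ R} n (-b) (-a) := by
  obtain ⟨δ, hδ, h⟩ := exists_dist_lt_on_strip f.symm.continuous hf.symm_comm R hε
  refine ⟨δ, hδ, fun n a b hab => ?_⟩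
  have h1 : ReachIn f.symm ε {z : ℂ | |z.im| ≤ R} n b a := hab.reverse fun z _ y hy hzy => by
    have := h y hy (f z) (by rwa [dist_comm])
    rwa [f.symm_apply_apply] at this
  refine h1.map Neg.neg (fun z y hzy => ?_) fun z hz => ?_
  · rwa [negConj_apply, neg_neg, dist_neg_neg]
  · change |(-z).im| ≤ R
    rwa [Complex.neg_im, abs_neg]

theorem reach_translate {f : ℂ ≃ₜ ℂ} (hf : IsAnnular f) {S : Set ℂ}
    (hS : ∀ z, z + 1 ∈ S ↔ z ∈ S) {ε : ℝ} (hε : 0 < ε) {x : ℂ} (hx : x ∈ S) {d : ℤ}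
    (hfx : f x = x + d) (n : ℕ) : ReachIn f ε S n x (x + (n * d : ℤ)) := by
  induction n with
  | zero => simpa using ReachIn.refl hx
  | succ n ih =>
    refine ih.step ?_ ((add_int_mem_iff hS _ _).2 hx)
    rw [map_add_int hf.comm, hfx]
    convert hε
    rw [dist_eq_zero]
    push_cast
    ring

/-- A pair of recurrent orbits turning in opposite directions produces a closed chain. -/
theorem exists_closed_chain {f : ℂ ≃ₜ ℂ} (hf : IsAnnular f) {S : Set ℂ}
    (hS : ∀ z, z + 1 ∈ S ↔ z ∈ S) {ε : ℝ} (hε : 0 < ε) {x y : ℂ} (hfx : f x = x + (-1 : ℤ)) {k : ℤ}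
    (hk : 0 < k) (hfy : f y = y + k) {n m : ℕ} {α β : ℤ} (hxy : ReachIn f ε S n x (y + α))
    (hyx : ReachIn f ε S m y (x + β)) : ∃ l, 1 ≤ l ∧ ReachIn f ε S l x x := by
  set b : ℕ := (α + β).natAbs + 1 with hb
  obtain ⟨a, ha⟩ : ∃ a : ℕ, (a : ℤ) = α + β + b * k := ⟨(α + β + b * k).toNat, by
    refine Int.toNat_of_nonneg ?_
    have h1 : (b : ℤ) ≤ b * k := le_mul_of_one_le_right (by positivity) hk
    omega⟩
  have hyS : y ∈ S := hyx.mem_left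
  have h1 := reach_translate hf hS hε hxy.mem_left hfx a
  have h2 := hf.reach_add_int hS hxy (a * (-1))
  have h3 := hf.reach_add_int hS (hf.reach_add_int hS (reach_translate hf hS hε hyS hfy b) α)
    (a * (-1))
  have h4 := hf.reach_add_int hS (hf.reach_add_int hS (hf.reach_add_int hS hyx (b * k)) α)
    (a * (-1))
  have h5 := ((h1.trans h2).trans h3).trans h4
  refine ⟨a + n + b + m, by omega, ?_⟩
  · convert h5 using 1
    have : ((a : ℤ) : ℂ) = ((α + β + b * k : ℤ) : ℂ) := by rw [ha]
    push_cast at this ⊢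
    linear_combination this

theorem exists_fixed_of_chain {P : ℂ → S2} {p m : S2} (hP : IsAnnCover P p m) {g : S2 ≃ₜ S2}
    {f : ℂ ≃ₜ ℂ} (hf : IsAnnular f) (hfg : ∀ z, P (f z) = g (P z)) {Vp Wp Vm Wm : Set S2}
    (hp : IsSink g.symm p Vp Wp) (hm : IsSink g m Vm Wm) (hgm : g m = m)
    (hpWm : p ∉ Wm) (hmWp : m ∉ Wp) (hne : (Wp ∩ Wm).Nonempty) {H : S2 → ℝ} (hH : Continuous H)
    (hmono : ∀ y, H (g y) ≤ H y) {a b : ℝ} (ha : ∀ y, H y ≤ a → H (g y) < a)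
    (hb : ∀ y, H y ≤ b → H (g y) < b) {x y : ℂ} (hfx : f x = x + (-1 : ℤ)) {k : ℤ} (hk : 0 < k)
    (hfy : f y = y + k) (hbx : b < H (P x)) (hxa : H (P x) < a)
    (hxy : ∀ ε > 0, ∃ n, ReachIn g ε univ n (P x) (P y))
    (hyx : ∀ ε > 0, ∃ n, ReachIn g ε univ n (P y) (P x)) :
    ∃ z, f z = z ∧ H (P z) ∈ Icc b a := by
  by_contra! hcon
  have hgP : ∀ (z : ℂ) (n : ℤ), f z = z + n → g (P z) = P z := fun z n h => by
    rw [← hfg, h, hP.add_int]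
  have hgs : ∀ (z : ℂ) (n : ℤ), f z = z + n → g.symm (P z) = P z := fun z n h =>
    g.symm_apply_eq.2 (hgP z n h).symm
  have hVp : ∀ (z : ℂ) (n : ℤ), f z = z + n → P z ∉ closure Vp := fun z n h h' =>
    hP.ne_top z (hp.eq_of_fixed h' (hgs z n h))
  have hmVp : m ∉ closure Vp := fun h =>
    hP.ne.symm (hp.eq_of_fixed h (g.symm_apply_eq.2 hgm.symm))
  obtain ⟨R, hR⟩ := exists_strip_chain hP hf hfg hp hm
  have hxy' := hR x y (fun h => hVp x _ hfx (subset_closure h))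
    (fun h => hP.ne_bot y (hm.eq_of_fixed h (hgP y k hfy))) hxy
  have hyx' := hR y x (fun h => hVp y _ hfy (subset_closure h))
    (fun h => hP.ne_bot x (hm.eq_of_fixed h (hgP x _ hfx))) hyx
  have hSper : ∀ z : ℂ, z + 1 ∈ {z : ℂ | |z.im| ≤ R} ↔ z ∈ {z : ℂ | |z.im| ≤ R} := fun z => by
    change |(z + 1).im| ≤ R ↔ |z.im| ≤ R
    simp
  have hP1 : ∀ z, P (z + 1) = P z := fun z => by simpa using hP.add_int z 1
  obtain ⟨MP, hMP⟩ := hP.top Vp hp.isOpen hp.mem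
  -- the sublevel side
  obtain ⟨A₀, hA₀⟩ : ∃ A₀ : Set ℂ, ∀ z, z ∈ A₀ ↔ H (P z) < a ∧ P z ∉ closure Vp :=
    ⟨{z | H (P z) < a ∧ P z ∉ closure Vp}, fun _ => Iff.rfl⟩
  have hA₀e : A₀ = P ⁻¹' (H ⁻¹' Iio a ∩ (closure Vp)ᶜ) := Set.ext hA₀
  have hA₀o : IsOpen A₀ := by
    rw [hA₀e]
    exact ((isOpen_Iio.preimage hH).inter isClosed_closure.isOpen_compl).preimage hP.cont
  have hA₀c : closure A₀ ⊆ P ⁻¹' (H ⁻¹' Iic a ∩ Vpᶜ) := by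
    refine closure_minimal ?_
      (((isClosed_Iic.preimage hH).inter hp.isOpen.isClosed_compl).preimage hP.cont)
    rw [hA₀e]
    exact preimage_mono (inter_subset_inter (preimage_mono Iio_subset_Iic_self)
      (compl_subset_compl.2 subset_closure))
  have hxA₀ : x ∈ A₀ := (hA₀ x).2 ⟨hxa, hVp x _ hfx⟩
  obtain ⟨C, hC⟩ : ∃ C, IsTrap f C (connectedComponentIn A₀ x) := by
    refine exists_isTrap_component hP hf hfg hp hm hpWm hmWp hne hA₀o (fun z => ?_)
      (fun z hz => ?_) (M := MP) (fun z hz => ?_) (N := 0) (fun z hz => ?_) (fun z hz hzW => ?_)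
      hxA₀ hfx (show (-1 : ℤ) < k by omega) (R := R) (fun ε hε => ?_)
    · rw [hA₀, hA₀, hP1]
    · obtain ⟨h1, h2⟩ := hA₀c hz
      rw [hA₀, hfg]
      exact ⟨ha _ h1, fun h => h2 (by simpa using hp.trap _ h)⟩
    · by_contra! h
      exact ((hA₀ z).1 hz).2 (subset_closure (hMP z h.le))
    · exact fun h => ((hA₀ z).1 hz).2 (subset_closure h)
    · have hHm : H m ≤ H (P z) := by
        by_contra! h
        obtain ⟨n, hn⟩ := hm.tendsto hzW (isOpen_Ioi.preimage hH) h
        have h1 : ∀ n, H (g^[n] (P z)) ≤ H (P z) := fun n => by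
          induction n with
          | zero => exact le_rfl
          | succ n ih =>
            rw [iterate_succ_apply']
            exact (hmono _).trans ih
        exact (h1 n).not_gt hn
      obtain ⟨M, hM⟩ := hP.bot (H ⁻¹' Iio a ∩ (closure Vp)ᶜ)
        ((isOpen_Iio.preimage hH).inter isClosed_closure.isOpen_compl)
        ⟨hHm.trans_lt ((hA₀ z).1 hz).1, hmVp⟩
      exact ⟨M, fun w hw => (hA₀ w).2 (hM w hw.le)⟩
    · obtain ⟨n, α, h⟩ := hxy' ε hε
      exact ⟨n, _, by rw [map_add_int hf.comm, hfy]; ring, h⟩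
  have hxA := mem_connectedComponentIn hxA₀
  have hAA₀ : connectedComponentIn A₀ x ⊆ A₀ := connectedComponentIn_subset A₀ x
  generalize connectedComponentIn A₀ x = A at hC hxA hAA₀
  -- the superlevel side
  obtain ⟨U, hU, hmU, hUC⟩ := hP.exists_nhds_bot (-C)
  obtain ⟨V, hV, hVU⟩ := hm.exists_small hgm hU hmU
  have hVA : ∀ z, P z ∈ closure V → z ∈ A := fun z hz => hC.bot z (hUC z (hVU hz))
  obtain ⟨B, hB⟩ : ∃ B : Set ℂ, ∀ z, z ∈ B ↔
      f.symm z ∈ closure A ∧ (H (P (f.symm z)) ≤ b ∨ P (f.symm z) ∈ closure V) :=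
    ⟨{z | f.symm z ∈ closure A ∧ (H (P (f.symm z)) ≤ b ∨ P (f.symm z) ∈ closure V)},
      fun _ => Iff.rfl⟩
  have hPf : Continuous fun z => P (f.symm z) := hP.cont.comp f.symm.continuous
  have hBc : IsClosed B := by
    have : B = f.symm ⁻¹' closure A ∩ (fun z => P (f.symm z)) ⁻¹' (H ⁻¹' Iic b ∪ closure V) :=
      Set.ext hB
    rw [this]
    exact (isClosed_closure.preimage f.symm.continuous).inter
      (((isClosed_Iic.preimage hH).union isClosed_closure).preimage hPf)
  have hBA : B ⊆ A := fun z hz => by simpa using hC.trap _ ((hB z).1 hz).1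
  have hBper : ∀ z, z + 1 ∈ B ↔ z ∈ B := fun z => by
    rw [hB, hB, hf.symm_comm, hP1, mem_closure_periodic hC.per]
  have hE₀o : IsOpen Bᶜ := hBc.isOpen_compl
  have hBtrap : ∀ z ∈ closure Bᶜ, f.symm z ∉ B := by
    intro z hz hzB
    have hO : IsOpen (f.symm ⁻¹' A ∩ (fun z => P (f.symm z)) ⁻¹' (H ⁻¹' Iio b ∪ V)) :=
      (hC.isOpen.preimage f.symm.continuous).inter
        (((isOpen_Iio.preimage hH).union hV.isOpen).preimage hPf)
    obtain ⟨w, ⟨hw1, hw2⟩, hwB⟩ := mem_closure_iff.1 hz _ hO ⟨hBA hzB, by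
      have h1 : P (f.symm z) = g (P (f.symm (f.symm z))) := by rw [← hfg, f.apply_symm_apply]
      change P (f.symm z) ∈ H ⁻¹' Iio b ∪ V
      rw [h1]
      exact ((hB _).1 hzB).2.imp (hb _) (hV.trap _)⟩
    exact hwB ((hB w).2 ⟨subset_closure hw1, hw2.imp (fun h => le_of_lt h) fun h => subset_closure h⟩)
  have hxB : x ∉ B := by
    intro hx
    have h1 : P (f.symm x) = P x := g.injective (by
      rw [← hfg, f.apply_symm_apply, hgP x _ hfx])
    have h2 := ((hB x).1 hx).2
    rw [h1] at h2
    exact h2.elim (fun h => h.not_gt hbx) fun h => hP.ne_bot x (hV.eq_of_fixed h (hgP x _ hfx))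
  obtain ⟨M₂, hM₂⟩ : ∃ M₂, ∀ z : ℂ, z.im ≤ M₂ → z ∈ B := by
    obtain ⟨M₁, hM₁⟩ := hP.bot V hV.isOpen hV.mem
    obtain ⟨M₂, hM₂⟩ := hf.symm.bot M₁
    refine ⟨M₂, fun z hz => (hB _).2 ?_⟩
    have h1 := hM₁ _ (hM₂ z hz)
    exact ⟨subset_closure (hVA _ (subset_closure h1)), Or.inr (subset_closure h1)⟩
  have hneg : ∀ D : Set ℂ, IsOpen D → IsOpen (Neg.neg ⁻¹' D) := fun D hD => hD.preimage continuous_neg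
  obtain ⟨C', hC'⟩ : ∃ C', IsTrap (negConj f.symm) C'
      (connectedComponentIn (Neg.neg ⁻¹' Bᶜ) (-x)) := by
    refine exists_isTrap_component hP.neg hf.symm.negConj (g := g.symm) (fun z => ?_)
      (Vp := V) (Vm := Vp) hV hp hmWp hpWm (by rwa [inter_comm]) (hneg _ hE₀o)
      (fun z => ?_) (fun z hz => ?_) (M := -M₂) (fun z hz => ?_) (N := 1) (fun z hz hzV => ?_)
      (fun z _ _ => ⟨-C, fun w hw hwB => ?_⟩)
      (show -(-x) ∈ Bᶜ by rwa [neg_neg]) (d := -1) ?_ (show (-1 : ℤ) < k by omega) (R := R)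
      (fun ε hε => ?_)
    · change P (-(-f.symm (- z))) = _
      rw [neg_neg, eq_comm, g.symm_apply_eq, ← hfg, f.apply_symm_apply]
    · change -(z + 1) ∉ B ↔ -z ∉ B
      rw [← hBper (-(z + 1))]
      simp
    · change -(-f.symm (-z)) ∉ B
      rw [neg_neg]
      exact hBtrap _ (mem_closure_neg.1 hz)
    · by_contra! h
      exact hz (hM₂ (-z) (by rw [Complex.neg_im]; linarith))
    · change P (-(-f.symm (- z))) ∈ V at hzV
      rw [neg_neg] at hzV
      exact hz ((hB _).2 ⟨subset_closure (hVA _ (subset_closure hzV)), Or.inr (subset_closure hzV)⟩)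
    · exact hC.top (-w) (by rw [Complex.neg_im]; linarith) (subset_closure (hBA hwB))
    · rw [negConj_apply, neg_neg, neg_eq_iff_eq_neg, f.symm_apply_eq]
      have := map_add_int hf.comm x 1
      rw [hfx] at this
      convert this.symm using 1
      · push_cast; ring
      · congr 1; push_cast; ring
    · obtain ⟨δ, hδ, h⟩ := exists_reverse_chain hf R hε
      obtain ⟨n, β, hβ⟩ := hyx' δ hδ
      have h1 := h _ _ _ (hf.reach_add_int hSper hβ (-β))
      refine ⟨n, -(y + (-β : ℤ)), ?_, ?_⟩
      · rw [negConj_apply, neg_neg, neg_eq_iff_eq_neg, f.symm_apply_eq]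
        have := map_add_int hf.comm y (-β - k)
        rw [hfy] at this
        convert this.symm using 1
        · push_cast; ring
        · congr 1; push_cast; ring
      · convert h1 using 1
        push_cast
        ring
  have hxE := mem_connectedComponentIn (show x ∈ Bᶜ from hxB)
  have hEB : connectedComponentIn Bᶜ x ⊆ Bᶜ := connectedComponentIn_subset _ x
  have hEcl := closure_connectedComponentIn_subset hE₀o x
  have hEeq : connectedComponentIn (Neg.neg ⁻¹' Bᶜ) (-x) = Neg.neg ⁻¹' connectedComponentIn Bᶜ x := by
    have := (Homeomorph.neg ℂ).image_connectedComponentIn (s := Bᶜ) (x := x) hxB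
    rw [Homeomorph.coe_neg, image_neg_eq_neg, image_neg_eq_neg] at this
    exact this.symm
  rw [hEeq] at hC'
  have hconn : IsPreconnected (A ∪ (connectedComponentIn Bᶜ x)ᶜ) :=
    isPreconnected_union_compl_connectedComponentIn hE₀o hC.conn (by rwa [compl_compl]) (by
      rw [compl_compl]
      exact ⟨⟨0, M₂⟩, hM₂ _ le_rfl⟩) x
  generalize connectedComponentIn Bᶜ x = E at hC' hxE hEB hEcl hconn
  have hEo : IsOpen E := by simpa using hneg _ hC'.isOpen
  have hEper : ∀ z, z + 1 ∈ E ↔ z ∈ E := fun z => by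
    have := hC'.per (-(z + 1))
    simpa using this.symm
  have hEtrap : ∀ z ∈ closure E, f.symm z ∈ E := fun z hz => by
    simpa using hC'.trap (-z) (mem_closure_neg.2 (by rwa [neg_neg]))
  have hEtop : ∀ z : ℂ, C' < z.im → z ∈ E := fun z hz => by
    simpa using hC'.bot (-z) (by rw [Complex.neg_im]; linarith)
  have hEtrap' : ∀ z ∈ Eᶜ, f z ∈ (closure E)ᶜ := fun z hz h => hz (by simpa using hEtrap _ h)
  have hpair : IsTrapPair f (max C C') (A ∪ Eᶜ) E := by
    refine ⟨⟨?_, hconn, fun z => ?_, fun z hz => ?_, fun z hz => Or.inl (hC.bot z ?_),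
      fun z hz hz' => ?_⟩, IsTrap.mono hC' (le_max_right _ _), ?_, fun z hz hfz => ?_⟩
    · have : A ∪ Eᶜ = A ∪ (closure E)ᶜ := by
        refine subset_antisymm (union_subset subset_union_left fun z hz => ?_)
          (union_subset_union_right _ (compl_subset_compl.2 subset_closure))
        by_cases h : z ∈ closure E
        · refine Or.inl (hBA ?_)
          simpa using (hEcl h).resolve_left hz
        · exact Or.inr h
      rw [this]
      exact hC.isOpen.union isClosed_closure.isOpen_compl
    · rw [mem_union, mem_union, mem_compl_iff, mem_compl_iff, hC.per, hEper]
    · rw [closure_union, hEo.isClosed_compl.closure_eq] at hz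
      exact hz.imp (hC.trap z) fun h h' => hEtrap' z h (subset_closure h')
    · have := le_max_left C C'
      linarith
    · rw [closure_union, hEo.isClosed_compl.closure_eq] at hz'
      exact hz'.elim (hC.top z ((le_max_left _ _).trans_lt hz))
        fun h => h (hEtop z ((le_max_right _ _).trans_lt hz))
    · rw [union_assoc, compl_union_self, union_univ]
    · have hzA : z ∈ A := hz.1.resolve_right fun h => h hz.2
      refine hcon z hfz ⟨?_, ((hA₀ z).1 (hAA₀ hzA)).1.le⟩
      by_contra! h
      refine hEB hz.2 ((hB z).2 ?_)
      rw [f.symm_apply_eq.2 hfz.symm]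
      exact ⟨subset_closure hzA, Or.inl h.le⟩
  obtain ⟨ε, hε, hno⟩ := hpair.no_closed_chain hf
  obtain ⟨ε₁, hε₁, hb₁⟩ := exists_ball_subset_on_strip f.continuous hf.comm hC.isOpen hC.per
    isClosed_closure (mem_closure_periodic hC.per) hC.trap R
  obtain ⟨ε₂, hε₂, hb₂⟩ := exists_ball_subset_on_strip f.continuous hf.comm
    (isClosed_closure (s := E)).isOpen_compl (fun z => not_congr (mem_closure_periodic hEper z))
    hEo.isClosed_compl (fun z => not_congr (hEper z)) hEtrap' R
  have hδ : 0 < min ε (min ε₁ ε₂) := lt_min hε (lt_min hε₁ hε₂)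
  obtain ⟨n, α, hα⟩ := hxy' _ hδ
  obtain ⟨n', β, hβ⟩ := hyx' _ hδ
  obtain ⟨l, hl, hll⟩ := exists_closed_chain hf hSper hδ hfx hk hfy hα hβ
  have h1 := hll.restrict (A := A) hxA fun z hz hzA w _ hzw => hb₁ z hz (subset_closure hzA)
    (mem_ball'.2 (hzw.trans_le ((min_le_right _ _).trans (min_le_left _ _))))
  have h2 := h1.restrict_compl (B := Eᶜ) (fun h => h hxE) fun z hzS hz w hzw hwE => hb₂ z hzS.1 hz
    (mem_ball'.2 (hzw.trans_le ((min_le_right _ _).trans (min_le_right _ _)))) (subset_closure hwE)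
  obtain ⟨z, hz0, hzl, hzS, hzd⟩ := h2.exists_fun
  exact hno l z hl (hzl.trans hz0.symm) (fun i hi => (hzd i hi).trans_le (min_le_left _ _))
    fun i hi => ⟨Or.inl (hzS i hi.le).1.2, not_not.1 (hzS i hi.le).2⟩

theorem Homeomorph.exists_iterate {X : Type*} [TopologicalSpace X] (h : X ≃ₜ X) (n : ℕ) :
    ∃ G : X ≃ₜ X, (∀ y, G y = h^[n] y) ∧ ∀ y, G.symm y = h.symm^[n] y :=
  ⟨{  toFun := h^[n]
      invFun := h.symm^[n]
      left_inv := LeftInverse.iterate h.symm_apply_apply n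
      right_inv := LeftInverse.iterate h.apply_symm_apply n
      continuous_toFun := h.continuous.iterate n
      continuous_invFun := h.symm.continuous.iterate n }, fun _ => rfl, fun _ => rfl⟩

theorem IsSink.notMem_basin_of_fixed {X : Type*} [TopologicalSpace X] [T1Space X] {g : X ≃ₜ X}
    {m : X} {V W : Set X} (h : IsSink g m V W) {p : X} (hp : g p = p) (hpm : p ≠ m) : p ∉ W := by
  intro hW
  obtain ⟨n, hn⟩ := h.tendsto hW (U := {p}ᶜ) isOpen_compl_singleton hpm.symm
  exact hn (iterate_fixed hp n)

theorem ReachIn.epsChainFromTo {X : Type*} [MetricSpace X] {h : X → X} {ε : ℝ} {S : Set X} {n : ℕ}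
    {a b : X} (hn : 1 ≤ n) (hab : ReachIn h ε S n a b) : EpsChainFromTo h ε a b := by
  obtain ⟨z, h0, h1, -, h2⟩ := hab.exists_fun
  exact ⟨n, z, ⟨hn, h2⟩, h0, h1⟩

theorem ChainRecurrent.chainEquiv_apply {X : Type*} [MetricSpace X] {h : X → X}
    (hh : UniformContinuous h) {y : X} (hy : ChainRecurrent h y) : ChainEquiv h y (h y) := by
  have h1 : ∀ ε > 0, ReachIn h ε univ 1 y (h y) := fun ε hε =>
    ReachIn.iterate hε 1 fun _ _ => mem_univ _
  have h2 : ∀ ε > 0, ∃ n, ReachIn h ε univ (n + 1) (h y) y := by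
    intro ε hε
    obtain ⟨δ, hδ, hδε⟩ := Metric.uniformContinuous_iff.1 hh (ε / 2) (half_pos hε)
    obtain ⟨r, z, ⟨hr, hz⟩, h0, hzr⟩ := hy (min δ (ε / 2)) (lt_min hδ (half_pos hε))
    have hyy := ReachIn.of_fun hz
    rw [h0, hzr] at hyy
    obtain ⟨n, rfl⟩ := Nat.exists_eq_add_of_le' hr
    have h3 := hyy.loop 2
    rw [show 2 * (n + 1) = 0 + 1 + (0 + 1 + 2 * n) by ring] at h3
    obtain ⟨c, hc, h4⟩ := h3.split
    obtain ⟨c', hc', h5⟩ := h4.split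
    cases hc with
    | step h6 h7 =>
      cases h6
      cases hc' with
      | step h8 h9 =>
        cases h8
        refine ⟨2 * n, ?_⟩
        rw [add_comm]
        refine ReachIn.trans ?_ (h5.mono ((min_le_right _ _).trans (half_le_self hε.le)) subset_rfl)
        refine (ReachIn.refl (mem_univ _)).step ?_ (mem_univ _)
        have h10 := hδε (h7.trans_le (min_le_left _ _))
        have h11 := h9.trans_le (min_le_right δ (ε / 2))
        linarith [dist_triangle (h (h y)) (h c) c']
  refine ⟨hy, fun ε hε => ?_, fun ε hε => ⟨(h1 ε hε).epsChainFromTo le_rfl, ?_⟩⟩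
  · obtain ⟨n, hn⟩ := h2 ε hε
    exact (hn.trans (h1 ε hε)).epsChainFromTo (by omega)
  · obtain ⟨n, hn⟩ := h2 ε hε
    exact hn.epsChainFromTo (by omega)

namespace IsCompleteLyapunov

variable {h : S2 → S2} {H : S2 → ℝ}

theorem apply_eq (hL : IsCompleteLyapunov h H) (hh : Continuous h) {y : S2}
    (hy : ChainRecurrent h y) : H (h y) = H y := by
  have h1 := hy.chainEquiv_apply (CompactSpace.uniformContinuous_of_continuous hh)
  exact ((hL.2.2.1 y (h y) hy h1.2.1).2 h1).symm

theorem apply_le (hL : IsCompleteLyapunov h H) (hh : Continuous h) (y : S2) : H (h y) ≤ H y := by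
  by_cases hy : ChainRecurrent h y
  · exact (hL.apply_eq hh hy).le
  · exact (hL.2.1 y hy).le

theorem iterate_le (hL : IsCompleteLyapunov h H) (hh : Continuous h) (n : ℕ) (y : S2) :
    H (h^[n] y) ≤ H y := by
  induction n with
  | zero => exact le_rfl
  | succ n ih =>
    rw [iterate_succ_apply']
    exact (hL.apply_le hh _).trans ih

theorem apply_lt (hL : IsCompleteLyapunov h H) (hh : Continuous h) {a : ℝ}
    (ha : a ∉ H '' chainRecSet h) {y : S2} (hy : H y ≤ a) : H (h y) < a := by
  by_cases hc : ChainRecurrent h y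
  · rw [hL.apply_eq hh hc]
    exact hy.lt_of_ne fun h => ha ⟨y, hc, h⟩
  · exact (hL.2.1 y hc).trans_le hy

theorem iterate_lt (hL : IsCompleteLyapunov h H) (hh : Continuous h) {a : ℝ}
    (ha : a ∉ H '' chainRecSet h) {n : ℕ} (hn : 0 < n) {y : S2} (hy : H y ≤ a) :
    H (h^[n] y) < a := by
  obtain ⟨k, rfl⟩ := Nat.exists_eq_succ_of_ne_zero hn.ne'
  rw [iterate_succ_apply]
  exact (hL.iterate_le hh k _).trans_lt (hL.apply_lt hh ha hy)

end IsCompleteLyapunov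

/-- Proposition 3.5 (p2a). -/
theorem statement3
    (h : S2 ≃ₜ S2) (pinf minf : S2) (Winf Wminf : Set S2)
    (hAR : IsNontrivAR h pinf minf Winf Wminf)
    (hA : Ann ≃ₜ Ann)
    (e : Ann ≃ₜ ↥({pinf, minf}ᶜ : Set S2))
    (he_comm : ∀ p : Ann, ((e (hA p) : S2)) = h ((e p : S2)))
    (he_top : Filter.Tendsto (fun p : Ann => ((e p : S2))) (Filter.comap Prod.snd Filter.atTop) (nhds pinf))
    (he_bot : Filter.Tendsto (fun p : Ann => ((e p : S2))) (Filter.comap Prod.snd Filter.atBot) (nhds minf))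
    (ht : ℝ × ℝ → ℝ × ℝ) (hlift : IsAnnulusLift (⇑hA) ht)
    (q : ℕ) (hq : 0 < q) (p₁ p₂ : ℤ) (hp : p₁ + 1 < p₂)
    (C₀ : Set S2) (hC₀ : IsChainClass (⇑h) C₀)
    (x₁ x₂ : Ann) (hmem₁ : ((e x₁ : S2)) ∈ C₀) (hmem₂ : ((e x₂ : S2)) ∈ C₀)
    (xl₁ xl₂ : ℝ × ℝ) (hl₁ : annP xl₁ = x₁) (hl₂ : annP xl₂ = x₂)
    (hfix₁ : ht^[q] xl₁ = deckPow p₁ xl₁) (hfix₂ : ht^[q] xl₂ = deckPow p₂ xl₂)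
    (H : S2 → ℝ) (hsmooth : ContMDiff (𝓡 2) 𝓘(ℝ, ℝ) (⊤ : ℕ∞) H)
    (hLyap : IsCompleteLyapunov (⇑h) H) (hH0 : H '' C₀ = {0})
    (a' a : ℝ) (ha' : 0 < a') (ha : 0 < a)
    (hdynreg' : -a' ∉ H '' chainRecSet (⇑h)) (hdynreg : a ∉ H '' chainRecSet (⇑h))
    (hreg' : IsRegularValue H (-a')) (hreg : IsRegularValue H a) :
    ∃ (x : Ann) (xl : ℝ × ℝ), H ((e x : S2)) ∈ Set.Icc (-a') a ∧ annP xl = x ∧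
      ht^[q] xl = deckPow (p₁ + 1) xl := by
  obtain ⟨hmf, Vm, hVm⟩ := hAR.attractor.exists_isSink
  obtain ⟨hpf', Vp, hVp⟩ := hAR.repellor.exists_isSink
  have hpf : h pinf = pinf := (h.symm_apply_eq.1 hpf').symm
  obtain ⟨g, hg, hgs⟩ := h.exists_iterate q
  have hgc : (g : S2 → S2) = h^[q] := funext hg
  have hP := isAnnCover_of_homeomorph hAR.distinct e he_top he_bot
  obtain ⟨F, hF1, hFt⟩ := hlift.exists_homeomorph
    (lift_add_one hAR.orient hAR.distinct hpf hmf e he_comm hlift)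
  obtain ⟨P, hPe⟩ : ∃ P : ℂ → S2, ∀ z, P z = (e (annP (Complex.equivRealProd z))).1 :=
    ⟨_, fun _ => rfl⟩
  rw [← funext hPe] at hP
  have hPF : ∀ z, P (F z) = h (P z) := fun z => by
    rw [hPe, hPe, hFt, hlift.2, he_comm]
  obtain ⟨G, hG, -⟩ := F.exists_iterate q
  have hGt : ∀ z, Complex.equivRealProd (G z) = ht^[q] (Complex.equivRealProd z) := fun z => by
    rw [hG]
    exact Semiconj.iterate_right (f := Complex.equivRealProd) (ga := F) (gb := ht) hFt q z
  have hPG : ∀ z, P (G z) = g (P z) := fun z => by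
    rw [hG, hg, semiconj_iterate hPF]
  have hFn : ∀ n z, F^[n] (z + 1) = F^[n] z + 1 := fun n z => by
    have h1 : Function.Commute F (fun z => z + 1) := fun z => hF1 z
    exact h1.iterate_left n z
  have hdeck : ∀ z (n : ℤ), ht^[q] (Complex.equivRealProd z) = deckPow n (Complex.equivRealProd z) ↔
      G z = z + n := fun z n => by
    rw [← hGt, ← Complex.equivRealProd.injective.eq_iff (a := G z)]
    simp [deckPow, Complex.equivRealProd_apply]
  set f : ℂ ≃ₜ ℂ := G.trans (Homeomorph.addRight (-(p₁ + 1 : ℤ) : ℂ)) with hf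
  have hfG : ∀ z, f z = G z + (-(p₁ + 1) : ℤ) := fun z => by
    rw [hf, Homeomorph.trans_apply, Homeomorph.coe_addRight]
    push_cast
    ring
  have hf1 : ∀ z, f (z + 1) = f z + 1 := fun z => by
    rw [hfG, hfG, hG, hG, hFn]
    ring
  have hPf : ∀ z, P (f z) = g (P z) := fun z => by
    rw [hfG, hP.add_int, hPG]
  have hgm : g minf = minf := by rw [hg, iterate_fixed hmf]
  have hgp : g pinf = pinf := by rw [hg, iterate_fixed hpf]
  have hfa : IsAnnular f := hP.isAnnular g.continuous hgp hgm hf1 hPf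
  obtain ⟨x, rfl⟩ := Complex.equivRealProd.surjective xl₁
  obtain ⟨w, rfl⟩ := Complex.equivRealProd.surjective xl₂
  rw [hdeck] at hfix₁ hfix₂
  rw [← hl₁, ← hPe] at hmem₁
  rw [← hl₂, ← hPe] at hmem₂
  have hHx : H (P x) = 0 := by
    have : H (P x) ∈ H '' C₀ := ⟨_, hmem₁, rfl⟩
    rwa [hH0] at this
  obtain ⟨x₀, -, rfl⟩ := hC₀
  have hhu : UniformContinuous h := CompactSpace.uniformContinuous_of_continuous h.continuous
  obtain ⟨j, hj⟩ := ReachIn.exists_common_iterate (a := P x) (b := P w) hhu hq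
    (by rw [← hg, ← hPG, hfix₂, hP.add_int])
    (fun ε hε => by
      obtain ⟨r, hr⟩ := (hmem₁.2.2 ε hε).2.reachIn
      obtain ⟨s, hs⟩ := (hmem₂.2.2 ε hε).1.reachIn
      exact ⟨_, hr.trans hs⟩)
    (fun ε hε => by
      obtain ⟨r, hr⟩ := (hmem₂.2.2 ε hε).2.reachIn
      obtain ⟨s, hs⟩ := (hmem₁.2.2 ε hε).1.reachIn
      exact ⟨_, hr.trans hs⟩)
  rw [← hgc, ← semiconj_iterate hPF] at hj
  obtain ⟨z, hz, hHz⟩ := exists_fixed_of_chain hP hfa hPf (Vp := Vp) (Wp := Winf) (Vm := Vm)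
    (Wm := Wminf) (hVp.iterate hq hgs) (hVm.iterate hq hg) hgm
    (hVm.notMem_basin_of_fixed hpf hAR.distinct)
    (hVp.notMem_basin_of_fixed (h.symm_apply_eq.2 hmf.symm) hAR.distinct.symm)
    (by rw [inter_comm]; exact hAR.basins_meet) hLyap.1
    (fun y => by rw [hg]; exact hLyap.iterate_le h.continuous q y) (a := a) (b := -a')
    (fun y hy => by rw [hg]; exact hLyap.iterate_lt h.continuous hdynreg hq hy)
    (fun y hy => by rw [hg]; exact hLyap.iterate_lt h.continuous hdynreg' hq hy)
    (x := x) (y := F^[j] w) (by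
      rw [hfG, hfix₁]
      push_cast
      ring) (k := p₂ - p₁ - 1) (by omega) (by
      rw [hfG, hG, ← iterate_add_apply, add_comm q j, iterate_add_apply, ← hG, hfix₂,
        map_add_int (hFn j)]
      push_cast
      ring) (by rw [hHx]; linarith) (by rwa [hHx]) (fun ε hε => (hj ε hε).1)
    fun ε hε => (hj ε hε).2
  refine ⟨_, Complex.equivRealProd z, ?_, rfl, (hdeck _ _).2 ?_⟩
  · rwa [← hPe]
  · rw [hfG] at hz
    push_cast at hz ⊢
    linear_combination hz
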